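/- Let G ~ G_{n,1/2} and let a = a(n) be a sequence of integers such that n^{1.1} < μ_a < n^{2.9}. Then there is a constant C > 0 such that, with high probability as n → ∞, |χ_a(G) − k_a(n)| ≤ C·n^{0.99}, where k_a(n) is the a-bounded first moment threshold. -/

import Mathlib

open Filter
open scoped BigOperators Classical

noncomputable section

/-- The number of edges of a simple graph on `Fin n`. -/
def edgeCount {n : ℕ} (G : SimpleGraph (Fin n)) : ℕ := Nat.card G.edgeSet

/-- Probability of a graph property under the uniform random graph `G(n,m)`. -/
def Pm (n m : ℕ) (E : SimpleGraph (Fin n) → Prop) : ℝ :=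
  (Nat.card {G : SimpleGraph (Fin n) // edgeCount G = m ∧ E G} : ℝ) /
    (Nat.card {G : SimpleGraph (Fin n) // edgeCount G = m} : ℝ)

/-- Expectation of a real functional under the uniform random graph `G(n,m)`. -/
def Em (n m : ℕ) (X : SimpleGraph (Fin n) → ℝ) : ℝ :=
  (∑ᶠ G : {G : SimpleGraph (Fin n) // edgeCount G = m}, X G.1) /
    (Nat.card {G : SimpleGraph (Fin n) // edgeCount G = m} : ℝ)

/-- Probability of a graph property under the binomial random graph `G(n,p)`. -/
def Pp (n : ℕ) (p : ℝ) (E : SimpleGraph (Fin n) → Prop) : ℝ :=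
  ∑ᶠ G : SimpleGraph (Fin n),
    (if E G then (1 : ℝ) else 0) * p ^ edgeCount G * (1 - p) ^ (n.choose 2 - edgeCount G)

/-- Expectation of a real functional under the binomial random graph `G(n,p)`. -/
def Ep (n : ℕ) (p : ℝ) (X : SimpleGraph (Fin n) → ℝ) : ℝ :=
  ∑ᶠ G : SimpleGraph (Fin n),
    X G * p ^ edgeCount G * (1 - p) ^ (n.choose 2 - edgeCount G)

/-- `α₀(n) = 2 log_b n − 2 log_b log_b n + 2 log_b (e/2) + 1`. -/
def alpha0 (b : ℝ) (n : ℕ) : ℝ :=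
  2 * Real.logb b n - 2 * Real.logb b (Real.logb b n) + 2 * Real.logb b (Real.exp 1 / 2) + 1

/-- `α(n) = ⌊α₀(n)⌋`. -/
def alphaNat (b : ℝ) (n : ℕ) : ℕ := ⌊alpha0 b n⌋₊

/-- `μ_t = C(n,t) q^{C(t,2)}`, the expected number of independent `t`-sets. -/
def muExp (q : ℝ) (n t : ℕ) : ℝ := (n.choose t : ℝ) * q ^ t.choose 2

/-- A finset of vertices is independent in `G`. -/
def IndepFinset {n : ℕ} (G : SimpleGraph (Fin n)) (s : Finset (Fin n)) : Prop :=
  ∀ v ∈ s, ∀ w ∈ s, ¬ G.Adj v w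

/-- `G` has a proper colouring with `k` colours, all colour classes of size at most `t`. -/
def HasBoundedColouring {n : ℕ} (G : SimpleGraph (Fin n)) (t k : ℕ) : Prop :=
  ∃ C : Fin n → Fin k, (∀ v w, G.Adj v w → C v ≠ C w) ∧
    ∀ c : Fin k, (Finset.univ.filter fun v => C v = c).card ≤ t

/-- The `t`-bounded chromatic number `χ_t(G)`. -/
def chiBounded {n : ℕ} (G : SimpleGraph (Fin n)) (t : ℕ) : ℕ :=
  sInf {k | HasBoundedColouring G t k}

/-- `G` has an equitable proper colouring with `k` colours. -/
def HasEquitableColouring {n : ℕ} (G : SimpleGraph (Fin n)) (k : ℕ) : Prop :=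
  ∃ C : Fin n → Fin k, (∀ v w, G.Adj v w → C v ≠ C w) ∧
    ∀ c c' : Fin k,
      (Finset.univ.filter fun v => C v = c).card ≤
        (Finset.univ.filter fun v => C v = c').card + 1

/-- The equitable chromatic number `χ₌(G)`. -/
def chiEquitable {n : ℕ} (G : SimpleGraph (Fin n)) : ℕ :=
  sInf {k | HasEquitableColouring G k}

/-- The number of unordered `t`-bounded proper `k`-colourings of `G`, i.e. partitions of the
vertex set into exactly `k` nonempty independent sets, each of size at most `t`. -/
def numUnorderedColourings (n t k : ℕ) (G : SimpleGraph (Fin n)) : ℕ :=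
  Set.ncard {Q : Finset (Finset (Fin n)) | Q.card = k ∧
    (∀ s ∈ Q, s.Nonempty ∧ s.card ≤ t ∧ IndepFinset G s) ∧
    (∀ v : Fin n, ∃ s ∈ Q, v ∈ s) ∧
    ∀ s ∈ Q, ∀ s' ∈ Q, s ≠ s' → Disjoint s s'}

/-- `E_{n,k,t}`: the expected number of unordered `t`-bounded `k`-colourings of `G_{n,1/2}`. -/
def Enkt (n k t : ℕ) : ℝ := Ep n (1/2) fun G => (numUnorderedColourings n t k G : ℝ)

/-- The `t`-bounded first moment threshold `k_t(n)`. -/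
def fmThreshold (n t : ℕ) : ℕ := sInf {k | 1 ≤ Enkt n k t}

/-- `P` is a (possibly partial) `k`-colouring profile on `n` vertices. -/
def IsProfile (n k : ℕ) (P : ℕ → ℕ) : Prop :=
  (∀ u, u ∉ Finset.Icc 1 n → P u = 0) ∧
    (∑ u ∈ Finset.Icc 1 n, P u = k) ∧ (∑ u ∈ Finset.Icc 1 n, u * P u ≤ n)

/-- A colouring profile is complete if its classes use all `n` vertices. -/
def IsCompleteProfile (n : ℕ) (P : ℕ → ℕ) : Prop :=
  ∑ u ∈ Finset.Icc 1 n, u * P u = n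

/-- A colouring profile is `t`-bounded if it has no classes of size larger than `t`. -/
def IsBoundedProfile (t : ℕ) (P : ℕ → ℕ) : Prop := ∀ u, t < u → P u = 0

/-- The number of parts of a profile on `n` vertices. -/
def profileParts (n : ℕ) (P : ℕ → ℕ) : ℕ := ∑ u ∈ Finset.Icc 1 n, P u

/-- `X_k`: the number of ordered (partial) proper colourings of `G` with profile `P`:
ordered tuples of pairwise disjoint independent sets, decreasing in size, with exactly
`P u` parts of size `u` for every `u`. -/
def Xprofile {n : ℕ} (G : SimpleGraph (Fin n)) (P : ℕ → ℕ) : ℕ :=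
  Set.ncard {V : Fin (profileParts n P) → Finset (Fin n) |
    (∀ i j, i ≠ j → Disjoint (V i) (V j)) ∧
    (∀ i j, i ≤ j → (V j).card ≤ (V i).card) ∧
    (∀ u : ℕ, (Finset.univ.filter fun i => (V i).card = u).card = P u) ∧
    ∀ i, IndepFinset G (V i)}

/-- `X̄_k = X_k / ∏_u k_u!`: the number of unordered colourings with profile `P`. -/
def Xbar {n : ℕ} (G : SimpleGraph (Fin n)) (P : ℕ → ℕ) : ℝ :=
  (Xprofile G P : ℝ) / ∏ u ∈ Finset.Icc 1 n, ((P u).factorial : ℝ)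

/-- `κ = Σ_u κ_u` where `κ_u = u k_u / n`. -/
def kappaTot (n : ℕ) (P : ℕ → ℕ) : ℝ := ∑ u ∈ Finset.Icc 1 n, (u : ℝ) * P u / n

/-- `m = ⌊p N⌋` with `N = C(n,2)`. -/
def mFloor (p : ℝ) (n : ℕ) : ℕ := ⌊p * (n.choose 2 : ℝ)⌋₊

/-- Definition 2.2: a sequence `P` of complete `a`-bounded colouring profiles is tame. -/
def IsTame (p : ℝ) (a : ℕ → ℕ) (P : ℕ → ℕ → ℕ) : Prop :=
  (∃ C : ℝ, ∀ᶠ n in atTop, alpha0 (1/(1-p)) n - C ≤ (a n : ℝ)) ∧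
  (∀ᶠ n in atTop, a n ≤ alphaNat (1/(1-p)) n) ∧
  (∀ n, IsProfile n (profileParts n (P n)) (P n) ∧ IsCompleteProfile n (P n) ∧
      IsBoundedProfile (a n) (P n)) ∧
  ∃ c : ℝ, c ∈ Set.Ioo (0:ℝ) 1 ∧ ∃ γ : ℕ → ℝ, Monotone γ ∧ Tendsto γ atTop atTop ∧
    (∀ᶠ n in atTop, ∀ u, 1 ≤ u → u ≤ a n →
      (u : ℝ) * P n u / n <
        (1/(1-p)) ^ (-(((alphaNat (1/(1-p)) n - u : ℕ) : ℝ) *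
          γ (alphaNat (1/(1-p)) n - u)))) ∧
    ∀ ε : ℝ, 0 < ε → ∀ᶠ n : ℕ in atTop,
      Real.exp (-ε * (n : ℝ) ^ ((1:ℝ) - c)) ≤ Em n (mFloor p n) fun G => Xbar G (P n)

/-- The function `φ(κ)` from Lemma 3.3. -/
def phiProfile (p : ℝ) (n : ℕ) (P : ℕ → ℕ) : ℝ :=
  -(1 - kappaTot n P) * Real.log (1 - kappaTot n P) +
    Real.log (1/(1-p)) / 2 * ∑ u ∈ Finset.Icc 1 n,
      ((u : ℝ) * P u / n) * (alpha0 (1/(1-p)) n - 1 - 2 / Real.log (1/(1-p)) - (u : ℝ))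

/-- The function `φ̃_δ(x)` from Lemma 3.5. -/
def phiTilde (p δ x : ℝ) : ℝ :=
  -(1 - x) * Real.log (1 - x) - (1 - Real.log (1/(1-p)) / 2 * δ) * x

/-- `d_u = 2^{C(u,2)} u!`. -/
def dcoef (u : ℕ) : ℝ := 2 ^ u.choose 2 * (u.factorial : ℝ)

/-- `L_0(n,k,t)`: the supremum of `L_k` over real-valued `t`-bounded complete profiles. -/
def L0 (n k t : ℕ) : ℝ :=
  sSup {y : ℝ | ∃ f : ℕ → ℝ, (∀ u ∈ Finset.Icc 1 t, 0 ≤ f u) ∧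
    (∑ u ∈ Finset.Icc 1 t, f u = (k : ℝ)) ∧ (∑ u ∈ Finset.Icc 1 t, (u : ℝ) * f u = (n : ℝ)) ∧
    y = (n : ℝ) * Real.log n - (n : ℝ) + (k : ℝ) -
      ∑ u ∈ Finset.Icc 1 t, f u * Real.log (f u * dcoef u)}

/-- Membership in `P_{n,k,t}`: a `t`-bounded complete `k`-colouring profile on `n` vertices. -/
def IsKTProfile (n k t : ℕ) (P : ℕ → ℕ) : Prop :=
  (∀ u, u ∉ Finset.Icc 1 t → P u = 0) ∧
    (∑ u ∈ Finset.Icc 1 t, P u = k) ∧ (∑ u ∈ Finset.Icc 1 t, u * P u = n)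

/-- `E_{n,k,t}` written as the sum over profiles of `E_{1/2}[X̄_k]`. -/
def EnktSum (n k t : ℕ) : ℝ :=
  ∑ᶠ P : ℕ → ℕ, if IsKTProfile n k t P then Ep n (1/2) fun G => Xbar G P else 0

namespace TM

/-- average over a finite type -/
def avg {α : Type*} [Fintype α] (f : α → ℝ) : ℝ := (∑ x, f x) / (Fintype.card α : ℝ)

/-- probability over a finite type (uniform) -/
def pr {α : Type*} [Fintype α] (E : α → Prop) : ℝ := avg fun x => if E x then (1:ℝ) else 0

lemma avg_mono {α : Type*} [Fintype α] {f g : α → ℝ} (h : ∀ x, f x ≤ g x) : avg f ≤ avg g := by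
  unfold avg
  gcongr with x
  exact h x

lemma avg_add {α : Type*} [Fintype α] (f g : α → ℝ) :
    avg (fun x => f x + g x) = avg f + avg g := by
  unfold avg
  rw [Finset.sum_add_distrib, add_div]

lemma avg_const_mul {α : Type*} [Fintype α] (c : ℝ) (f : α → ℝ) :
    avg (fun x => c * f x) = c * avg f := by
  unfold avg
  rw [← Finset.mul_sum, mul_div_assoc]

lemma avg_sum {α β : Type*} [Fintype α] (s : Finset β) (f : β → α → ℝ) :
    avg (fun x => ∑ b ∈ s, f b x) = ∑ b ∈ s, avg (f b) := by
  unfold avg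
  rw [Finset.sum_comm, Finset.sum_div]

lemma avg_const {α : Type*} [Fintype α] [Nonempty α] (c : ℝ) : avg (fun _ : α => c) = c := by
  unfold avg
  rw [Finset.sum_const, Finset.card_univ, nsmul_eq_mul]
  have : (Fintype.card α : ℝ) ≠ 0 := by
    exact_mod_cast Fintype.card_ne_zero
  field_simp

lemma pr_mono {α : Type*} [Fintype α] {E F : α → Prop} (h : ∀ x, E x → F x) : pr E ≤ pr F := by
  apply avg_mono
  intro x
  by_cases hE : E x
  · simp [hE, h x hE]
  · simp only [hE, if_false]; split_ifs <;> norm_num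

lemma pr_nonneg {α : Type*} [Fintype α] (E : α → Prop) : 0 ≤ pr E := by
  unfold pr avg
  apply div_nonneg
  · apply Finset.sum_nonneg; intro x _; split_ifs <;> norm_num
  · positivity

lemma pr_le_one {α : Type*} [Fintype α] [Nonempty α] (E : α → Prop) : pr E ≤ 1 := by
  calc pr E ≤ avg (fun _ : α => (1:ℝ)) := by
        apply avg_mono; intro x; split_ifs <;> norm_num
    _ = 1 := avg_const 1

lemma pr_not {α : Type*} [Fintype α] [Nonempty α] (E : α → Prop) :
    pr (fun x => ¬ E x) = 1 - pr E := by
  have : pr E + pr (fun x => ¬ E x) = 1 := by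
    unfold pr
    rw [← avg_add]
    refine Eq.trans ?_ (avg_const (α := α) 1)
    congr 1; ext x; by_cases h : E x <;> simp [h]
  linarith

lemma pr_or_le {α : Type*} [Fintype α] (E F : α → Prop) :
    pr (fun x => E x ∨ F x) ≤ pr E + pr F := by
  unfold pr
  rw [← avg_add]
  apply avg_mono
  intro x
  by_cases h : E x <;> by_cases h' : F x <;> simp [h, h']

lemma markov {α : Type*} [Fintype α] {E : α → Prop} {f : α → ℝ} (hf : ∀ x, 0 ≤ f x)
    (h : ∀ x, E x → 1 ≤ f x) : pr E ≤ avg f := by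
  apply avg_mono
  intro x
  split_ifs with hE
  · exact h x hE
  · exact hf x

/-- Cauchy-Schwarz -/
lemma second_moment {α : Type*} [Fintype α] (Z : α → ℝ) (hZ : ∀ x, 0 ≤ Z x) :
    (avg Z) ^ 2 ≤ avg (fun x => Z x ^ 2) * pr (fun x => 0 < Z x) := by
  unfold pr avg
  rw [div_pow, div_mul_div_comm, sq (Fintype.card α : ℝ)]
  gcongr
  have := Finset.sum_mul_sq_le_sq_mul_sq Finset.univ Z (fun x => if 0 < Z x then (1:ℝ) else 0)
  convert this using 2
  · apply Finset.sum_congr rfl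
    intro x _
    split_ifs with h
    · simp
    · have : Z x = 0 := le_antisymm (not_lt.1 h) (hZ x)
      simp [this]
  · apply Finset.sum_congr rfl
    intro x _
    by_cases h : 0 < Z x <;> simp [h]

lemma pr_eq_card {α : Type*} [Fintype α] (E : α → Prop) [DecidablePred E] :
    pr E = ((Finset.univ.filter E).card : ℝ) / (Fintype.card α : ℝ) := by
  unfold pr avg
  rw [← Finset.sum_boole]
  congr 1
  apply Finset.sum_congr rfl
  intro x _
  by_cases h : E x <;> simp [h]

abbrev Om (n : ℕ) := Fin n → Fin n → Bool

/-- graph of a configuration -/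
def gr {n : ℕ} (x : Om n) : SimpleGraph (Fin n) where
  Adj v w := (w < v ∧ x v w = true) ∨ (v < w ∧ x w v = true)
  symm := ⟨fun v w h => by tauto⟩
  loopless := ⟨fun v h => by simp at h⟩

lemma pr_prescribed {n : ℕ} (S : Finset (Fin n × Fin n)) (y : Om n) :
    pr (fun x : Om n => ∀ s ∈ S, x s.1 s.2 = y s.1 s.2) = (1/2 : ℝ) ^ S.card := by
  have hset : (Finset.univ.filter fun x : Om n => ∀ s ∈ S, x s.1 s.2 = y s.1 s.2) =
      Fintype.piFinset (fun v => Fintype.piFinset (fun w =>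
        if (v, w) ∈ S then ({y v w} : Finset Bool) else Finset.univ)) := by
    ext x
    simp only [Finset.mem_filter, Finset.mem_univ, true_and, Fintype.mem_piFinset]
    constructor
    · intro h v w
      split_ifs with hS
      · simpa using h _ hS
      · simp
    · rintro h ⟨v, w⟩ hs
      have := h v w
      rw [if_pos hs] at this
      simpa using this
  have hc : ((Finset.univ.filter fun x : Om n => ∀ s ∈ S, x s.1 s.2 = y s.1 s.2).card : ℝ) =
      ∏ s : Fin n × Fin n, (if s ∈ S then (1:ℝ) else 2) := by
    rw [hset, Fintype.card_piFinset]
    simp only [Fintype.card_piFinset]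
    push_cast
    rw [Fintype.prod_prod_type]
    apply Finset.prod_congr rfl; intro v _
    apply Finset.prod_congr rfl; intro w _
    split_ifs <;> simp
  have hO : (Fintype.card (Om n) : ℝ) = ∏ s : Fin n × Fin n, (2:ℝ) := by
    rw [Fintype.prod_prod_type]
    simp [Om]
  rw [pr_eq_card, hc, hO, ← Finset.prod_div_distrib]
  have : ∀ s : Fin n × Fin n, (if s ∈ S then (1:ℝ) else 2) / 2 = if s ∈ S then 1/2 else 1 := by
    intro s; split_ifs <;> norm_num
  simp only [this]
  rw [Finset.prod_ite_mem]
  simp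

def lowPairs (n : ℕ) : Finset (Fin n × Fin n) := Finset.univ.filter fun s => s.2 < s.1

/-- number of ordered pairs with decreasing entries inside a set -/
lemma card_dec (n : ℕ) (s : Finset (Fin n)) :
    ((s ×ˢ s).filter fun p => p.2 < p.1).card = s.card.choose 2 := by
  have h1 : s.offDiag = ((s ×ˢ s).filter fun p => p.2 < p.1) ∪ ((s ×ˢ s).filter fun p => p.1 < p.2) := by
    ext ⟨x, y⟩
    simp only [Finset.mem_offDiag, Finset.mem_union, Finset.mem_filter, Finset.mem_product]
    constructor
    · rintro ⟨hx, hy, h⟩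
      rcases lt_or_gt_of_ne h with h | h <;> tauto
    · rintro (⟨⟨h1, h2⟩, h3⟩ | ⟨⟨h1, h2⟩, h3⟩)
      · exact ⟨h1, h2, h3.ne'⟩
      · exact ⟨h1, h2, h3.ne⟩
  have h2 : ((s ×ˢ s).filter fun p => p.1 < p.2).card = ((s ×ˢ s).filter fun p => p.2 < p.1).card := by
    apply Finset.card_bij (fun p _ => p.swap)
    · simp; tauto
    · rintro ⟨a, b⟩ _ ⟨c, d⟩ _ h; simpa [and_comm] using h
    · rintro ⟨a, b⟩ h
      refine ⟨(b, a), ?_, rfl⟩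
      simp at h ⊢; tauto
  have h3 := congrArg Finset.card h1
  rw [Finset.card_union_of_disjoint, h2, Finset.offDiag_card] at h3
  · rw [Nat.choose_two_right, Nat.mul_sub_one]; omega
  · rw [Finset.disjoint_left]
    rintro ⟨x, y⟩ h1 h2
    simp at h1 h2
    exact absurd h1.2 (not_lt.2 h2.2.le)

lemma card_lowPairs (n : ℕ) : (lowPairs n).card = n.choose 2 := by
  have := card_dec n Finset.univ
  simpa [lowPairs] using this

lemma gr_fiber {n : ℕ} (G : SimpleGraph (Fin n)) (x : Om n) :
    gr x = G ↔ ∀ s ∈ lowPairs n, x s.1 s.2 = (fun v w => decide (G.Adj v w)) s.1 s.2 := by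
  constructor
  · rintro rfl ⟨v, w⟩ hs
    simp only [lowPairs, Finset.mem_filter, Finset.mem_univ, true_and] at hs
    have : ¬ v < w := not_lt.2 hs.le
    by_cases h : x v w <;> simp [gr, hs, this, h]
  · intro h
    ext v w
    have h1 := h (v, w)
    have h2 := h (w, v)
    simp only [lowPairs, Finset.mem_filter, Finset.mem_univ, true_and] at h1 h2
    rcases lt_trichotomy v w with hvw | rfl | hvw
    · have := h2 hvw
      simp [gr, hvw, not_lt.2 hvw.le, this, G.adj_comm]
    · simp [gr]
    · have := h1 hvw
      simp [gr, hvw, not_lt.2 hvw.le, this]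

lemma pr_gr_eq {n : ℕ} (G : SimpleGraph (Fin n)) :
    pr (fun x : Om n => gr x = G) = (1/2 : ℝ) ^ n.choose 2 := by
  simp only [gr_fiber]
  rw [pr_prescribed (lowPairs n) (fun v w => decide (G.Adj v w)), card_lowPairs]

lemma edgeCount_le {n : ℕ} (G : SimpleGraph (Fin n)) : edgeCount G ≤ n.choose 2 := by
  unfold edgeCount
  rw [Nat.card_eq_fintype_card]
  rw [← SimpleGraph.edgeFinset_card]
  have := SimpleGraph.card_edgeFinset_le_card_choose_two (G := G)
  simpa using this

lemma Ep_eq_avg (n : ℕ) (X : SimpleGraph (Fin n) → ℝ) :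
    Ep n (1/2) X = avg fun x : Om n => X (gr x) := by
  unfold Ep
  rw [finsum_eq_sum_of_fintype]
  have h : ∀ x : Om n, X (gr x) = ∑ G : SimpleGraph (Fin n), X G * (if gr x = G then 1 else 0) := by
    intro x; simp
  simp only [h]
  rw [avg_sum]
  apply Finset.sum_congr rfl
  intro G _
  rw [avg_const_mul]
  have := pr_gr_eq G
  unfold pr at this
  rw [this, mul_assoc]
  congr 1
  have h12 : (1 - 1/2 : ℝ) = 1/2 := by norm_num
  rw [h12, ← pow_add, Nat.add_sub_cancel' (edgeCount_le G)]

lemma Pp_eq_pr (n : ℕ) (E : SimpleGraph (Fin n) → Prop) :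
    Pp n (1/2) E = pr fun x : Om n => E (gr x) := by
  have := Ep_eq_avg n (fun G => if E G then 1 else 0)
  unfold Ep at this
  unfold Pp pr
  exact this

/-- proper for a colouring -/
def Proper {n : ℕ} {ι : Type*} (x : Om n) (C : Fin n → ι) : Prop :=
  ∀ v w, (gr x).Adj v w → C v ≠ C w

def mono {n : ℕ} {ι : Type*} (C : Fin n → ι) : Finset (Fin n × Fin n) :=
  Finset.univ.filter fun s => s.2 < s.1 ∧ C s.1 = C s.2

lemma proper_iff {n : ℕ} {ι : Type*} (x : Om n) (C : Fin n → ι) :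
    Proper x C ↔ ∀ s ∈ mono C, x s.1 s.2 = (fun _ _ => false) s.1 s.2 := by
  constructor
  · rintro h ⟨v, w⟩ hs
    simp only [mono, Finset.mem_filter, Finset.mem_univ, true_and] at hs
    by_contra hx
    have : x v w = true := by simpa using hx
    exact h v w (Or.inl ⟨hs.1, this⟩) hs.2
  · intro h v w hvw hC
    rcases hvw with ⟨h1, h2⟩ | ⟨h1, h2⟩
    · have := h (v, w) (by simp [mono, h1, hC])
      simp [h2] at this
    · have := h (w, v) (by simp [mono, h1, hC])
      simp [h2] at this

lemma pr_proper {n : ℕ} {ι : Type*} (C : Fin n → ι) :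
    pr (fun x : Om n => Proper x C) = (1/2 : ℝ) ^ (mono C).card := by
  simp only [proper_iff]
  rw [pr_prescribed (mono C) (fun _ _ => false)]

lemma pr_proper_two {n : ℕ} {ι κ : Type*} (C : Fin n → ι) (D : Fin n → κ) :
    pr (fun x : Om n => Proper x C ∧ Proper x D) =
      (1/2 : ℝ) ^ (mono C).card * (1/2 : ℝ) ^ (mono D).card *
        2 ^ (mono fun v => (C v, D v)).card := by
  have h : ∀ x : Om n, (Proper x C ∧ Proper x D) ↔
      ∀ s ∈ mono C ∪ mono D, x s.1 s.2 = (fun _ _ => false) s.1 s.2 := by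
    intro x
    rw [proper_iff, proper_iff]
    simp only [Finset.mem_union]
    constructor
    · rintro ⟨h1, h2⟩ s (hs | hs)
      · exact h1 s hs
      · exact h2 s hs
    · intro h; exact ⟨fun s hs => h s (Or.inl hs), fun s hs => h s (Or.inr hs)⟩
  simp only [h]
  rw [pr_prescribed (mono C ∪ mono D) (fun _ _ => false)]
  have hi : mono C ∩ mono D = mono fun v => (C v, D v) := by
    ext ⟨v, w⟩; simp [mono]; tauto
  have := Finset.card_union_add_card_inter (mono C) (mono D)
  rw [hi] at this
  rw [← pow_add, ← this, pow_add, mul_assoc, ← mul_pow]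
  norm_num

/-- fibre of a colouring -/
def fib {n : ℕ} {κ : Type*} (c : Fin n → κ) (i : κ) : Finset (Fin n) := Finset.univ.filter fun x => c x = i

lemma mem_fib {n : ℕ} {κ : Type*} (c : Fin n → κ) (i : κ) (x : Fin n) : x ∈ fib c i ↔ c x = i := by
  simp [fib]

lemma card_mono {n : ℕ} {ι : Type*} [Fintype ι] (C : Fin n → ι) :
    (mono C).card = ∑ i, (fib C i).card.choose 2 := by
  rw [Finset.card_eq_sum_card_fiberwise (f := fun s => C s.1) (t := Finset.univ) (by simp [Set.MapsTo])]
  apply Finset.sum_congr rfl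
  intro i _
  rw [← card_dec]
  congr 1
  ext ⟨v, w⟩
  simp [mono, mem_fib]
  constructor
  · rintro ⟨⟨h1, h2⟩, h3⟩; exact ⟨⟨h3, h2 ▸ h3⟩, h1⟩
  · rintro ⟨⟨h1, h2⟩, h3⟩; exact ⟨⟨h3, h1.trans h2.symm⟩, h1⟩

end TM

namespace TM

lemma exp_le_cosh_add (l y : ℝ) (hy : |y| ≤ 1) :
    Real.exp (l * y) ≤ Real.cosh l + y * Real.sinh l := by
  have h := abs_le.1 hy
  have hc := convexOn_exp.2 (Set.mem_univ l) (Set.mem_univ (-l))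
    (show 0 ≤ (1 + y)/2 by linarith) (show 0 ≤ (1 - y)/2 by linarith) (by ring)
  simp only [smul_eq_mul] at hc
  rw [Real.cosh_eq, Real.sinh_eq]
  have e : (1 + y) / 2 * l + (1 - y) / 2 * -l = l * y := by ring
  rw [e] at hc
  linarith

lemma avg_cons {β : Type*} [Fintype β] (n : ℕ) (h : (Fin (n+1) → β) → ℝ) :
    avg h = avg fun y : Fin n → β => avg fun b : β => h (Fin.cons b y : Fin (n+1) → β) := by
  unfold avg
  rw [← Finset.sum_div, div_div]
  congr 1
  · rw [← (Fin.consEquiv (fun _ : Fin (n+1) => β)).sum_comp, Fintype.sum_prod_type, Finset.sum_comm]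
    rfl
  · simp [pow_succ]; ring

lemma avg_sub {α : Type*} [Fintype α] (f g : α → ℝ) :
    avg (fun x => f x - g x) = avg f - avg g := by
  unfold avg
  rw [Finset.sum_sub_distrib, sub_div]

def Lip {β : Type*} {n : ℕ} (f : (Fin n → β) → ℝ) : Prop :=
  ∀ x i b, |f x - f (Function.update x i b)| ≤ 1

lemma mcd {β : Type*} [Fintype β] [Nonempty β] (n : ℕ) (l : ℝ) :
    ∀ f : (Fin n → β) → ℝ, Lip f →
      avg (fun x => Real.exp (l * (f x - avg f))) ≤ Real.exp (n * l ^ 2 / 2) := by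
  induction n with
  | zero =>
    intro f _
    have : ∀ x, f x = avg f := by
      intro x
      rw [← avg_const (α := Fin 0 → β) (f x)]
      congr 1; ext y
      exact congrArg f (Subsingleton.elim _ _)
    have h2 : (fun x => Real.exp (l * (f x - avg f))) = fun _ => (1:ℝ) := by
      ext x; rw [this x]; simp
    rw [h2, avg_const]
    simp
  | succ n ih =>
    intro f hf
    set g : (Fin n → β) → ℝ := fun y => avg fun b : β => f (Fin.cons b y : Fin (n+1) → β) with hg
    have hgavg : avg g = avg f := (avg_cons n f).symm
    have hgl : Lip g := by
      intro y i b
      have : g y - g (Function.update y i b) =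
          avg fun c : β => f (Fin.cons c y : Fin (n+1) → β) -
            f (Function.update (Fin.cons c y : Fin (n+1) → β) i.succ b) := by
        rw [avg_sub]; congr 1
        show (avg fun c : β => _) = _
        congr 1; ext c
        rw [Fin.cons_update]
      rw [this, abs_le]
      constructor
      · rw [← avg_const (α := β) (-1)]
        exact avg_mono fun c => (abs_le.1 (hf _ _ _)).1
      · rw [← avg_const (α := β) (1)]
        exact avg_mono fun c => (abs_le.1 (hf _ _ _)).2
    have hY : ∀ (y : Fin n → β) (b : β), |f (Fin.cons b y : Fin (n+1) → β) - g y| ≤ 1 := by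
      intro y b
      have : f (Fin.cons b y : Fin (n+1) → β) - g y =
          avg fun c : β => f (Fin.cons b y : Fin (n+1) → β) -
            f (Function.update (Fin.cons b y : Fin (n+1) → β) 0 c) := by
        rw [avg_sub, avg_const]; congr 1
        show (avg fun c : β => _) = _
        congr 1; ext c
        rw [Fin.update_cons_zero]
      rw [this, abs_le]
      constructor
      · rw [← avg_const (α := β) (-1)]
        exact avg_mono fun c => (abs_le.1 (hf _ _ _)).1
      · rw [← avg_const (α := β) (1)]
        exact avg_mono fun c => (abs_le.1 (hf _ _ _)).2
    rw [avg_cons]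
    have hin : ∀ y : Fin n → β,
        avg (fun b : β => Real.exp (l * (f (Fin.cons b y : Fin (n+1) → β) - avg f))) ≤
          Real.exp (l^2/2) * Real.exp (l * (g y - avg g)) := by
      intro y
      have e : ∀ b : β, Real.exp (l * (f (Fin.cons b y : Fin (n+1) → β) - avg f)) =
          Real.exp (l * (g y - avg g)) * Real.exp (l * (f (Fin.cons b y : Fin (n+1) → β) - g y)) := by
        intro b; rw [← Real.exp_add, hgavg]; congr 1; ring
      simp only [e]
      rw [avg_const_mul, mul_comm]
      gcongr
      calc _ ≤ avg (fun b : β => Real.cosh l + (f (Fin.cons b y : Fin (n+1) → β) - g y) * Real.sinh l) :=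
            avg_mono fun b => exp_le_cosh_add _ _ (hY y b)
        _ = Real.cosh l := by
            rw [avg_add, avg_const]
            have : (avg fun b : β => (f (Fin.cons b y : Fin (n+1) → β) - g y) * Real.sinh l) = 0 := by
              simp only [mul_comm _ (Real.sinh l)]
              rw [avg_const_mul, avg_sub, avg_const]
              simp [hg]
            rw [this, add_zero]
        _ ≤ _ := Real.cosh_le_exp_half_sq l
    refine (avg_mono hin).trans ?_
    rw [avg_const_mul]
    calc _ ≤ Real.exp (l^2/2) * Real.exp (n * l ^ 2 / 2) := by gcongr; exact ih g hgl
      _ = _ := by rw [← Real.exp_add]; congr 1; push_cast; ring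

lemma mcd_upper {β : Type*} [Fintype β] [Nonempty β] (n : ℕ) (hn : 0 < n)
    (f : (Fin n → β) → ℝ) (hf : Lip f) (t : ℝ) (ht : 0 ≤ t) :
    pr (fun x => avg f + t ≤ f x) ≤ Real.exp (-t^2/(2*n)) := by
  have hn' : (0:ℝ) < n := by exact_mod_cast hn
  set l := t / n with hl
  have hl0 : 0 ≤ l := by positivity
  calc pr (fun x => avg f + t ≤ f x) ≤
        avg (fun x => Real.exp (-(l*t)) * Real.exp (l * (f x - avg f))) := by
        apply markov
        · intro x; positivity
        · intro x hx
          rw [← Real.exp_add, Real.one_le_exp_iff]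
          nlinarith
    _ ≤ Real.exp (-(l*t)) * Real.exp (n * l ^ 2 / 2) := by
        rw [avg_const_mul]; gcongr; exact mcd n l f hf
    _ = _ := by
        rw [← Real.exp_add]; congr 1; rw [hl]; field_simp; ring

lemma mcd_final {β : Type*} [Fintype β] [Nonempty β] (n : ℕ) (hn : 0 < n)
    (f : (Fin n → β) → ℝ) (hf : Lip f) (t K : ℝ) (ht : 0 ≤ t)
    (h : Real.exp (-t^2/(2*n)) < pr (fun x => f x ≤ K)) :
    pr (fun x => K + 2 * t ≤ f x) ≤ Real.exp (-t^2/(2*n)) := by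
  have hμ : avg f < K + t := by
    by_contra hc
    push Not at hc
    have h2 : pr (fun x => f x ≤ K) ≤ Real.exp (-t^2/(2*n)) := by
      refine le_trans ?_ (mcd_upper n hn (fun x => (-1) * f x) ?_ t ht)
      · apply pr_mono
        intro x hx
        rw [avg_const_mul]
        linarith
      · intro x i b
        rw [← mul_sub, abs_mul]
        simpa using hf x i b
    linarith
  refine le_trans ?_ (mcd_upper n hn f hf t ht)
  apply pr_mono
  intro x hx
  linarith

end TM

namespace TM

set_option linter.unusedSectionVars false
variable {ι : Type*} [Fintype ι]


def rr {n : ℕ} (c : Fin n → ι) (σ : Equiv.Perm (Fin n)) (p : ι × ι) : ℕ :=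
  (Finset.univ.filter fun x => c x = p.1 ∧ c (σ x) = p.2).card

def ov {n : ℕ} (c : Fin n → ι) (σ : Equiv.Perm (Fin n)) : ℕ := ∑ p : ι × ι, (rr c σ p).choose 2

lemma card_mono_pair {n : ℕ} (c : Fin n → ι) (σ τ : Equiv.Perm (Fin n)) :
    (mono fun v => ((c ∘ σ) v, (c ∘ τ) v)).card = ov c (τ * σ⁻¹) := by
  rw [card_mono]
  unfold ov
  apply Finset.sum_congr rfl
  rintro ⟨i, j⟩ _
  congr 1
  unfold rr
  apply Finset.card_bij (fun x _ => σ x)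
  · intro x hx
    rw [Finset.mem_filter]
    rw [mem_fib] at hx
    simpa using hx
  · intro x _ y _ h; exact σ.injective h
  · intro y hy
    refine ⟨σ⁻¹ y, ?_, by simp⟩
    rw [mem_fib]
    rw [Finset.mem_filter] at hy
    simpa using hy

lemma card_mono_comp {n : ℕ} (c : Fin n → ι) (σ : Equiv.Perm (Fin n)) :
    (mono (c ∘ σ)).card = (mono c).card := by
  rw [card_mono, card_mono]
  apply Finset.sum_congr rfl
  intro i _
  congr 1
  apply Finset.card_bij (fun x _ => σ x)
  · intro x hx
    rw [mem_fib] at hx ⊢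
    simpa using hx
  · intro x _ y _ h; exact σ.injective h
  · intro y hy
    refine ⟨σ⁻¹ y, ?_, by simp⟩
    rw [mem_fib] at hy ⊢
    simpa using hy

lemma second_moment_perm {n : ℕ} (c : Fin n → ι) :
    (n.factorial : ℝ) ≤ (∑ σ : Equiv.Perm (Fin n), (2:ℝ) ^ ov c σ) *
      pr (fun x : Om n => ∃ σ : Equiv.Perm (Fin n), Proper x (c ∘ σ)) := by
  set Z : Om n → ℝ := fun x => ∑ σ : Equiv.Perm (Fin n), if Proper x (c ∘ σ) then (1:ℝ) else 0 with hZ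
  have hZ0 : ∀ x, 0 ≤ Z x := fun x => Finset.sum_nonneg fun σ _ => by split_ifs <;> norm_num
  have h := second_moment Z hZ0
  set q : ℝ := (1/2 : ℝ) ^ (mono c).card with hq
  have hq0 : 0 < q := by positivity
  have h1 : avg Z = n.factorial * q := by
    rw [hZ, avg_sum]
    have : ∀ σ : Equiv.Perm (Fin n), (avg fun x : Om n => if Proper x (c ∘ σ) then (1:ℝ) else 0) = q := by
      intro σ
      have := pr_proper (c ∘ σ)
      unfold pr at this
      rw [this, card_mono_comp]
    simp only [this]
    rw [Finset.sum_const, Finset.card_univ, Fintype.card_perm]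
    simp
  have h2 : avg (fun x => Z x ^ 2) = q * q * (n.factorial * ∑ σ : Equiv.Perm (Fin n), (2:ℝ) ^ ov c σ) := by
    have e : ∀ x, Z x ^ 2 = ∑ σ : Equiv.Perm (Fin n), ∑ τ : Equiv.Perm (Fin n),
        if Proper x (c ∘ σ) ∧ Proper x (c ∘ τ) then (1:ℝ) else 0 := by
      intro x
      rw [sq, hZ]
      simp only
      rw [Finset.sum_mul_sum]
      apply Finset.sum_congr rfl; intro σ _
      apply Finset.sum_congr rfl; intro τ _
      by_cases h1 : Proper x (c ∘ σ) <;> by_cases h2 : Proper x (c ∘ τ) <;> simp [h1, h2]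
    simp only [e]
    rw [avg_sum]
    simp only [avg_sum]
    have e2 : ∀ σ τ : Equiv.Perm (Fin n),
        (avg fun x : Om n => if Proper x (c ∘ σ) ∧ Proper x (c ∘ τ) then (1:ℝ) else 0) =
          q * q * 2 ^ ov c (τ * σ⁻¹) := by
      intro σ τ
      have h0 := pr_proper_two (c ∘ σ) (c ∘ τ)
      rw [card_mono_comp, card_mono_comp, card_mono_pair] at h0
      rw [← h0]
      unfold pr
      congr 1; ext x
      by_cases hh : Proper x (c ∘ σ) ∧ Proper x (c ∘ τ)
      · rw [if_pos hh, if_pos hh]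
      · rw [if_neg hh, if_neg hh]
    simp only [e2]
    have e3 : ∀ σ : Equiv.Perm (Fin n), ∑ τ : Equiv.Perm (Fin n), q * q * (2:ℝ) ^ ov c (τ * σ⁻¹) =
        q * q * ∑ τ : Equiv.Perm (Fin n), (2:ℝ) ^ ov c τ := by
      intro σ
      rw [← Finset.mul_sum]
      congr 1
      exact Equiv.sum_comp (Equiv.mulRight σ⁻¹) (fun τ => (2:ℝ) ^ ov c τ)
    simp only [e3]
    rw [Finset.sum_const, Finset.card_univ, Fintype.card_perm, nsmul_eq_mul]
    simp; ring
  have h3 : pr (fun x => 0 < Z x) ≤ pr (fun x : Om n => ∃ σ : Equiv.Perm (Fin n), Proper x (c ∘ σ)) := by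
    apply pr_mono
    intro x hx
    by_contra hc
    push Not at hc
    have : Z x = 0 := Finset.sum_eq_zero fun σ _ => by simp [hc σ]
    linarith
  rw [h1, h2] at h
  set S := ∑ σ : Equiv.Perm (Fin n), (2:ℝ) ^ ov c σ with hS
  have hS0 : 0 ≤ S := Finset.sum_nonneg fun σ _ => by positivity
  have hn : (0:ℝ) < n.factorial := by exact_mod_cast n.factorial_pos
  have h4 : (n.factorial:ℝ) * q * q * n.factorial ≤ (n.factorial:ℝ) * q * q * (S * pr (fun x => 0 < Z x)) := by
    nlinarith
  have h5 := le_of_mul_le_mul_left h4 (by positivity)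
  exact h5.trans (by gcongr)

/-- pattern -/
def pat {n : ℕ} (c : Fin n → ι) (σ : Equiv.Perm (Fin n)) (p : ι × ι) : ℕ :=
  if 2 ≤ rr c σ p then rr c σ p else 0

lemma ov_eq_pat {n : ℕ} (c : Fin n → ι) (σ : Equiv.Perm (Fin n)) :
    ov c σ = ∑ p, (pat c σ p).choose 2 := by
  apply Finset.sum_congr rfl
  intro p _
  unfold pat
  split_ifs with h
  · rfl
  · push Not at h
    interval_cases rr c σ p <;> rfl

def AA {n : ℕ} (c : Fin n → ι) (σ : Equiv.Perm (Fin n)) (p : ι × ι) : Finset (Fin n) :=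
  if pat c σ p = 0 then ∅ else Finset.univ.filter fun x => c x = p.1 ∧ c (σ x) = p.2

lemma card_AA {n : ℕ} (c : Fin n → ι) (σ : Equiv.Perm (Fin n)) (p : ι × ι) :
    (AA c σ p).card = pat c σ p := by
  unfold AA
  split_ifs with h
  · simp [h]
  · unfold pat at h ⊢
    split_ifs at h ⊢ with h1
    · rfl
    · simp at h

def lab {n : ℕ} (c : Fin n → ι) (σ : Equiv.Perm (Fin n)) (x : Fin n) : Option (ι × ι) :=
  if pat c σ (c x, c (σ x)) = 0 then none else some (c x, c (σ x))

lemma lab_iff {n : ℕ} (c : Fin n → ι) (σ : Equiv.Perm (Fin n)) (x : Fin n) (p : ι × ι) :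
    lab c σ x = some p ↔ x ∈ AA c σ p := by
  unfold lab AA
  rcases p with ⟨i, j⟩
  constructor
  · intro h
    split_ifs at h with h1
    simp only [Option.some.injEq, Prod.mk.injEq] at h
    obtain ⟨rfl, rfl⟩ := h
    simp [h1]
  · intro h
    split_ifs at h with h1
    · simp at h
    · simp at h
      obtain ⟨rfl, rfl⟩ := h
      simp [h1]

lemma lab_eq {n : ℕ} (c : Fin n → ι) (σ τ : Equiv.Perm (Fin n)) (h : AA c σ = AA c τ) :
    lab c σ = lab c τ := by
  ext1 x
  apply Option.ext
  intro p
  rw [lab_iff, lab_iff, h]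

lemma card_pattern {n : ℕ} (c : Fin n → ι) (t : ι × ι → ℕ) :
    (Finset.univ.filter fun σ : Equiv.Perm (Fin n) => pat c σ = t).card ≤
      ((n - ∑ p, t p).factorial * ∏ p, (t p).factorial) *
        ((∏ p : ι × ι, ((fib c p.1).card.choose (t p))) * ∏ p : ι × ι, ((fib c p.2).card.choose (t p))) := by
  set T : Finset ((ι × ι → Finset (Fin n)) × (ι × ι → Finset (Fin n))) :=
    (Fintype.piFinset fun p : ι × ι => (fib c p.1).powersetCard (t p)) ×ˢ
      (Fintype.piFinset fun p : ι × ι => (fib c p.2).powersetCard (t p)) with hT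
  have hTc : T.card = (∏ p : ι × ι, ((fib c p.1).card.choose (t p))) *
      ∏ p : ι × ι, ((fib c p.2).card.choose (t p)) := by
    rw [hT, Finset.card_product, Fintype.card_piFinset, Fintype.card_piFinset]
    simp only [Finset.card_powersetCard]
  rw [← hTc]
  apply Finset.card_le_mul_card_image_of_maps_to
    (f := fun σ => (AA c σ, fun p => (AA c σ p).map σ.toEmbedding))
  · intro σ hσ
    rw [Finset.mem_filter] at hσ
    obtain ⟨-, hσ⟩ := hσ
    subst hσ
    simp only [hT, Finset.mem_product, Fintype.mem_piFinset, Finset.mem_powersetCard, Finset.card_map,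
      card_AA, and_true, Finset.mem_coe]
    constructor
    · intro p x hx
      rw [← lab_iff] at hx
      unfold lab at hx
      split_ifs at hx
      simp only [Option.some.injEq] at hx
      subst hx
      simp [fib]
    · intro p y hy
      rw [Finset.mem_map] at hy
      obtain ⟨x, hx, rfl⟩ := hy
      rw [← lab_iff] at hx
      unfold lab at hx
      split_ifs at hx
      simp only [Option.some.injEq] at hx
      subst hx
      simp [fib]
  · rintro ⟨A, B⟩ _
    rcases Finset.eq_empty_or_nonempty ((Finset.univ.filter fun σ : Equiv.Perm (Fin n) => pat c σ = t).filter
      fun σ => (AA c σ, fun p => (AA c σ p).map σ.toEmbedding) = (A, B)) with he | ⟨σ0, hσ0⟩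
    · rw [he]; simp
    simp only [Finset.mem_filter, Finset.mem_univ, true_and, Prod.mk.injEq] at hσ0
    obtain ⟨ht0, hA0, hB0⟩ := hσ0
    set f := lab c σ0 with hf
    have hstab := DomMulAct.stabilizer_card (α := Fin n) f
    have hle : ((Finset.univ.filter fun σ : Equiv.Perm (Fin n) => pat c σ = t).filter
      fun σ => (AA c σ, fun p => (AA c σ p).map σ.toEmbedding) = (A, B)).card ≤
        Fintype.card {g : Equiv.Perm (Fin n) // f ∘ g = f} := by
      rw [Fintype.card_subtype]
      apply Finset.card_le_card_of_injOn (fun σ => σ0⁻¹ * σ)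
      · intro σ hσ
        simp only [Finset.coe_filter, Finset.mem_filter, Finset.mem_univ, true_and, Prod.mk.injEq,
          Set.mem_ofPred_eq] at hσ ⊢
        obtain ⟨ht, hA, hB⟩ := hσ
        have hl : lab c σ = f := lab_eq c σ σ0 (hA.trans hA0.symm)
        ext1 x
        apply Option.ext
        intro p
        rw [← hl]
        simp only [Function.comp_apply]
        rw [hl, lab_iff, ← hl, lab_iff]
        have h1 : (AA c σ p).map σ.toEmbedding = (AA c σ0 p).map σ0.toEmbedding :=
          (congrFun hB p).trans (congrFun hB0 p).symm
        constructor
        · intro hx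
          have : σ x ∈ (AA c σ0 p).map σ0.toEmbedding := by
            rw [Finset.mem_map]
            exact ⟨_, hx, by simp⟩
          rw [← h1, Finset.mem_map] at this
          obtain ⟨z, hz, hzx⟩ := this
          have : z = x := σ.injective hzx
          rwa [← this]
        · intro hx
          have : σ x ∈ (AA c σ p).map σ.toEmbedding := by
            rw [Finset.mem_map]
            exact ⟨_, hx, by simp⟩
          rw [h1, Finset.mem_map] at this
          obtain ⟨z, hz, hzx⟩ := this
          have : z = (σ0⁻¹ * σ) x := by
            simp only [Equiv.Perm.mul_apply]
            rw [← hzx]; simp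
          rwa [← this]
      · intro σ _ τ _ h
        exact mul_left_cancel h
    refine hle.trans ?_
    rw [hstab, Fintype.prod_option]
    have hs : ∀ p, Fintype.card {x // f x = some p} = t p := by
      intro p
      rw [Fintype.card_subtype, ← ht0, ← card_AA]
      congr 1
      ext x
      simp [hf, lab_iff]
    simp only [hs]
    have hn : Fintype.card {x // f x = none} = n - ∑ p, t p := by
      have h1 : ∑ o : Option (ι × ι), Fintype.card {x // f x = o} = n := by
        have := Finset.card_eq_sum_card_fiberwise (f := f) (s := Finset.univ) (t := Finset.univ) (by simp [Set.MapsTo])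
        simp only [Finset.card_univ, Fintype.card_fin] at this
        refine Eq.trans ?_ this.symm
        apply Finset.sum_congr rfl
        intro o _
        rw [Fintype.card_subtype]
      rw [Fintype.sum_option] at h1
      simp only [hs] at h1
      omega
    rw [hn]

end TM

namespace TM
set_option linter.unusedSectionVars false
variable {ι : Type*} [Fintype ι]

/-- core set: partial matchings with values in `[ρ,a]` -/
def CoreSet (ρ a : ℕ) (I J : Finset ι) : Finset (ι × ι → ℕ) :=
  (Fintype.piFinset fun _ => Finset.range (a+1)).filter fun t =>
    (∀ p, t p ≠ 0 → p.1 ∈ I ∧ p.2 ∈ J ∧ ρ ≤ t p) ∧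
    (∀ i j j', t (i,j) ≠ 0 → t (i,j') ≠ 0 → j = j') ∧
    (∀ i i' j, t (i,j) ≠ 0 → t (i',j) ≠ 0 → i = i')

lemma mem_CoreSet {ρ a : ℕ} {I J : Finset ι} {t : ι × ι → ℕ} :
    t ∈ CoreSet ρ a I J ↔ (∀ p, t p ≤ a) ∧ (∀ p, t p ≠ 0 → p.1 ∈ I ∧ p.2 ∈ J ∧ ρ ≤ t p) ∧
    (∀ i j j', t (i,j) ≠ 0 → t (i,j') ≠ 0 → j = j') ∧
    (∀ i i' j, t (i,j) ≠ 0 → t (i',j) ≠ 0 → i = i') := by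
  unfold CoreSet
  rw [Finset.mem_filter, Fintype.mem_piFinset]
  simp only [Finset.mem_range, Nat.lt_succ_iff]

def KK (v : ι → ℕ) (J : Finset ι) (u : ℕ) : ℕ := (J.filter fun j => v j = u).card

lemma KK_erase_same (v : ι → ℕ) (J : Finset ι) (j : ι) (hj : j ∈ J) :
    KK v J (v j) = KK v (J.erase j) (v j) + 1 := by
  unfold KK
  rw [Finset.filter_erase, Finset.card_erase_of_mem (by simp [hj])]
  have : 0 < (J.filter fun x => v x = v j).card := Finset.card_pos.2 ⟨j, by simp [hj]⟩
  omega

lemma KK_erase_ne (v : ι → ℕ) (J : Finset ι) (j : ι) (u : ℕ) (hu : u ≠ v j) :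
    KK v (J.erase j) u = KK v J u := by
  unfold KK
  rw [Finset.filter_erase, Finset.erase_eq_of_notMem]
  simp; intro _ h; exact hu h.symm

def PP (v : ι → ℕ) (U : Finset ℕ) (y : ℕ → ℝ) (J : Finset ι) : ℝ :=
  ∏ u ∈ U, ((KK v J u).factorial * Real.exp (y u) / (y u) ^ (KK v J u))

lemma PP_erase (v : ι → ℕ) (U : Finset ℕ) (y : ℕ → ℝ) (J : Finset ι) (j : ι) (hj : j ∈ J)
    (hU : v j ∈ U) (hy : 0 < y (v j)) :
    (KK v J (v j) : ℝ) * PP v U y (J.erase j) = PP v U y J * y (v j) := by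
  unfold PP
  rw [← Finset.mul_prod_erase U _ hU, ← Finset.mul_prod_erase U _ hU]
  have h1 : ∏ u ∈ U.erase (v j), ((KK v (J.erase j) u).factorial * Real.exp (y u) / (y u) ^ (KK v (J.erase j) u)) =
      ∏ u ∈ U.erase (v j), (((KK v J u).factorial : ℝ) * Real.exp (y u) / (y u) ^ (KK v J u)) := by
    apply Finset.prod_congr rfl
    intro u hu
    rw [KK_erase_ne v J j u (Finset.ne_of_mem_erase hu)]
  rw [h1, KK_erase_same v J j hj, Nat.factorial_succ, pow_succ]
  push_cast
  field_simp

lemma PP_nonneg (v : ι → ℕ) (U : Finset ℕ) (y : ℕ → ℝ) (J : Finset ι) (hy0 : ∀ u, 0 ≤ y u) :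
    0 ≤ PP v U y J := Finset.prod_nonneg fun u _ => by have := hy0 u; positivity

lemma one_le_PP (v : ι → ℕ) (U : Finset ℕ) (y : ℕ → ℝ) (J : Finset ι) (hy0 : ∀ u, 0 ≤ y u)
    (hy : ∀ j, 0 < y (v j)) : 1 ≤ PP v U y J := by
  unfold PP
  have : (1:ℝ) = ∏ u ∈ U, (1:ℝ) := by simp
  rw [this]
  apply Finset.prod_le_prod
  · intros; norm_num
  · intro u _
    have h := Real.pow_div_factorial_le_exp (y u) (hy0 u) (KK v J u)
    rcases Nat.eq_zero_or_pos (KK v J u) with h0 | h0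
    · rw [h0]; simp; exact hy0 u
    · obtain ⟨j, hj⟩ := Finset.card_pos.1 h0
      simp at hj
      have hyu : 0 < y u := hj.2 ▸ hy j
      rw [le_div_iff₀ (by positivity), one_mul]
      rw [div_le_iff₀ (by positivity)] at h
      linarith

lemma matching_sum (ρ a : ℕ) (hρ : 0 < ρ) (v : ι → ℕ) (U : Finset ℕ) (hU : ∀ j, v j ∈ U)
    (y : ℕ → ℝ) (hy0 : ∀ u, 0 ≤ y u) (hy : ∀ j, 0 < y (v j))
    (g : ι × ι → ℕ → ℝ) (hg0 : ∀ p, g p 0 = 1) (hg : ∀ p t, 0 ≤ g p t)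
    (Ω : ι → ℕ → ℝ) (hΩ0 : ∀ i u, 0 ≤ Ω i u)
    (hΩ : ∀ i j, ∑ t ∈ Finset.Icc ρ a, g (i,j) t ≤ Ω i (v j)) (I : Finset ι) :
    ∀ J : Finset ι, ∑ c ∈ CoreSet ρ a I J, ∏ p, g p (c p) ≤
      PP v U y J * ∏ i ∈ I, (1 + ∑ u ∈ U, Ω i u * y u) := by
  induction I using Finset.induction_on with
  | empty =>
    intro J
    have : CoreSet ρ a (∅ : Finset ι) J ⊆ {fun _ => 0} := by
      intro t ht
      rw [mem_CoreSet] at ht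
      rw [Finset.mem_singleton]
      ext p
      by_contra h
      simpa using (ht.2.1 p h).1
    calc _ ≤ ∑ c ∈ ({fun _ => 0} : Finset (ι × ι → ℕ)), ∏ p, g p (c p) :=
          Finset.sum_le_sum_of_subset_of_nonneg this fun _ _ _ => Finset.prod_nonneg fun _ _ => hg _ _
      _ = 1 := by simp [hg0]
      _ ≤ _ := by simpa using one_le_PP v U y J hy0 hy
  | insert i I hi ih =>
    intro J
    rw [Finset.prod_insert hi]
    set R := ∏ i ∈ I, (1 + ∑ u ∈ U, Ω i u * y u) with hR
    have hR0 : 0 ≤ R := Finset.prod_nonneg fun i _ => by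
      have : 0 ≤ ∑ u ∈ U, Ω i u * y u := Finset.sum_nonneg fun u _ => mul_nonneg (hΩ0 i u) (hy0 u)
      linarith
    set F : (ι × ι → ℕ) → ℝ := fun c => ∏ p, g p (c p) with hF
    have hF0 : ∀ c, 0 ≤ F c := fun c => Finset.prod_nonneg fun _ _ => hg _ _
    -- split
    have hsplit : ∑ c ∈ CoreSet ρ a (insert i I) J, F c ≤
        ∑ c ∈ CoreSet ρ a I J, F c +
          ∑ j ∈ J, ∑ t ∈ Finset.Icc ρ a, ∑ c ∈ (CoreSet ρ a (insert i I) J).filter (fun c => c (i,j) = t), F c := by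
      rw [← Finset.sum_filter_add_sum_filter_not (CoreSet ρ a (insert i I) J) (fun c => ∀ j, c (i,j) = 0)]
      apply add_le_add
      · apply Finset.sum_le_sum_of_subset_of_nonneg _ fun _ _ _ => hF0 _
        intro c hc
        rw [Finset.mem_filter, mem_CoreSet] at hc
        rw [mem_CoreSet]
        obtain ⟨⟨h1, h2, h3⟩, h0⟩ := hc
        refine ⟨h1, ?_, h3⟩
        rintro ⟨i', j⟩ hp
        obtain ⟨h4, h5⟩ := h2 _ hp
        refine ⟨?_, h5⟩
        rcases Finset.mem_insert.1 h4 with h | h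
        · simp only at h; subst h; exact absurd (h0 j) hp
        · exact h
      · simp only [Finset.sum_filter]
        have : ∑ j ∈ J, ∑ t ∈ Finset.Icc ρ a, ∑ c ∈ CoreSet ρ a (insert i I) J, (if c (i,j) = t then F c else 0)
          = ∑ c ∈ CoreSet ρ a (insert i I) J, ∑ j ∈ J, ∑ t ∈ Finset.Icc ρ a, (if c (i,j) = t then F c else 0) := by
          rw [Finset.sum_comm]
          apply Eq.symm
          rw [Finset.sum_comm]
          simp_rw [Finset.sum_comm (s := CoreSet ρ a (insert i I) J)]
          rw [Finset.sum_comm]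
        rw [this]
        apply Finset.sum_le_sum
        intro c hc
        have hnn : ∀ j ∈ J, 0 ≤ ∑ t ∈ Finset.Icc ρ a, (if c (i,j) = t then F c else 0) :=
          fun j _ => Finset.sum_nonneg fun t _ => by split_ifs; exact hF0 c; exact le_rfl
        by_cases h : ∀ j, c (i,j) = 0
        · rw [if_neg (not_not.2 h)]
          exact Finset.sum_nonneg hnn
        · rw [if_pos h]
          push Not at h
          obtain ⟨j, hj⟩ := h
          rw [mem_CoreSet] at hc
          obtain ⟨h1, h2, h3⟩ := hc
          have h4 := h2 _ hj
          refine le_trans ?_ (Finset.single_le_sum hnn h4.2.1)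
          rw [Finset.sum_ite_eq]
          rw [if_pos]
          rw [Finset.mem_Icc]
          exact ⟨h4.2.2, h1 _⟩
    have hjt : ∀ j ∈ J, ∀ t ∈ Finset.Icc ρ a,
        ∑ c ∈ (CoreSet ρ a (insert i I) J).filter (fun c => c (i,j) = t), F c ≤
          g (i,j) t * ∑ c ∈ CoreSet ρ a I (J.erase j), F c := by
      intro j hj t ht
      have ht0 : t ≠ 0 := by rw [Finset.mem_Icc] at ht; omega
      rw [Finset.mul_sum]
      have hval : ∀ c ∈ (CoreSet ρ a (insert i I) J).filter (fun c => c (i,j) = t),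
          F c = g (i,j) t * F (Function.update c (i,j) 0) := by
        intro c hc
        rw [Finset.mem_filter] at hc
        simp only [hF]
        rw [← Finset.mul_prod_erase Finset.univ _ (Finset.mem_univ (i,j)),
          ← Finset.mul_prod_erase Finset.univ (fun p => g p (Function.update c (i,j) 0 p)) (Finset.mem_univ (i,j))]
        rw [Function.update_self, hg0, one_mul, hc.2]
        congr 1
        apply Finset.prod_congr rfl
        intro p hp
        rw [Function.update_of_ne (Finset.ne_of_mem_erase hp)]
      rw [Finset.sum_congr rfl hval]
      have hinj : Set.InjOn (fun c : ι × ι → ℕ => Function.update c (i,j) 0)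
          ((CoreSet ρ a (insert i I) J).filter (fun c => c (i,j) = t)) := by
        intro c hc c' hc' h
        rw [Finset.mem_coe, Finset.mem_filter] at hc hc'
        ext p
        by_cases hp : p = (i,j)
        · rw [hp, hc.2, hc'.2]
        · have := congrFun h p
          simpa [Function.update_of_ne hp] using this
      rw [← Finset.sum_image (f := fun c => g (i,j) t * F c) hinj]
      apply Finset.sum_le_sum_of_subset_of_nonneg
      · intro c' hc'
        rw [Finset.mem_image] at hc'
        obtain ⟨c, hc, rfl⟩ := hc'
        rw [Finset.mem_filter, mem_CoreSet] at hc
        obtain ⟨⟨h1, h2, h3, h4⟩, h0⟩ := hc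
        have hle : ∀ p, Function.update c (i,j) 0 p ≠ 0 → p ≠ (i,j) ∧ c p ≠ 0 := by
          intro p hp
          by_cases h : p = (i,j)
          · subst h; simp at hp
          · rw [Function.update_of_ne h] at hp; exact ⟨h, hp⟩
        rw [mem_CoreSet]
        refine ⟨?_, ?_, ?_, ?_⟩
        · intro p
          by_cases h : p = (i,j)
          · subst h; simp
          · rw [Function.update_of_ne h]; exact h1 p
        · rintro ⟨i', j'⟩ hp
          obtain ⟨hne, hp'⟩ := hle _ hp
          obtain ⟨q1, q2, q3⟩ := h2 _ hp'
          rw [Function.update_of_ne hne]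
          have hij : c (i,j) ≠ 0 := by rw [h0]; exact ht0
          have hi' : i' ≠ i := by
            rintro rfl
            exact hne (by rw [h3 _ _ _ hij hp'])
          have hj' : j' ≠ j := by
            rintro rfl
            exact hne (by rw [h4 _ _ _ hij hp'])
          refine ⟨?_, ?_, q3⟩
          · exact (Finset.mem_insert.1 q1).resolve_left hi'
          · exact Finset.mem_erase.2 ⟨hj', q2⟩
        · intro i1 j1 j2 e1 e2
          exact h3 _ _ _ (hle _ e1).2 (hle _ e2).2
        · intro i1 i2 j1 e1 e2
          exact h4 _ _ _ (hle _ e1).2 (hle _ e2).2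
      · intro c _ _
        exact mul_nonneg (hg _ _) (hF0 c)
    have hP0 := PP_nonneg v U y J hy0
    calc ∑ c ∈ CoreSet ρ a (insert i I) J, F c ≤ _ := hsplit
      _ ≤ PP v U y J * R + ∑ j ∈ J, Ω i (v j) * (PP v U y (J.erase j) * R) := by
        apply add_le_add (ih J)
        apply Finset.sum_le_sum
        intro j hj
        have hE : 0 ≤ PP v U y (J.erase j) * R := mul_nonneg (PP_nonneg v U y _ hy0) hR0
        calc _ ≤ ∑ t ∈ Finset.Icc ρ a, g (i,j) t * (PP v U y (J.erase j) * R) := by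
              apply Finset.sum_le_sum
              intro t ht
              exact (hjt j hj t ht).trans (mul_le_mul_of_nonneg_left (ih _) (hg _ _))
          _ ≤ _ := by
              rw [← Finset.sum_mul]
              exact mul_le_mul_of_nonneg_right (hΩ i j) hE
      _ ≤ PP v U y J * R + ∑ u ∈ U, Ω i u * (PP v U y J * y u * R) := by
        apply add_le_add le_rfl
        rw [← Finset.sum_fiberwise_of_maps_to (s := J) (t := U) (g := v) (fun j _ => hU j)]
        apply Finset.sum_le_sum
        intro u hu
        rcases Nat.eq_zero_or_pos (KK v J u) with h0 | h0
        · have he : (J.filter fun j => v j = u) = ∅ := Finset.card_eq_zero.1 h0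
          rw [he, Finset.sum_empty]
          exact mul_nonneg (hΩ0 _ _) (mul_nonneg (mul_nonneg hP0 (hy0 u)) hR0)
        · have hK : (0:ℝ) < KK v J u := by exact_mod_cast h0
          have : ∀ j ∈ J.filter (fun j => v j = u), Ω i (v j) * (PP v U y (J.erase j) * R) =
              Ω i u * (PP v U y J * y u * R) / KK v J u := by
            intro j hj
            rw [Finset.mem_filter] at hj
            obtain ⟨hj, rfl⟩ := hj
            rw [← PP_erase v U y J j hj (hU j) (hy j)]
            field_simp
          rw [Finset.sum_congr rfl this, Finset.sum_const, nsmul_eq_mul]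
          have e : ((J.filter fun j => v j = u).card : ℝ) = KK v J u := rfl
          rw [e]
          apply le_of_eq
          field_simp
      _ = _ := by
        have : ∑ u ∈ U, Ω i u * (PP v U y J * y u * R) = PP v U y J * R * ∑ u ∈ U, Ω i u * y u := by
          rw [Finset.mul_sum]
          apply Finset.sum_congr rfl; intro u _; ring
        rw [this]; ring

end TM

namespace TM
set_option linter.unusedSectionVars false
variable {ι : Type*} [Fintype ι]

def wt (u u' t : ℕ) : ℝ := (u.choose t : ℝ) * (u'.choose t : ℝ) * (t.factorial : ℝ) * 2 ^ t.choose 2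

lemma wt_nonneg (u u' t : ℕ) : 0 ≤ wt u u' t := by unfold wt; positivity
lemma wt_zero (u u' : ℕ) : wt u u' 0 = 1 := by simp [wt]

lemma sum_ov_le {n : ℕ} (c : Fin n → ι) :
    ∑ σ : Equiv.Perm (Fin n), (2:ℝ) ^ ov c σ ≤
      ∑ t ∈ Finset.univ.image (pat c), (∏ p : ι × ι, wt (fib c p.1).card (fib c p.2).card (t p)) *
        ((n - ∑ p, t p).factorial : ℝ) := by
  rw [← Finset.sum_fiberwise_of_maps_to (s := Finset.univ) (t := Finset.univ.image (pat c)) (g := pat c)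
    (fun σ _ => Finset.mem_image_of_mem _ (Finset.mem_univ σ))]
  apply Finset.sum_le_sum
  intro t _
  have h : ∀ σ ∈ Finset.univ.filter (fun σ => pat c σ = t), (2:ℝ) ^ ov c σ = ∏ p, (2:ℝ) ^ (t p).choose 2 := by
    intro σ hσ
    rw [Finset.mem_filter] at hσ
    rw [ov_eq_pat, hσ.2, Finset.prod_pow_eq_pow_sum]
  rw [Finset.sum_congr rfl h, Finset.sum_const, nsmul_eq_mul]
  have hc : ((Finset.univ.filter fun σ : Equiv.Perm (Fin n) => pat c σ = t).card : ℝ) ≤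
      (((n - ∑ p, t p).factorial : ℝ) * ∏ p, ((t p).factorial : ℝ)) *
        ((∏ p : ι × ι, ((fib c p.1).card.choose (t p) : ℝ)) * ∏ p : ι × ι, ((fib c p.2).card.choose (t p) : ℝ)) := by
    exact_mod_cast card_pattern c t
  calc _ ≤ (((n - ∑ p, t p).factorial : ℝ) * ∏ p, ((t p).factorial : ℝ)) *
        ((∏ p : ι × ι, ((fib c p.1).card.choose (t p) : ℝ)) * ∏ p : ι × ι, ((fib c p.2).card.choose (t p) : ℝ)) *
        ∏ p, (2:ℝ) ^ (t p).choose 2 := by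
        apply mul_le_mul_of_nonneg_right hc
        exact Finset.prod_nonneg fun _ _ => by positivity
    _ = _ := by
        unfold wt
        simp only [Finset.prod_mul_distrib]
        ring

lemma rr_row {n : ℕ} (c : Fin n → ι) (σ : Equiv.Perm (Fin n)) (i : ι) :
    ∑ j, rr c σ (i,j) = (fib c i).card := by
  rw [Finset.card_eq_sum_card_fiberwise (s := fib c i) (f := fun x => c (σ x)) (t := Finset.univ) (by simp [Set.MapsTo])]
  apply Finset.sum_congr rfl
  intro j _
  unfold rr fib
  rw [Finset.filter_filter]

lemma rr_col {n : ℕ} (c : Fin n → ι) (σ : Equiv.Perm (Fin n)) (j : ι) :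
    ∑ i, rr c σ (i,j) = (fib c j).card := by
  have : (fib c j).card = (Finset.univ.filter fun x => c (σ x) = j).card := by
    symm
    apply Finset.card_bij (fun x _ => σ x)
    · intro x hx
      rw [mem_fib]
      simpa using hx
    · intro x _ y _ h; exact σ.injective h
    · intro y hy
      refine ⟨σ⁻¹ y, ?_, by simp⟩
      rw [mem_fib] at hy
      simpa using hy
  rw [this, Finset.card_eq_sum_card_fiberwise (f := fun x => c x) (t := Finset.univ) (by simp [Set.MapsTo])]
  apply Finset.sum_congr rfl
  intro i _
  unfold rr
  rw [Finset.filter_filter]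
  congr 1
  ext x; simp [and_comm]

lemma pat_le_rr {n : ℕ} (c : Fin n → ι) (σ : Equiv.Perm (Fin n)) (p : ι × ι) : pat c σ p ≤ rr c σ p := by
  unfold pat; split_ifs <;> omega

lemma pat_row {n : ℕ} (c : Fin n → ι) (σ : Equiv.Perm (Fin n)) (i : ι) :
    ∑ j, pat c σ (i,j) ≤ (fib c i).card := by
  rw [← rr_row c σ i]; exact Finset.sum_le_sum fun j _ => pat_le_rr c σ _

lemma pat_col {n : ℕ} (c : Fin n → ι) (σ : Equiv.Perm (Fin n)) (j : ι) :
    ∑ i, pat c σ (i,j) ≤ (fib c j).card := by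
  rw [← rr_col c σ j]; exact Finset.sum_le_sum fun j _ => pat_le_rr c σ _

lemma sum_fib {n : ℕ} (c : Fin n → ι) : ∑ i, (fib c i).card = n := by
  have := Finset.card_eq_sum_card_fiberwise (f := c) (s := Finset.univ) (t := Finset.univ) (by simp [Set.MapsTo])
  simpa [fib] using this.symm

lemma pat_sum {n : ℕ} (c : Fin n → ι) (σ : Equiv.Perm (Fin n)) : ∑ p, pat c σ p ≤ n := by
  rw [Fintype.sum_prod_type]
  calc _ ≤ ∑ i, (fib c i).card := Finset.sum_le_sum fun i _ => pat_row c σ i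
    _ = n := sum_fib c

def core (ρ : ℕ) (t : ι × ι → ℕ) (p : ι × ι) : ℕ := if ρ ≤ t p then t p else 0
def smal (ρ : ℕ) (t : ι × ι → ℕ) (p : ι × ι) : ℕ := if ρ ≤ t p then 0 else t p

lemma core_add_smal (ρ : ℕ) (t : ι × ι → ℕ) (p : ι × ι) : core ρ t p + smal ρ t p = t p := by
  unfold core smal; split_ifs <;> simp

lemma two_le_sum {f : ι → ℕ} {i j : ι} (h : i ≠ j) : f i + f j ≤ ∑ x, f x := by
  rw [← Finset.sum_pair h]
  exact Finset.sum_le_sum_of_subset (Finset.subset_univ _)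

lemma core_mem {n : ℕ} (c : Fin n → ι) (σ : Equiv.Perm (Fin n)) (ρ a : ℕ) (hρ : a < 2 * ρ)
    (hv : ∀ i, (fib c i).card ≤ a) : core ρ (pat c σ) ∈ CoreSet ρ a Finset.univ Finset.univ := by
  have hc : ∀ p, core ρ (pat c σ) p ≠ 0 → ρ ≤ pat c σ p := by
    intro p hp; unfold core at hp; split_ifs at hp with h; exact h; simp at hp
  have hle : ∀ p, core ρ (pat c σ) p ≤ pat c σ p := by
    intro p; unfold core; split_ifs <;> omega
  rw [mem_CoreSet]
  refine ⟨?_, ?_, ?_, ?_⟩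
  · rintro ⟨i, j⟩
    refine (hle _).trans (le_trans ?_ ((pat_row c σ i).trans (hv i)))
    exact Finset.single_le_sum (f := fun j => pat c σ (i,j)) (fun _ _ => Nat.zero_le _) (Finset.mem_univ j)
  · intro p hp
    refine ⟨Finset.mem_univ _, Finset.mem_univ _, ?_⟩
    have := hc p hp
    unfold core; rw [if_pos this]; exact this
  · intro i j j' h1 h2
    by_contra hne
    have := two_le_sum (f := fun j => pat c σ (i,j)) hne
    have h3 := hc _ h1
    have h4 := hc _ h2
    have h5 := (pat_row c σ i).trans (hv i)
    omega
  · intro i i' j h1 h2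
    by_contra hne
    have := two_le_sum (f := fun i => pat c σ (i,j)) hne
    have h3 := hc _ h1
    have h4 := hc _ h2
    have h5 := (pat_col c σ j).trans (hv j)
    omega

lemma core_sum {n : ℕ} (c : Fin n → ι) (σ : Equiv.Perm (Fin n)) (ρ m0 : ℕ) (_hρ : 0 < ρ)
    (hm : ∑ i ∈ Finset.univ.filter (fun i => ρ ≤ (fib c i).card), (fib c i).card + m0 ≤ n) :
    ∑ p, core ρ (pat c σ) p + m0 ≤ n := by
  refine le_trans (Nat.add_le_add_right ?_ m0) hm
  rw [Fintype.sum_prod_type, Finset.sum_filter]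
  apply Finset.sum_le_sum
  intro i _
  have hle : ∀ p, core ρ (pat c σ) p ≤ pat c σ p := by
    intro p; unfold core; split_ifs <;> omega
  split_ifs with h
  · exact (Finset.sum_le_sum fun j _ => hle _).trans (pat_row c σ i)
  · rw [Nat.le_zero, Finset.sum_eq_zero_iff]
    intro j _
    unfold core
    rw [if_neg]
    intro h2
    apply h
    refine h2.trans (le_trans ?_ (pat_row c σ i))
    exact Finset.single_le_sum (f := fun j => pat c σ (i,j)) (fun _ _ => Nat.zero_le _) (Finset.mem_univ j)

lemma fact_ratio (N : ℕ) (s : ℕ) :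
    ((N + s : ℕ) : ℝ) ^ s * (N.factorial : ℝ) ≤ Real.exp s * ((N + s).factorial : ℝ) := by
  induction s with
  | zero => simp
  | succ s ih =>
    rcases Nat.eq_zero_or_pos (N + s) with h0 | h0
    · have : N = 0 ∧ s = 0 := by omega
      obtain ⟨rfl, rfl⟩ := this
      simp
    have hM : (0:ℝ) < ((N + s : ℕ) : ℝ) := by exact_mod_cast h0
    set M : ℝ := ((N + s : ℕ) : ℝ) with hMd
    have e1 : ((N + (s+1) : ℕ) : ℝ) = M + 1 := by rw [hMd]; push_cast; ring
    have e2 : ((N + (s+1)).factorial : ℝ) = (M + 1) * ((N+s).factorial : ℝ) := by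
      rw [← add_assoc, Nat.factorial_succ]; push_cast; rw [hMd]; push_cast; ring
    rw [e1, e2]
    have h1 : (M + 1) ^ s ≤ Real.exp 1 * M ^ s := by
      have : M + 1 ≤ M * Real.exp (1/M) := by
        have := Real.add_one_le_exp (1/M)
        calc M + 1 = M * (1/M + 1) := by field_simp; ring
          _ ≤ _ := by gcongr
      calc (M+1)^s ≤ (M * Real.exp (1/M))^s := by gcongr
        _ = M^s * Real.exp (s * (1/M)) := by rw [mul_pow, ← Real.exp_nat_mul]
        _ ≤ M^s * Real.exp 1 := by
            gcongr
            have : (s:ℝ) ≤ M := by rw [hMd]; push_cast; linarith [Nat.cast_nonneg (α := ℝ) N]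
            rw [mul_one_div, div_le_one hM]; exact this
        _ = _ := by ring
    have e3 : Real.exp ((s+1 : ℕ) : ℝ) = Real.exp s * Real.exp 1 := by rw [← Real.exp_add]; push_cast; rfl
    rw [e3, pow_succ]
    have hN : (0:ℝ) ≤ N.factorial := by positivity
    calc (M+1)^s * (M+1) * (N.factorial : ℝ) ≤ (Real.exp 1 * M ^ s) * (M+1) * (N.factorial : ℝ) := by gcongr
      _ = Real.exp 1 * (M+1) * (M ^ s * N.factorial) := by ring
      _ ≤ Real.exp 1 * (M+1) * (Real.exp s * ((N + s).factorial : ℝ)) := by gcongr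
      _ = _ := by ring

lemma fact_small (n Tc Ts m0 : ℕ) (hm0 : 0 < m0) (h1 : Tc + m0 ≤ n) (h2 : Tc + Ts ≤ n) :
    ((n - (Tc + Ts)).factorial : ℝ) ≤ ((n - Tc).factorial : ℝ) * (Real.exp 1 / m0) ^ Ts := by
  have h := fact_ratio (n - (Tc + Ts)) Ts
  have e : n - (Tc + Ts) + Ts = n - Tc := by omega
  rw [e] at h
  have hm : (0:ℝ) < m0 := by exact_mod_cast hm0
  have h3 : (m0 : ℝ) ^ Ts ≤ ((n - Tc : ℕ) : ℝ) ^ Ts := by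
    gcongr; omega
  rw [div_pow, ← Real.exp_nat_mul, mul_one, mul_div_assoc', le_div_iff₀ (by positivity)]
  calc _ ≤ ((n - (Tc + Ts)).factorial : ℝ) * ((n - Tc : ℕ) : ℝ) ^ Ts := by gcongr
    _ ≤ _ := by linarith

def smallSet (ρ : ℕ) : Finset ℕ := insert 0 (Finset.Ico 2 ρ)

lemma smal_mem {n : ℕ} (c : Fin n → ι) (σ : Equiv.Perm (Fin n)) (ρ : ℕ) :
    smal ρ (pat c σ) ∈ Fintype.piFinset fun _ : ι × ι => smallSet ρ := by
  rw [Fintype.mem_piFinset]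
  intro p
  unfold smal smallSet pat
  simp only [Finset.mem_insert, Finset.mem_Ico]
  split_ifs <;> omega

lemma sum_ov_le2 {n : ℕ} (c : Fin n → ι) (ρ a m0 : ℕ) (hρ : a < 2 * ρ) (hρ0 : 0 < ρ) (hm0 : 0 < m0)
    (hv : ∀ i, (fib c i).card ≤ a)
    (hm : ∑ i ∈ Finset.univ.filter (fun i => ρ ≤ (fib c i).card), (fib c i).card + m0 ≤ n) :
    ∑ σ : Equiv.Perm (Fin n), (2:ℝ) ^ ov c σ ≤
      (∏ p : ι × ι, ∑ t ∈ smallSet ρ, wt (fib c p.1).card (fib c p.2).card t * (Real.exp 1 / m0) ^ t) *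
      ∑ t ∈ (CoreSet ρ a Finset.univ Finset.univ).filter (fun t : ι × ι → ℕ => ∑ p, t p + m0 ≤ n),
        (∏ p : ι × ι, wt (fib c p.1).card (fib c p.2).card (t p)) * ((n - ∑ p, t p).factorial : ℝ) := by
  set W : ι × ι → ℕ → ℝ := fun p t => wt (fib c p.1).card (fib c p.2).card t with hW
  have hW0 : ∀ p t, 0 ≤ W p t := fun p t => wt_nonneg _ _ _
  have hWz : ∀ p, W p 0 = 1 := fun p => wt_zero _ _
  refine (sum_ov_le c).trans ?_
  set CS := (CoreSet ρ a Finset.univ Finset.univ).filter (fun t : ι × ι → ℕ => ∑ p, t p + m0 ≤ n) with hCS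
  set SS := Fintype.piFinset fun _ : ι × ι => smallSet ρ with hSS
  have hprod : (∏ p : ι × ι, ∑ t ∈ smallSet ρ, W p t * (Real.exp 1 / m0) ^ t) =
      ∑ s ∈ SS, ∏ p, W p (s p) * (Real.exp 1 / m0) ^ (s p) := by
    rw [Finset.prod_univ_sum]
  change _ ≤ (∏ p : ι × ι, ∑ t ∈ smallSet ρ, W p t * (Real.exp 1 / m0) ^ t) * _
  rw [hprod, Finset.sum_mul_sum, ← Finset.sum_product']
  set H : (ι × ι → ℕ) × (ι × ι → ℕ) → ℝ := fun x => (∏ p, W p (x.1 p) * (Real.exp 1 / m0) ^ (x.1 p)) *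
    ((∏ p : ι × ι, wt (fib c p.1).card (fib c p.2).card (x.2 p)) * ((n - ∑ p, x.2 p).factorial : ℝ)) with hH
  have hH0 : ∀ x, 0 ≤ H x := by
    intro x
    apply mul_nonneg
    · exact Finset.prod_nonneg fun p _ => mul_nonneg (hW0 _ _) (by positivity)
    · exact mul_nonneg (Finset.prod_nonneg fun p _ => hW0 _ _) (by positivity)
  calc _ ≤ ∑ t ∈ Finset.univ.image (pat c), H (smal ρ t, core ρ t) := by
        apply Finset.sum_le_sum
        intro t ht
        rw [Finset.mem_image] at ht
        obtain ⟨σ, -, rfl⟩ := ht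
        set t := pat c σ
        have hT : ∑ p, t p = ∑ p, core ρ t p + ∑ p, smal ρ t p := by
          rw [← Finset.sum_add_distrib]
          exact Finset.sum_congr rfl fun p _ => (core_add_smal ρ t p).symm
        have hf := fact_small n (∑ p, core ρ t p) (∑ p, smal ρ t p) m0 hm0 (core_sum c σ ρ m0 hρ0 hm)
          (by rw [← hT]; exact pat_sum c σ)
        rw [← hT] at hf
        have hw : ∀ p, W p (t p) = W p (smal ρ t p) * W p (core ρ t p) := by
          intro p
          unfold smal core
          split_ifs <;> simp [hWz]
        calc (∏ p, W p (t p)) * ((n - ∑ p, t p).factorial : ℝ) ≤ (∏ p, W p (t p)) *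
              (((n - ∑ p, core ρ t p).factorial : ℝ) * (Real.exp 1 / m0) ^ ∑ p, smal ρ t p) := by
              apply mul_le_mul_of_nonneg_left hf
              exact Finset.prod_nonneg fun p _ => hW0 _ _
          _ = H (smal ρ t, core ρ t) := by
              rw [hH]
              simp only [hw, Finset.prod_mul_distrib, Finset.prod_pow_eq_pow_sum]
              simp only [hW]
              ring
    _ = ∑ x ∈ (Finset.univ.image (pat c)).image (fun t => (smal ρ t, core ρ t)), H x := by
        rw [Finset.sum_image (s := Finset.univ.image (pat c)) (g := fun t => (smal ρ t, core ρ t))]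
        intro t _ t' _ h
        simp only [Prod.mk.injEq] at h
        ext p
        rw [← core_add_smal ρ t p, ← core_add_smal ρ t' p, h.1, h.2]
    _ ≤ _ := by
        apply Finset.sum_le_sum_of_subset_of_nonneg
        · intro x hx
          rw [Finset.mem_image] at hx
          obtain ⟨t, ht, rfl⟩ := hx
          rw [Finset.mem_image] at ht
          obtain ⟨σ, -, rfl⟩ := ht
          rw [Finset.mem_product]
          refine ⟨smal_mem c σ ρ, ?_⟩
          rw [hCS, Finset.mem_filter]
          exact ⟨core_mem c σ ρ a hρ hv, core_sum c σ ρ m0 hρ0 hm⟩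
        · intro x _ _; exact hH0 x

lemma core_le_MS {n : ℕ} (c : Fin n → ι) (ρ a m0 : ℕ) (hm0 : 0 < m0) :
    ∑ t ∈ (CoreSet ρ a Finset.univ Finset.univ).filter (fun t : ι × ι → ℕ => ∑ p, t p + m0 ≤ n),
        (∏ p : ι × ι, wt (fib c p.1).card (fib c p.2).card (t p)) * ((n - ∑ p, t p).factorial : ℝ) ≤
    ∑ m ∈ Finset.Icc m0 n, (m.factorial : ℝ) * (m:ℝ) ^ (n - m) *
      ∑ t ∈ CoreSet ρ a Finset.univ Finset.univ,
        ∏ p : ι × ι, (wt (fib c p.1).card (fib c p.2).card (t p) * ((m:ℝ)⁻¹) ^ (t p)) := by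
  simp_rw [Finset.mul_sum]
  rw [Finset.sum_comm]
  have hnn : ∀ (t : ι × ι → ℕ) (m : ℕ), 0 ≤ (m.factorial : ℝ) * (m:ℝ) ^ (n - m) *
        ∏ p : ι × ι, (wt (fib c p.1).card (fib c p.2).card (t p) * ((m:ℝ)⁻¹) ^ (t p)) := by
    intro t m
    apply mul_nonneg (by positivity)
    exact Finset.prod_nonneg fun p _ => mul_nonneg (wt_nonneg _ _ _) (by positivity)
  refine le_trans ?_ (Finset.sum_le_sum_of_subset_of_nonneg (Finset.filter_subset
    (fun t : ι × ι → ℕ => ∑ p, t p + m0 ≤ n) _) fun t _ _ => Finset.sum_nonneg fun m _ => hnn t m)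
  apply Finset.sum_le_sum
  intro t ht
  rw [Finset.mem_filter] at ht
  have hT := ht.2
  set T := ∑ p, t p with hTd
  have hmem : n - T ∈ Finset.Icc m0 n := by rw [Finset.mem_Icc]; omega
  refine le_trans ?_ (Finset.single_le_sum (fun m _ => hnn t m) hmem)
  have hpos : (0:ℝ) < ((n - T : ℕ) : ℝ) := by
    have : 0 < n - T := by omega
    exact_mod_cast this
  rw [Finset.prod_mul_distrib, Finset.prod_pow_eq_pow_sum, ← hTd]
  have e : n - (n - T) = T := by omega
  rw [e, inv_pow]
  apply le_of_eq
  field_simp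

end TM

namespace TM
set_option linter.unusedSectionVars false
variable {ι : Type*} [Fintype ι]

def psi (θ : ℝ) : ℝ := if θ ≤ 1 then θ else Real.log θ - 1 + 2 / Real.sqrt θ

def ysel (k : ℕ) (w : ℝ) : ℝ := if (k:ℝ) * w ≤ 1 then (k:ℝ) else Real.sqrt (k / w)

lemma ysel_nonneg (k : ℕ) (w : ℝ) : 0 ≤ ysel k w := by
  unfold ysel; split_ifs <;> positivity

lemma ysel_pos (k : ℕ) (w : ℝ) (hk : 0 < k) (hw : 0 < w) : 0 < ysel k w := by
  have : (0:ℝ) < k := by exact_mod_cast hk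
  unfold ysel; split_ifs <;> positivity

lemma ysel_sq (k : ℕ) (w : ℝ) (hw : 0 < w) : ysel k w * Real.sqrt w ≤ Real.sqrt k := by
  have hk : (0:ℝ) ≤ k := by positivity
  unfold ysel
  split_ifs with h
  · have : (k:ℝ) = Real.sqrt k * Real.sqrt k := (Real.mul_self_sqrt hk).symm
    calc (k:ℝ) * Real.sqrt w = Real.sqrt k * (Real.sqrt (k * w)) := by
          rw [Real.sqrt_mul hk, ← mul_assoc, ← this]
      _ ≤ Real.sqrt k * 1 := by
          gcongr; rw [Real.sqrt_le_one]; exact h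
      _ = _ := mul_one _
  · rw [← Real.sqrt_mul (by positivity), div_mul_cancel₀ _ hw.ne']

lemma stirling_upper (k : ℕ) (hk : 0 < k) :
    (k.factorial : ℝ) ≤ k * ((k:ℝ)^k * Real.exp (1 - k)) := by
  induction k with
  | zero => omega
  | succ n ih =>
    rcases Nat.eq_zero_or_pos n with rfl | hn
    · simp
    have ih := ih hn
    have hn' : (0:ℝ) < n := by exact_mod_cast hn
    rw [Nat.factorial_succ]
    push_cast
    have key : (n:ℝ) * (n:ℝ)^n * Real.exp 1 ≤ ((n:ℝ)+1)^(n+1) := by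
      have h1 : (n:ℝ) * Real.exp (1/(n+1)) ≤ n + 1 := by
        have := Real.add_one_le_exp (-(1/((n:ℝ)+1)))
        have h2 : Real.exp (1/((n:ℝ)+1)) * Real.exp (-(1/((n:ℝ)+1))) = 1 := by
          rw [← Real.exp_add]; simp
        have h3 : -(1/((n:ℝ)+1)) + 1 = n/(n+1) := by field_simp; ring
        rw [h3] at this
        have h4 : Real.exp (1/((n:ℝ)+1)) * (n/(n+1)) ≤ 1 := by
          calc _ ≤ Real.exp (1/((n:ℝ)+1)) * Real.exp (-(1/((n:ℝ)+1))) := by gcongr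
            _ = 1 := h2
        rw [mul_div_assoc', div_le_one (by positivity)] at h4
        linarith
      calc (n:ℝ) * (n:ℝ)^n * Real.exp 1 = ((n:ℝ) * Real.exp (1/(n+1)))^(n+1) := by
            rw [mul_pow, ← Real.exp_nat_mul]
            push_cast
            have : ((n:ℝ)+1) * (1/(n+1)) = 1 := by field_simp
            rw [this]; ring
        _ ≤ _ := by gcongr
    have e : Real.exp (1 - (n:ℝ)) = Real.exp 1 * Real.exp (1 - ((n:ℝ)+1)) := by
      rw [← Real.exp_add]; congr 1; ring
    calc ((n:ℝ)+1) * (n.factorial:ℝ) ≤ ((n:ℝ)+1) * (n * ((n:ℝ)^n * Real.exp (1 - n))) := by gcongr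
      _ = ((n:ℝ)+1) * ((n:ℝ) * (n:ℝ)^n * Real.exp 1 * Real.exp (1 - ((n:ℝ)+1))) := by rw [e]; ring
      _ ≤ ((n:ℝ)+1) * (((n:ℝ)+1)^(n+1) * Real.exp (1 - ((n:ℝ)+1))) := by gcongr

lemma log_fact_le (k : ℕ) (hk : 0 < k) :
    Real.log (k.factorial : ℝ) ≤ k * Real.log k - k + 1 + Real.log k := by
  have hk' : (0:ℝ) < k := by exact_mod_cast hk
  have := Real.log_le_log (by positivity) (stirling_upper k hk)
  rw [Real.log_mul (by positivity) (by positivity), Real.log_mul (by positivity) (by positivity),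
    Real.log_pow, Real.log_exp] at this
  linarith

lemma factor_u (k : ℕ) (w N : ℝ) (hw : 0 < w) (hN : 1 ≤ N) (hkN : (k:ℝ) ≤ N) :
    ((k.factorial : ℝ) / ysel k w ^ k) ^ 2 * Real.exp (2 * ysel k w + ysel k w ^ 2 * w) ≤
      Real.exp (k * psi (k * w) + (2 * Real.log N + 2)) := by
  have hlN : 0 ≤ Real.log N := Real.log_nonneg hN
  rcases Nat.eq_zero_or_pos k with rfl | hk
  · simp [ysel, psi]; linarith
  have hk' : (0:ℝ) < k := by exact_mod_cast hk
  have hy := ysel_pos k w hk hw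
  set y := ysel k w with hyd
  have hpos : 0 < ((k.factorial : ℝ) / y ^ k) ^ 2 := by positivity
  rw [← Real.exp_log hpos, ← Real.exp_add, Real.exp_le_exp, Real.log_pow,
    Real.log_div (by positivity) (by positivity), Real.log_pow]
  have hs := log_fact_le k hk
  have hkl : Real.log k ≤ Real.log N := Real.log_le_log hk' hkN
  push_cast
  by_cases h : (k:ℝ) * w ≤ 1
  · have e1 : y = k := by rw [hyd]; simp [ysel, h]
    have e2 : psi (k*w) = k * w := by simp [psi, h]
    rw [e1, e2]
    nlinarith
  · have e1 : y = Real.sqrt (k/w) := by rw [hyd]; simp [ysel, h]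
    have e2 : psi (k*w) = Real.log (k*w) - 1 + 2 / Real.sqrt (k*w) := by simp [psi, h]
    have hkw : 0 < (k:ℝ) * w := by positivity
    have e3 : y = k / Real.sqrt (k*w) := by
      rw [e1, eq_div_iff (by positivity), ← Real.sqrt_mul (by positivity)]
      have : (k:ℝ)/w * (k*w) = k * k := by field_simp
      rw [this, Real.sqrt_mul_self hk'.le]
    have e4 : Real.log y = (Real.log k - Real.log w) / 2 := by
      rw [e1, Real.log_sqrt (by positivity), Real.log_div hk'.ne' hw.ne']
    have e5 : y ^ 2 * w = k := by
      rw [e1, Real.sq_sqrt (by positivity)]; field_simp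
    have e6 : (k:ℝ) * (2 / Real.sqrt (k*w)) = 2 * y := by rw [e3]; ring
    rw [e2, e4, e5, Real.log_mul hk'.ne' hw.ne', mul_add, e6]
    nlinarith

lemma dcoef_pos (u : ℕ) : 0 < dcoef u := by unfold dcoef; positivity

lemma dcoef_ge (t s : ℕ) : dcoef t * (2:ℝ) ^ (t * s) ≤ dcoef (t + s) := by
  unfold dcoef
  have h1 : (t.factorial : ℝ) ≤ (t+s).factorial := by
    exact_mod_cast Nat.factorial_le (by omega)
  have h2 : t.choose 2 + t * s ≤ (t+s).choose 2 := by
    induction s with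
    | zero => simp
    | succ s ih =>
      have ih := ih (by exact_mod_cast Nat.factorial_le (by omega))
      rw [← add_assoc, Nat.choose_succ_succ' (t+s) 1, Nat.choose_one_right, Nat.mul_succ]
      simp
      omega
  calc (2:ℝ)^t.choose 2 * t.factorial * 2^(t*s) = 2^(t.choose 2 + t*s) * t.factorial := by rw [pow_add]; ring
    _ ≤ _ := by
      gcongr
      norm_num

lemma lemQ (a ρ t s : ℕ) (m e : ℝ) (hm : 0 ≤ m) (he : 0 ≤ e) (hρ : ρ ≤ t) (hts : t + s ≤ a)
    (h : (a:ℝ)^2 * m ≤ e * 2^ρ) :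
    ((t+s).choose t : ℝ)^2 * dcoef t * m^s ≤ e^s * dcoef (t+s) := by
  have h1 : ((t+s).choose t : ℝ) ≤ (a:ℝ)^s := by
    have : (t+s).choose t = (t+s).choose s := by
      rw [Nat.choose_symm_add]
    rw [this]
    have h2 : (t+s).choose s ≤ (t+s)^s := Nat.choose_le_pow _ _
    calc (((t+s).choose s : ℕ) : ℝ) ≤ (((t+s)^s : ℕ) : ℝ) := by exact_mod_cast h2
      _ ≤ _ := by push_cast; gcongr; exact_mod_cast hts
  have hd := dcoef_pos t
  calc ((t+s).choose t : ℝ)^2 * dcoef t * m^s ≤ ((a:ℝ)^s)^2 * dcoef t * m^s := by gcongr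
    _ = dcoef t * ((a:ℝ)^2 * m)^s := by rw [mul_pow]; ring
    _ ≤ dcoef t * (e * 2^ρ)^s := by gcongr
    _ ≤ dcoef t * (e * 2^t)^s := by gcongr; norm_num
    _ = e^s * (dcoef t * 2^(t*s)) := by rw [mul_pow, pow_mul]; ring
    _ ≤ _ := by gcongr; exact dcoef_ge t s

lemma wt_eq (u u' t : ℕ) : wt u u' t = u.choose t * u'.choose t * dcoef t := by
  unfold wt dcoef; ring

lemma off_term (a ρ u u' t : ℕ) (m e : ℝ) (hm : 0 < m) (he : 0 ≤ e) (he1 : e ≤ 1) (hρ : ρ ≤ t)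
    (hu : u ≤ a) (hu' : u' ≤ a) (hne : ¬ (u = u' ∧ t = u)) (h : (a:ℝ)^2 * m ≤ e * 2^ρ) :
    wt u u' t * (m⁻¹)^t ≤ Real.sqrt e * (Real.sqrt (dcoef u * (m⁻¹)^u) * Real.sqrt (dcoef u' * (m⁻¹)^u')) := by
  by_cases h1 : t ≤ u
  swap
  · rw [wt_eq, Nat.choose_eq_zero_of_lt (not_le.1 h1)]; simp; positivity
  by_cases h2 : t ≤ u'
  swap
  · rw [wt_eq, Nat.choose_eq_zero_of_lt (not_le.1 h2)]; simp; positivity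
  obtain ⟨s, rfl⟩ := Nat.exists_eq_add_of_le h1
  obtain ⟨s', rfl⟩ := Nat.exists_eq_add_of_le h2
  have q1 := lemQ a ρ t s m e hm.le he hρ hu h
  have q2 := lemQ a ρ t s' m e hm.le he hρ hu' h
  have hd := dcoef_pos t
  have hds := dcoef_pos (t+s)
  have hds' := dcoef_pos (t+s')
  rw [← Real.sqrt_mul (by positivity), ← Real.sqrt_mul he]
  apply Real.le_sqrt_of_sq_le
  have hss : e^(s+s') ≤ e := by
    have : 1 ≤ s + s' := by
      by_contra hc
      apply hne; omega
    calc e^(s+s') ≤ e^1 := pow_le_pow_of_le_one he he1 this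
      _ = e := pow_one e
  have hm' : m * m⁻¹ = 1 := mul_inv_cancel₀ hm.ne'
  have key : (((t+s).choose t : ℝ)^2 * dcoef t * m^s) * (((t+s').choose t : ℝ)^2 * dcoef t * m^s') ≤
      (e^s * dcoef (t+s)) * (e^s' * dcoef (t+s')) := by
    apply mul_le_mul q1 q2 <;> positivity
  have e1 : (wt (t+s) (t+s') t * (m⁻¹)^t)^2 =
      ((((t+s).choose t : ℝ)^2 * dcoef t * m^s) * (((t+s').choose t : ℝ)^2 * dcoef t * m^s')) *
        ((m⁻¹)^(t+s) * (m⁻¹)^(t+s')) := by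
    have : m^s * m^s' * ((m⁻¹)^(t+s) * (m⁻¹)^(t+s')) = ((m⁻¹)^t)^2 := by
      have a1 : m^s * (m⁻¹)^s = 1 := by rw [← mul_pow, hm', one_pow]
      have a2 : m^s' * (m⁻¹)^s' = 1 := by rw [← mul_pow, hm', one_pow]
      calc _ = (m^s * (m⁻¹)^s) * (m^s' * (m⁻¹)^s') * ((m⁻¹)^t)^2 := by rw [pow_add, pow_add]; ring
        _ = _ := by rw [a1, a2]; ring
    rw [wt_eq, mul_pow, ← this]; ring
  rw [e1]
  calc _ ≤ ((e^s * dcoef (t+s)) * (e^s' * dcoef (t+s'))) * ((m⁻¹)^(t+s) * (m⁻¹)^(t+s')) := by gcongr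
    _ = e^(s+s') * (dcoef (t+s) * (m⁻¹)^(t+s) * (dcoef (t+s') * (m⁻¹)^(t+s'))) := by rw [pow_add e]; ring
    _ ≤ _ := by gcongr

def omm (ρ a : ℕ) (m : ℝ) (u u' : ℕ) : ℝ := ∑ t ∈ Finset.Icc ρ a, wt u u' t * (m⁻¹)^t

lemma omm_le (a ρ u u' : ℕ) (m e : ℝ) (hm : 0 < m) (he : 0 ≤ e) (he1 : e ≤ 1) (hρ0 : 0 < ρ)
    (hu : u ≤ a) (hu' : u' ≤ a) (h : (a:ℝ)^2 * m ≤ e * 2^ρ) :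
    omm ρ a m u u' ≤ (if u = u' then dcoef u * (m⁻¹)^u else 0) +
      a * Real.sqrt e * (Real.sqrt (dcoef u * (m⁻¹)^u) * Real.sqrt (dcoef u' * (m⁻¹)^u')) := by
  unfold omm
  have hd := dcoef_pos u
  have hd' := dcoef_pos u'
  set R := Real.sqrt e * (Real.sqrt (dcoef u * (m⁻¹)^u) * Real.sqrt (dcoef u' * (m⁻¹)^u')) with hR
  have hR0 : 0 ≤ R := by positivity
  have h1 : ∀ t ∈ Finset.Icc ρ a, wt u u' t * (m⁻¹)^t ≤
      (if t = u then (if u = u' then dcoef u * (m⁻¹)^u else 0) else 0) + R := by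
    intro t ht
    by_cases hc : u = u' ∧ t = u
    · obtain ⟨rfl, rfl⟩ := hc
      rw [if_pos rfl, if_pos rfl, wt_eq]
      simp; exact hR0
    · have := off_term a ρ u u' t m e hm he he1 (Finset.mem_Icc.1 ht).1 hu hu' hc h
      have h0 : 0 ≤ (if t = u then (if u = u' then dcoef u * (m⁻¹)^u else 0) else 0) := by
        split_ifs <;> positivity
      linarith
  calc _ ≤ ∑ t ∈ Finset.Icc ρ a, ((if t = u then (if u = u' then dcoef u * (m⁻¹)^u else 0) else 0) + R) :=
        Finset.sum_le_sum h1
    _ ≤ _ := by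
      rw [Finset.sum_add_distrib, Finset.sum_ite_eq', Finset.sum_const, nsmul_eq_mul]
      have hc : ((Finset.Icc ρ a).card : ℝ) ≤ a := by
        rw [Nat.card_Icc]; exact_mod_cast (by omega : a + 1 - ρ ≤ a)
      have h0 : 0 ≤ (if u = u' then dcoef u * (m⁻¹)^u else 0) := by
        split_ifs <;> positivity
      have e1 : a * Real.sqrt e * (Real.sqrt (dcoef u * (m⁻¹)^u) * Real.sqrt (dcoef u' * (m⁻¹)^u')) = a * R := by
        rw [hR]; ring
      rw [e1]
      have := mul_le_mul_of_nonneg_right hc hR0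
      split_ifs at h0 ⊢ <;> linarith

theorem MS_bound (n a ρ : ℕ) (v : ι → ℕ) (hv : ∀ i, v i ∈ Finset.Icc 1 a) (hn : Fintype.card ι ≤ n)
    (hn1 : 0 < n)
    (m e : ℝ) (hm : 0 < m) (he : 0 ≤ e) (he1 : e ≤ 1) (hρ0 : 0 < ρ)
    (h : (a:ℝ)^2 * m ≤ e * 2^ρ) :
    ∑ t ∈ CoreSet ρ a (Finset.univ : Finset ι) (Finset.univ : Finset ι), ∏ p : ι × ι, (wt (v p.1) (v p.2) (t p) * (m⁻¹)^(t p)) ≤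
      Real.exp (∑ u ∈ Finset.Icc 1 a, ((KK v Finset.univ u : ℝ) * psi (KK v Finset.univ u * (dcoef u * (m⁻¹)^u))
        + (2 * Real.log n + 2)) + a * Real.sqrt e * (a * n)) := by
  set U := Finset.Icc 1 a with hU
  set k : ℕ → ℕ := fun u => KK v Finset.univ u with hk
  set w : ℕ → ℝ := fun u => dcoef u * (m⁻¹)^u with hw
  set y : ℕ → ℝ := fun u => ysel (k u) (w u) with hy
  have hwp : ∀ u, 0 < w u := fun u => by
    have := dcoef_pos u
    simp only [hw]; positivity
  have hy0 : ∀ u, 0 ≤ y u := fun u => ysel_nonneg _ _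
  have hkpos : ∀ j, 0 < k (v j) := fun j => by
    simp only [hk, KK]
    exact Finset.card_pos.2 ⟨j, by simp⟩
  have hyp : ∀ j, 0 < y (v j) := fun j => ysel_pos _ _ (hkpos j) (hwp _)
  have hksum : ∑ u ∈ U, k u = Fintype.card ι := by
    have := Finset.card_eq_sum_card_fiberwise (f := v) (s := Finset.univ) (t := U) (fun i _ => hv i)
    rw [Finset.card_univ] at this
    exact this.symm
  have hksumR : ∑ u ∈ U, (k u : ℝ) ≤ n := by
    have : ((∑ u ∈ U, k u : ℕ) : ℝ) ≤ n := by rw [hksum]; exact_mod_cast hn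
    push_cast at this; exact this
  set X : ℕ → ℝ := fun u => ∑ u' ∈ U, omm ρ a m u u' * y u' with hX
  have homm0 : ∀ u u', 0 ≤ omm ρ a m u u' := fun u u' =>
    Finset.sum_nonneg fun t _ => mul_nonneg (wt_nonneg _ _ _) (by positivity)
  have hX0 : ∀ u, 0 ≤ X u := fun u => Finset.sum_nonneg fun u' _ => mul_nonneg (homm0 _ _) (hy0 _)
  have hMS := matching_sum ρ a hρ0 v U hv y hy0 hyp
    (fun p t => wt (v p.1) (v p.2) t * (m⁻¹)^t) (fun p => by simp [wt_zero])
    (fun p t => mul_nonneg (wt_nonneg _ _ _) (by positivity))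
    (fun i u => omm ρ a m (v i) u) (fun i u => homm0 _ _) (fun i j => le_refl _) Finset.univ Finset.univ
  refine hMS.trans ?_
  have e1 : ∏ i : ι, (1 + ∑ u ∈ U, omm ρ a m (v i) u * y u) = ∏ u ∈ U, (1 + X u)^(k u) := by
    rw [← Finset.prod_fiberwise_of_maps_to (s := Finset.univ) (t := U) (g := v) (fun i _ => hv i)]
    refine Finset.prod_congr rfl fun u hu => ?_
    rw [Finset.prod_congr rfl (g := fun _ => 1 + X u)]
    · rw [Finset.prod_const]; rfl
    · intro i hi
      rw [(Finset.mem_filter.1 hi).2]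
  rw [e1]
  have e2 : ∀ u ∈ U, (1 + X u)^(k u) ≤ (k u).factorial / (y u)^(k u) * Real.exp (y u * (1 + X u)) := by
    intro u hu
    by_cases hku : k u = 0
    · rw [hku]; simp
      exact mul_nonneg (hy0 u) (by linarith [hX0 u])
    have hyu : 0 < y u := ysel_pos _ _ (Nat.pos_of_ne_zero hku) (hwp u)
    have := Real.pow_div_factorial_le_exp (y u * (1 + X u)) (mul_nonneg (hy0 u) (by linarith [hX0 u])) (k u)
    rw [div_le_iff₀ (by positivity), mul_pow] at this
    rw [div_mul_eq_mul_div, le_div_iff₀ (by positivity)]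
    linarith
  have e3 : PP v U y Finset.univ * ∏ u ∈ U, (1 + X u)^(k u) ≤
      ∏ u ∈ U, (((k u).factorial / (y u)^(k u))^2 * Real.exp (2 * y u + y u * X u)) := by
    have : ∏ u ∈ U, (((k u).factorial / (y u)^(k u))^2 * Real.exp (2 * y u + y u * X u)) =
      PP v U y Finset.univ * ∏ u ∈ U, ((k u).factorial / (y u)^(k u) * Real.exp (y u * (1 + X u))) := by
      unfold PP
      rw [← Finset.prod_mul_distrib]
      refine Finset.prod_congr rfl fun u hu => ?_
      have : Real.exp (2 * y u + y u * X u) = Real.exp (y u) * Real.exp (y u * (1 + X u)) := by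
        rw [← Real.exp_add]; congr 1; ring
      rw [this]; simp only [hk]; ring
    rw [this]
    apply mul_le_mul_of_nonneg_left
    · exact Finset.prod_le_prod (fun u _ => pow_nonneg (by linarith [hX0 u]) _) e2
    · unfold PP
      exact Finset.prod_nonneg fun u _ => by have := hy0 u; positivity
  refine e3.trans ?_
  have hquad : ∑ u ∈ U, y u * X u ≤ ∑ u ∈ U, (y u)^2 * w u + a * Real.sqrt e * (a * n) := by
    have q1 : ∀ u ∈ U, y u * X u ≤ (y u)^2 * w u + a * Real.sqrt e * (y u * Real.sqrt (w u)) * ∑ u' ∈ U, y u' * Real.sqrt (w u') := by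
      intro u hu
      have q2 : X u ≤ ∑ u' ∈ U, ((if u = u' then w u * y u' else 0) +
          a * Real.sqrt e * Real.sqrt (w u) * (y u' * Real.sqrt (w u'))) := by
        refine Finset.sum_le_sum fun u' hu' => ?_
        have := omm_le a ρ u u' m e hm he he1 hρ0 (Finset.mem_Icc.1 hu).2 (Finset.mem_Icc.1 hu').2 h
        have := mul_le_mul_of_nonneg_right this (hy0 u')
        refine this.trans (le_of_eq ?_)
        simp only [hw]
        split_ifs <;> ring
      rw [Finset.sum_add_distrib, Finset.sum_ite_eq, if_pos hu, ← Finset.mul_sum] at q2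
      have := mul_le_mul_of_nonneg_left q2 (hy0 u)
      refine this.trans (le_of_eq ?_)
      ring
    refine (Finset.sum_le_sum q1).trans ?_
    rw [Finset.sum_add_distrib]
    have q3 : ∑ u ∈ U, y u * Real.sqrt (w u) ≤ ∑ u ∈ U, Real.sqrt (k u) :=
      Finset.sum_le_sum fun u _ => ysel_sq _ _ (hwp u)
    have q30 : 0 ≤ ∑ u ∈ U, y u * Real.sqrt (w u) :=
      Finset.sum_nonneg fun u _ => mul_nonneg (hy0 u) (by positivity)
    have q4 : (∑ u ∈ U, Real.sqrt (k u))^2 ≤ a * n := by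
      have := sq_sum_le_card_mul_sum_sq (s := U) (f := fun u => Real.sqrt (k u))
      refine this.trans ?_
      have c1 : U.card = a := by simp [hU]
      rw [c1]
      have : ∑ i ∈ U, Real.sqrt (k i)^2 = ∑ i ∈ U, (k i : ℝ) :=
        Finset.sum_congr rfl fun i _ => Real.sq_sqrt (by positivity)
      rw [this]
      gcongr
    have q5 : ∑ u ∈ U, a * Real.sqrt e * (y u * Real.sqrt (w u)) * ∑ u' ∈ U, y u' * Real.sqrt (w u') =
      a * Real.sqrt e * (∑ u ∈ U, y u * Real.sqrt (w u))^2 := by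
      rw [← Finset.sum_mul, ← Finset.mul_sum]; ring
    rw [q5]
    gcongr
    exact (pow_le_pow_left₀ q30 q3 2).trans q4
  have hf : ∀ u ∈ U, ((k u).factorial / (y u)^(k u))^2 * Real.exp (2 * y u + (y u)^2 * w u) ≤
      Real.exp (k u * psi (k u * w u) + (2 * Real.log n + 2)) := by
    intro u hu
    apply factor_u _ _ _ (hwp u)
    · exact_mod_cast hn1
    · refine le_trans ?_ hksumR
      exact Finset.single_le_sum (f := fun u => (k u : ℝ)) (fun _ _ => by positivity) hu
  have e5 : ∏ u ∈ U, (((k u).factorial / (y u)^(k u))^2 * Real.exp (2 * y u + y u * X u)) =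
     (∏ u ∈ U, (((k u).factorial / (y u)^(k u))^2 * Real.exp (2 * y u + (y u)^2 * w u))) *
       Real.exp (∑ u ∈ U, y u * X u - ∑ u ∈ U, (y u)^2 * w u) := by
    rw [← Finset.sum_sub_distrib, Real.exp_sum, ← Finset.prod_mul_distrib]
    refine Finset.prod_congr rfl fun u hu => ?_
    rw [mul_assoc, ← Real.exp_add]
    congr 2; ring
  rw [e5, Real.exp_add, Real.exp_sum]
  apply mul_le_mul
  · exact Finset.prod_le_prod (fun u _ => by have := hy0 u; positivity) hf
  · rw [Real.exp_le_exp]; linarith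
  · positivity
  · exact Finset.prod_nonneg fun u _ => by positivity

end TM

namespace TM
set_option linter.unusedSectionVars false
variable {ι : Type*} [Fintype ι]

theorem second_moment_profile {n : ℕ} (hn : 0 < n) (c : Fin n → ι) (a ρ m0 : ℕ) (hρ : a < 2 * ρ) (hρ0 : 0 < ρ)
    (hm0 : 0 < m0) (hv : ∀ i, (fib c i).card ∈ Finset.Icc 1 a)
    (hm : ∑ i ∈ Finset.univ.filter (fun i => ρ ≤ (fib c i).card), (fib c i).card + m0 ≤ n)
    (e : ℝ) (he : 0 ≤ e) (he1 : e ≤ 1) (h : (a:ℝ)^2 * n ≤ e * 2^ρ) (S Φ : ℝ) (hΦ0 : 0 ≤ Φ)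
    (hS : ∏ p : ι × ι, ∑ t ∈ smallSet ρ, wt (fib c p.1).card (fib c p.2).card t * (Real.exp 1 / m0)^t ≤ S)
    (hΦ : ∀ m ∈ Finset.Icc m0 n, ((m.factorial : ℝ) * (m:ℝ)^(n-m)) *
      Real.exp (∑ u ∈ Finset.Icc 1 a, ((KK (fun i => (fib c i).card) Finset.univ u : ℝ) *
        psi (KK (fun i => (fib c i).card) Finset.univ u * (dcoef u * ((m:ℝ)⁻¹)^u)))) ≤ n.factorial * Φ) :
    1 ≤ S * (n * (Φ * Real.exp (a * (2 * Real.log n + 2) + a * Real.sqrt e * (a * n)))) *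
      pr (fun x : Om n => ∃ σ : Equiv.Perm (Fin n), Proper x (c ∘ σ)) := by
  have hnf : (0:ℝ) < n.factorial := by positivity
  have h1 := second_moment_perm c
  have h2 := sum_ov_le2 c ρ a m0 hρ hρ0 hm0 (fun i => (Finset.mem_Icc.1 (hv i)).2) hm
  have h3 := core_le_MS c ρ a m0 hm0
  have hcard : Fintype.card ι ≤ n := by
    rw [← sum_fib c, ← Finset.card_univ, Finset.card_eq_sum_ones]
    exact Finset.sum_le_sum fun i _ => (Finset.mem_Icc.1 (hv i)).1
  set Y := Real.exp (a * (2 * Real.log n + 2) + a * Real.sqrt e * (a * n)) with hY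
  have h4 : ∑ m ∈ Finset.Icc m0 n, (m.factorial : ℝ) * (m:ℝ)^(n-m) * ∑ t ∈ CoreSet ρ a (Finset.univ : Finset ι) (Finset.univ : Finset ι),
      ∏ p, (wt (fib c p.1).card (fib c p.2).card (t p) * ((m:ℝ)⁻¹)^(t p)) ≤ n.factorial * (n * (Φ * Y)) := by
    have h5 : ∀ m ∈ Finset.Icc m0 n, (m.factorial : ℝ) * (m:ℝ)^(n-m) * ∑ t ∈ CoreSet ρ a (Finset.univ : Finset ι) (Finset.univ : Finset ι),
      ∏ p, (wt (fib c p.1).card (fib c p.2).card (t p) * ((m:ℝ)⁻¹)^(t p)) ≤ n.factorial * (Φ * Y) := by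
      intro m hmm
      have hmp : 0 < m := lt_of_lt_of_le hm0 (Finset.mem_Icc.1 hmm).1
      have hmp' : (0:ℝ) < m := by exact_mod_cast hmp
      have hmn : (m:ℝ) ≤ n := by exact_mod_cast (Finset.mem_Icc.1 hmm).2
      have := MS_bound n a ρ (fun i => (fib c i).card) hv hcard hn (m:ℝ) e hmp' he he1 hρ0
        (le_trans (by gcongr) h)
      have h6 := hΦ m hmm
      calc _ ≤ (m.factorial : ℝ) * (m:ℝ)^(n-m) * _ := mul_le_mul_of_nonneg_left this (by positivity)
        _ = ((m.factorial : ℝ) * (m:ℝ)^(n-m) * Real.exp (∑ u ∈ Finset.Icc 1 a, ((KK (fun i => (fib c i).card) Finset.univ u : ℝ) *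
        psi (KK (fun i => (fib c i).card) Finset.univ u * (dcoef u * ((m:ℝ)⁻¹)^u))))) * Y := by
            rw [hY, mul_assoc _ (Real.exp _) (Real.exp _), ← Real.exp_add]
            congr 2
            rw [Finset.sum_add_distrib, Finset.sum_const, nsmul_eq_mul]
            simp
            ring
        _ ≤ (n.factorial * Φ) * Y := by gcongr
        _ = _ := by ring
    refine (Finset.sum_le_sum h5).trans ?_
    rw [Finset.sum_const, nsmul_eq_mul]
    have hc : ((Finset.Icc m0 n).card : ℝ) ≤ n := by
      rw [Nat.card_Icc]; exact_mod_cast (by omega : n + 1 - m0 ≤ n)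
    have hy : 0 ≤ Y := by positivity
    calc _ ≤ (n:ℝ) * (n.factorial * (Φ * Y)) := by gcongr
      _ = _ := by ring
  have hP := pr_nonneg (fun x : Om n => ∃ σ : Equiv.Perm (Fin n), Proper x (c ∘ σ))
  have hS0 : 0 ≤ S := le_trans (Finset.prod_nonneg fun p _ => Finset.sum_nonneg fun t _ =>
    mul_nonneg (wt_nonneg _ _ _) (by positivity)) hS
  have h7 : (n.factorial : ℝ) ≤ S * (n.factorial * (n * (Φ * Y))) *
      pr (fun x : Om n => ∃ σ : Equiv.Perm (Fin n), Proper x (c ∘ σ)) := by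
    refine h1.trans (mul_le_mul_of_nonneg_right (h2.trans ?_) hP)
    apply mul_le_mul hS (h3.trans h4) _ hS0
    exact Finset.sum_nonneg fun t _ => mul_nonneg (Finset.prod_nonneg fun p _ => wt_nonneg _ _ _) (by positivity)
  have h8 : (n.factorial : ℝ) * 1 ≤ n.factorial * (S * (n * (Φ * Y)) *
      pr (fun x : Om n => ∃ σ : Equiv.Perm (Fin n), Proper x (c ∘ σ))) := by
    rw [mul_one]; refine h7.trans (le_of_eq ?_); ring
  exact le_of_mul_le_mul_left h8 hnf

end TM

namespace TM

lemma count_sizes {n k : ℕ} (u : Fin k → ℕ) :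
    (Finset.univ.filter fun C : Fin n → Fin k => ∀ i, (fib C i).card = u i).card * ∏ i, (u i).factorial
      ≤ n.factorial := by
  set S := Finset.univ.filter fun C : Fin n → Fin k => ∀ i, (fib C i).card = u i with hS
  have hmem : ∀ C ∈ S, ∀ i, (fib C i).card = u i := fun C hC => (Finset.mem_filter.1 hC).2
  rcases S.eq_empty_or_nonempty with h0 | ⟨C0, hC0⟩
  · rw [h0]; simp
  have hex : ∀ C : Fin n → Fin k, ∃ σ : Equiv.Perm (Fin n), C ∈ S → C ∘ σ = C0 := by
    intro C
    by_cases hC : C ∈ S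
    swap
    · exact ⟨1, fun h => absurd h hC⟩
    have e : ∀ i, Nonempty ({a // C0 a = i} ≃ {b // C b = i}) := by
      intro i
      have h1 := hmem C hC i
      have h2 := hmem C0 hC0 i
      apply Fintype.card_eq.1
      rw [Fintype.card_of_subtype (fib C0 i) (fun x => mem_fib _ _ _),
        Fintype.card_of_subtype (fib C i) (fun x => mem_fib _ _ _), h1, h2]
    have e' : ∀ i, ({a // C0 a = i} ≃ {b // C b = i}) := fun i => (e i).some
    refine ⟨Equiv.ofFiberEquiv (f := C0) (g := C) e', fun _ => ?_⟩
    funext a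
    exact Equiv.ofFiberEquiv_map e' a
  choose sg hsg using hex
  set St := Finset.univ.filter fun g : Equiv.Perm (Fin n) => C0 ∘ g = C0 with hSt
  have hStc : St.card = ∏ i, (u i).factorial := by
    have h1 := DomMulAct.stabilizer_card C0
    have h2 : St.card = Fintype.card {g : Equiv.Perm (Fin n) // C0 ∘ g = C0} :=
      (Fintype.card_of_subtype St (fun x => by simp [hSt])).symm
    have h3 : ∀ i, Fintype.card {a // C0 a = i} = u i := fun i => by
      rw [Fintype.card_of_subtype (fib C0 i) (fun x => mem_fib _ _ _), hmem C0 hC0 i]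
    rw [h2]
    calc _ = _ := by convert h1
      _ = _ := by
        refine Finset.prod_congr rfl fun i _ => ?_
        rw [← h3 i]
  rw [← hStc, ← Finset.card_product]
  have : n.factorial = (Finset.univ : Finset (Equiv.Perm (Fin n))).card := by
    rw [Finset.card_univ, Fintype.card_perm, Fintype.card_fin]
  rw [this]
  apply Finset.card_le_card_of_injOn (fun p => sg p.1 * p.2) (fun _ _ => Finset.mem_coe.2 (Finset.mem_univ _))
  rintro ⟨C, g⟩ h ⟨C', g'⟩ h' heq
  have hm := Finset.mem_product.1 (Finset.mem_coe.1 h)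
  have hm' := Finset.mem_product.1 (Finset.mem_coe.1 h')
  simp only at hm hm' heq
  have hg : C0 ∘ g = C0 := (Finset.mem_filter.1 hm.2).2
  have hg' : C0 ∘ g' = C0 := (Finset.mem_filter.1 hm'.2).2
  have a1 : C ∘ (sg C * g : Equiv.Perm (Fin n)) = C0 := by
    rw [Equiv.Perm.coe_mul, ← Function.comp_assoc, hsg C hm.1, hg]
  have a2 : C' ∘ (sg C' * g' : Equiv.Perm (Fin n)) = C0 := by
    rw [Equiv.Perm.coe_mul, ← Function.comp_assoc, hsg C' hm'.1, hg']
  rw [heq] at a1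
  have hCC : C = C' := by
    funext v
    obtain ⟨w, rfl⟩ := (sg C' * g').surjective v
    have b1 := congrFun a1 w
    have b2 := congrFun a2 w
    simp only [Function.comp] at b1 b2
    rw [b1, b2]
  subst hCC
  have : g = g' := mul_left_cancel heq
  rw [this]

/-- good unordered colourings -/
def GoodQ {n : ℕ} (G : SimpleGraph (Fin n)) (t k : ℕ) (Q : Finset (Finset (Fin n))) : Prop :=
  Q.card = k ∧ (∀ s ∈ Q, s.Nonempty ∧ s.card ≤ t ∧ IndepFinset G s) ∧
    (∀ v : Fin n, ∃ s ∈ Q, v ∈ s) ∧ ∀ s ∈ Q, ∀ s' ∈ Q, s ≠ s' → Disjoint s s'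

lemma num_eq {n : ℕ} (G : SimpleGraph (Fin n)) (t k : ℕ) :
    numUnorderedColourings n t k G = (Finset.univ.filter fun Q => GoodQ G t k Q).card := by
  unfold numUnorderedColourings
  rw [← Set.ncard_coe_finset]
  congr 1
  ext Q
  rw [Finset.mem_coe, Finset.mem_filter]
  simp only [Finset.mem_univ, true_and]
  rfl

lemma exists_col {n : ℕ} (x : Om n) (t k : ℕ) (Q : Finset (Finset (Fin n))) (hQ : GoodQ (gr x) t k Q) :
    ∃ C : Fin n → Fin k, Proper x C ∧ (∀ i, (fib C i).card ∈ Finset.Icc 1 t) ∧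
      Finset.univ.image (fib C) = Q := by
  obtain ⟨h1, h2, h3, h4⟩ := hQ
  choose p hp using h3
  set e : Q ≃ Fin k := Finset.equivFinOfCardEq h1 with he
  have hpe : ∀ v, ∀ s ∈ Q, v ∈ s → p v = s := by
    intro v s hs hv
    by_contra hne
    exact Finset.disjoint_left.1 (h4 (p v) (hp v).1 s hs hne) (hp v).2 hv
  set C : Fin n → Fin k := fun v => e ⟨p v, (hp v).1⟩ with hC
  have hfib : ∀ i, fib C i = (e.symm i).1 := by
    intro i
    ext v
    rw [mem_fib]
    simp only [hC]
    rw [← Equiv.eq_symm_apply]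
    constructor
    · intro h
      rw [← h]; exact (hp v).2
    · intro h
      apply Subtype.ext
      exact hpe v _ (e.symm i).2 h
  refine ⟨C, ?_, ?_, ?_⟩
  · intro v w hvw heq
    have hv : v ∈ fib C (C v) := (mem_fib _ _ _).2 rfl
    have hw : w ∈ fib C (C v) := (mem_fib _ _ _).2 heq.symm
    rw [hfib] at hv hw
    exact (h2 _ (e.symm (C v)).2).2.2 v hv w hw hvw
  · intro i
    rw [hfib, Finset.mem_Icc]
    have := h2 _ (e.symm i).2
    exact ⟨Finset.card_pos.2 this.1, this.2.1⟩
  · ext s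
    simp only [Finset.mem_image, Finset.mem_univ, true_and]
    constructor
    · rintro ⟨i, rfl⟩; rw [hfib]; exact (e.symm i).2
    · intro hs
      exact ⟨e ⟨s, hs⟩, by rw [hfib]; simp⟩

def ColT (n k a : ℕ) : Finset (Fin n → Fin k) :=
  Finset.univ.filter fun C => ∀ i, (fib C i).card ∈ Finset.Icc 1 a

lemma num_le {n : ℕ} (x : Om n) (a k : ℕ) :
    numUnorderedColourings n a k (gr x) * k.factorial ≤
      ((ColT n k a).filter fun C => Proper x C).card := by
  rw [num_eq]
  have : k.factorial = (Finset.univ : Finset (Equiv.Perm (Fin k))).card := by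
    rw [Finset.card_univ, Fintype.card_perm, Fintype.card_fin]
  rw [this, ← Finset.card_product]
  have hex : ∀ Q : Finset (Finset (Fin n)), GoodQ (gr x) a k Q → ∃ C : Fin n → Fin k, Proper x C ∧ (∀ i, (fib C i).card ∈ Finset.Icc 1 a) ∧
      Finset.univ.image (fib C) = Q := fun Q hQ => exists_col x a k Q hQ
  set S := Finset.univ.filter fun Q => GoodQ (gr x) a k Q with hS
  rcases S.eq_empty_or_nonempty with h0 | ⟨Q0, hQ0⟩
  · rw [h0]; simp
  obtain ⟨D, -⟩ := hex Q0 (Finset.mem_filter.1 hQ0).2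
  have hex' : ∀ Q : Finset (Finset (Fin n)), ∃ C : Fin n → Fin k, Q ∈ S →
     (Proper x C ∧ (∀ i, (fib C i).card ∈ Finset.Icc 1 a) ∧ Finset.univ.image (fib C) = Q) := by
    intro Q
    by_cases hQ : GoodQ (gr x) a k Q
    · obtain ⟨C, hC⟩ := hex Q hQ
      exact ⟨C, fun _ => hC⟩
    · exact ⟨D, fun h => absurd (Finset.mem_filter.1 h).2 hQ⟩
  choose f hf using hex'
  have hfc : ∀ (σ : Equiv.Perm (Fin k)) (C : Fin n → Fin k) (i : Fin k), fib (σ ∘ C) (σ i) = fib C i := by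
    intro σ C i
    ext v
    simp [mem_fib]
  have him : ∀ (σ : Equiv.Perm (Fin k)) (C : Fin n → Fin k), Finset.univ.image (fib (σ ∘ C)) = Finset.univ.image (fib C) := by
    intro σ C
    ext s
    simp only [Finset.mem_image, Finset.mem_univ, true_and]
    constructor
    · rintro ⟨i, rfl⟩
      obtain ⟨j, rfl⟩ := σ.surjective i
      exact ⟨j, (hfc _ _ _).symm⟩
    · rintro ⟨i, rfl⟩
      exact ⟨σ i, hfc _ _ _⟩
  apply Finset.card_le_card_of_injOn (fun p => p.2 ∘ f p.1)
  · rintro ⟨Q, σ⟩ h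
    have hm := Finset.mem_product.1 (Finset.mem_coe.1 h)
    obtain ⟨b1, b2, b3⟩ := hf Q hm.1
    refine Finset.mem_coe.2 (Finset.mem_filter.2 ⟨Finset.mem_filter.2 ⟨Finset.mem_univ _, ?_⟩, ?_⟩)
    · intro i
      obtain ⟨j, rfl⟩ := σ.surjective i
      simp only
      rw [hfc]; exact b2 j
    · intro v w hvw heq
      exact b1 v w hvw (σ.injective heq)
  · rintro ⟨Q, σ⟩ h ⟨Q', σ'⟩ h' heq
    have hm := Finset.mem_product.1 (Finset.mem_coe.1 h)
    have hm' := Finset.mem_product.1 (Finset.mem_coe.1 h')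
    simp only at heq
    have hQQ : Q = Q' := by
      rw [← (hf Q hm.1).2.2, ← (hf Q' hm'.1).2.2, ← him σ (f Q), ← him σ' (f Q'), heq]
    subst hQQ
    have : σ = σ' := by
      ext1 i
      have hc := ((hf Q hm.1).2.1) i
      obtain ⟨v, hv⟩ := Finset.card_pos.1 (Finset.mem_Icc.1 hc).1
      rw [mem_fib] at hv
      have := congrFun heq v
      simp only [Function.comp, hv] at this
      exact this
    rw [this]

theorem first_moment (n k a : ℕ) (x : ℝ) (hx : 0 < x) :
    Enkt n k a * k.factorial ≤
      n.factorial * (x⁻¹)^n * (∑ u ∈ Finset.Icc 1 a, x^u / dcoef u)^k := by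
  have h1 : Enkt n k a * k.factorial ≤ ∑ C ∈ ColT n k a, (1/2 : ℝ)^(mono C).card := by
    unfold Enkt
    rw [Ep_eq_avg, mul_comm, ← avg_const_mul]
    have : ∀ C : Fin n → Fin k, (1/2:ℝ)^(mono C).card = avg (fun y : Om n => if Proper y C then (1:ℝ) else 0) :=
      fun C => (pr_proper C).symm
    simp_rw [this]
    rw [← avg_sum]
    apply avg_mono
    intro y
    rw [Finset.sum_boole]
    have := num_le y a k
    rw [mul_comm] at this
    exact_mod_cast this
  refine h1.trans ?_
  have h2 : ∀ C : Fin n → Fin k, (1/2 : ℝ)^(mono C).card = ∏ i, (1/2:ℝ)^((fib C i).card.choose 2) := by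
    intro C; rw [card_mono, Finset.prod_pow_eq_pow_sum]
  simp_rw [h2]
  set V := Fintype.piFinset fun _ : Fin k => Finset.Icc 1 a with hV
  have h3 : ∑ C ∈ ColT n k a, ∏ i, (1/2:ℝ)^((fib C i).card.choose 2) =
      ∑ u ∈ V, ∑ C ∈ (ColT n k a).filter (fun C => (fun i => (fib C i).card) = u), ∏ i, (1/2:ℝ)^((fib C i).card.choose 2) := by
    rw [Finset.sum_fiberwise_of_maps_to]
    intro C hC
    rw [hV, Fintype.mem_piFinset]
    exact (Finset.mem_filter.1 hC).2
  rw [h3]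
  have h4 : ∀ u ∈ V, ∑ C ∈ (ColT n k a).filter (fun C => (fun i => (fib C i).card) = u), ∏ i, (1/2:ℝ)^((fib C i).card.choose 2) ≤
      n.factorial * (x⁻¹)^n * ∏ i, (x^(u i) / dcoef (u i)) := by
    intro u hu
    have hcong : ∑ C ∈ (ColT n k a).filter (fun C => (fun i => (fib C i).card) = u), ∏ i, (1/2:ℝ)^((fib C i).card.choose 2) =
        ((ColT n k a).filter (fun C => (fun i => (fib C i).card) = u)).card * ∏ i, (1/2:ℝ)^((u i).choose 2) := by
      rw [← nsmul_eq_mul, ← Finset.sum_const]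
      refine Finset.sum_congr rfl fun C hC => ?_
      have := (Finset.mem_filter.1 hC).2
      refine Finset.prod_congr rfl fun i _ => ?_
      rw [← this]
    rw [hcong]
    have hd : ∀ i, 0 < dcoef (u i) := fun i => dcoef_pos _
    have hRpos : 0 ≤ n.factorial * (x⁻¹)^n * ∏ i, (x^(u i) / dcoef (u i)) := by
      apply mul_nonneg (by positivity)
      exact Finset.prod_nonneg fun i _ => by have := hd i; positivity
    rcases ((ColT n k a).filter (fun C => (fun i => (fib C i).card) = u)).eq_empty_or_nonempty with h0 | ⟨C, hC⟩
    · rw [h0]; simpa using hRpos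
    have hsum : ∑ i, u i = n := by
      rw [← sum_fib C]
      have := (Finset.mem_filter.1 hC).2
      refine Finset.sum_congr rfl fun i _ => ?_
      rw [← this]
    have hxx : (x⁻¹)^n * ∏ i, x^(u i) = 1 := by
      rw [Finset.prod_pow_eq_pow_sum, hsum, ← mul_pow, inv_mul_cancel₀ hx.ne', one_pow]
    have hcnt : (((ColT n k a).filter (fun C => (fun i => (fib C i).card) = u)).card : ℝ) * ∏ i, ((u i).factorial : ℝ) ≤ n.factorial := by
      have := count_sizes (n := n) u
      have hsub : ((ColT n k a).filter (fun C => (fun i => (fib C i).card) = u)).card ≤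
          (Finset.univ.filter fun C : Fin n → Fin k => ∀ i, (fib C i).card = u i).card := by
        apply Finset.card_le_card
        intro C hC
        rw [Finset.mem_filter]
        exact ⟨Finset.mem_univ _, fun i => congrFun (Finset.mem_filter.1 hC).2 i⟩
      have := (Nat.mul_le_mul_right _ hsub).trans this
      exact_mod_cast this
    have hpp : ∏ i, (x^(u i) / dcoef (u i)) = (∏ i, x^(u i)) * ((∏ i, (1/2:ℝ)^((u i).choose 2)) * (∏ i, ((u i).factorial : ℝ))⁻¹) := by
      rw [← Finset.prod_inv_distrib, ← Finset.prod_mul_distrib, ← Finset.prod_mul_distrib]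
      refine Finset.prod_congr rfl fun i _ => ?_
      unfold dcoef
      rw [one_div, inv_pow]
      field_simp
    have hfp : 0 < ∏ i, ((u i).factorial : ℝ) := Finset.prod_pos fun i _ => by positivity
    have hhp : 0 < ∏ i, (1/2:ℝ)^((u i).choose 2) := Finset.prod_pos fun i _ => by positivity
    rw [hpp]
    calc _ ≤ (n.factorial / ∏ i, ((u i).factorial : ℝ)) * ∏ i, (1/2:ℝ)^((u i).choose 2) := by
          gcongr
          rw [le_div_iff₀ hfp]; exact hcnt
      _ = n.factorial * ((x⁻¹)^n * ∏ i, x^(u i)) * ((∏ i, (1/2:ℝ)^((u i).choose 2)) * (∏ i, ((u i).factorial : ℝ))⁻¹) := by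
          rw [hxx]; field_simp
      _ = _ := by ring
  refine (Finset.sum_le_sum h4).trans (le_of_eq ?_)
  rw [← Finset.mul_sum, hV, ← Finset.prod_univ_sum (fun _ : Fin k => Finset.Icc 1 a) (fun _ u => x^u / dcoef u)]
  simp

end TM

namespace TM

lemma hasBounded_iff {n : ℕ} (G : SimpleGraph (Fin n)) (t k : ℕ) :
    HasBoundedColouring G t k ↔ ∃ C : Fin n → Fin k, (∀ v w, G.Adj v w → C v ≠ C w) ∧
      ∀ c, (fib C c).card ≤ t := by
  unfold HasBoundedColouring
  constructor
  · rintro ⟨C, h1, h2⟩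
    refine ⟨C, h1, fun c => le_trans (le_of_eq ?_) (h2 c)⟩
    congr 1; ext v; simp [mem_fib]
  · rintro ⟨C, h1, h2⟩
    refine ⟨C, h1, fun c => le_trans (le_of_eq ?_) (h2 c)⟩
    congr 1; ext v; simp [mem_fib]

lemma hasBounded_n {n : ℕ} (G : SimpleGraph (Fin n)) (t : ℕ) (ht : 1 ≤ t) : HasBoundedColouring G t n := by
  rw [hasBounded_iff]
  refine ⟨id, fun v w h => G.ne_of_adj h, fun c => ?_⟩
  have : fib (id : Fin n → Fin n) c = {c} := by ext v; simp [mem_fib]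
  rw [this]; simpa using ht

lemma chi_spec {n : ℕ} (G : SimpleGraph (Fin n)) (t : ℕ) (ht : 1 ≤ t) :
    HasBoundedColouring G t (chiBounded G t) := by
  have : (chiBounded G t) ∈ {k | HasBoundedColouring G t k} := Nat.sInf_mem ⟨n, hasBounded_n G t ht⟩
  exact this

lemma chi_le {n : ℕ} (G : SimpleGraph (Fin n)) (t k : ℕ) (h : HasBoundedColouring G t k) :
    chiBounded G t ≤ k := Nat.sInf_le h

lemma bounded_to_Q {n : ℕ} (G : SimpleGraph (Fin n)) (t k : ℕ) (h : HasBoundedColouring G t k) :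
    ∃ k' ≤ k, ∃ Q, GoodQ G t k' Q := by
  rw [hasBounded_iff] at h
  obtain ⟨C, h1, h2⟩ := h
  refine ⟨((Finset.univ.image C).image (fib C)).card, ?_, (Finset.univ.image C).image (fib C), rfl, ?_, ?_, ?_⟩
  · refine Finset.card_image_le.trans ?_
    have := Finset.card_le_univ (Finset.univ.image C)
    simpa using this
  · intro s hs
    obtain ⟨i, hi, rfl⟩ := Finset.mem_image.1 hs
    obtain ⟨v, -, rfl⟩ := Finset.mem_image.1 hi
    refine ⟨⟨v, (mem_fib _ _ _).2 rfl⟩, h2 _, ?_⟩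
    intro x hx y hy hxy
    rw [mem_fib] at hx hy
    exact h1 x y hxy (hx.trans hy.symm)
  · intro v
    exact ⟨fib C (C v), Finset.mem_image_of_mem _ (Finset.mem_image_of_mem _ (Finset.mem_univ _)), (mem_fib _ _ _).2 rfl⟩
  · intro s hs s' hs' hne
    obtain ⟨i, hi, rfl⟩ := Finset.mem_image.1 hs
    obtain ⟨j, hj, rfl⟩ := Finset.mem_image.1 hs'
    rw [Finset.disjoint_left]
    intro v hv hv'
    rw [mem_fib] at hv hv'
    apply hne; rw [← hv, ← hv']

/-- splitting off one vertex -/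
def splitQ {n : ℕ} (Q : Finset (Finset (Fin n))) (s : Finset (Fin n)) (v : Fin n) : Finset (Finset (Fin n)) :=
  insert {v} (insert (s.erase v) (Q.erase s))

lemma mem_splitQ {n : ℕ} (Q : Finset (Finset (Fin n))) (s T : Finset (Fin n)) (v : Fin n) :
    T ∈ splitQ Q s v ↔ T = {v} ∨ T = s.erase v ∨ (T ≠ s ∧ T ∈ Q) := by
  simp [splitQ]

lemma splitQ_good {n : ℕ} (G : SimpleGraph (Fin n)) (t k : ℕ) (ht : 1 ≤ t) (Q : Finset (Finset (Fin n)))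
    (hQ : GoodQ G t k Q) (s : Finset (Fin n)) (hs : s ∈ Q) (v : Fin n) (hv : v ∈ s) (h2 : 2 ≤ s.card) :
    GoodQ G t (k+1) (splitQ Q s v) := by
  obtain ⟨q1, q2, q3, q4⟩ := hQ
  have hce : (s.erase v).card = s.card - 1 := Finset.card_erase_of_mem hv
  have hne : (s.erase v).Nonempty := Finset.card_pos.1 (by omega)
  obtain ⟨w, hw⟩ := hne
  have hws := (Finset.mem_erase.1 hw)
  have huniq : ∀ T ∈ Q, ∀ x, x ∈ T → x ∈ s → T = s := by
    intro T hT x h1 h2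
    by_contra hc
    exact Finset.disjoint_left.1 (q4 T hT s hs hc) h1 h2
  have n1 : s.erase v ∉ Q.erase s := by
    intro h
    have := Finset.mem_erase.1 h
    exact this.1 (huniq _ this.2 w hw hws.2)
  have n2 : ({v} : Finset (Fin n)) ∉ insert (s.erase v) (Q.erase s) := by
    intro h
    rcases Finset.mem_insert.1 h with h | h
    · have : v ∈ s.erase v := h ▸ Finset.mem_singleton_self v
      simp at this
    · have := Finset.mem_erase.1 h
      exact this.1 (huniq _ this.2 v (Finset.mem_singleton_self v) hv)
  refine ⟨?_, ?_, ?_, ?_⟩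
  · unfold splitQ
    rw [Finset.card_insert_of_notMem n2, Finset.card_insert_of_notMem n1, Finset.card_erase_of_mem hs, q1]
    have : 0 < k := q1 ▸ Finset.card_pos.2 ⟨s, hs⟩
    omega
  · intro T hT
    rcases (mem_splitQ _ _ _ _).1 hT with rfl | rfl | h
    · refine ⟨⟨v, by simp⟩, by simpa using ht, ?_⟩
      intro x hx y hy hxy
      rw [Finset.mem_singleton] at hx hy
      subst hx; subst hy
      exact G.ne_of_adj hxy rfl
    · have := q2 s hs
      refine ⟨⟨w, hw⟩, by omega, ?_⟩
      intro x hx y hy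
      exact this.2.2 x (Finset.mem_of_mem_erase hx) y (Finset.mem_of_mem_erase hy)
    · exact q2 T h.2
  · intro x
    obtain ⟨T, hT, hx⟩ := q3 x
    by_cases hTs : T = s
    · subst hTs
      by_cases hxv : x = v
      · exact ⟨{v}, (mem_splitQ _ _ _ _).2 (Or.inl rfl), by simp [hxv]⟩
      · exact ⟨T.erase v, (mem_splitQ _ _ _ _).2 (Or.inr (Or.inl rfl)), Finset.mem_erase.2 ⟨hxv, hx⟩⟩
    · exact ⟨T, (mem_splitQ _ _ _ _).2 (Or.inr (Or.inr ⟨hTs, hT⟩)), hx⟩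
  · intro T hT T' hT' hne
    rw [Finset.disjoint_left]
    intro x hx hx'
    apply hne
    rcases (mem_splitQ _ _ _ _).1 hT with rfl | rfl | h <;>
    rcases (mem_splitQ _ _ _ _).1 hT' with rfl | rfl | h'
    · rfl
    · simp at hx; subst hx; simp at hx'
    · simp at hx; subst hx; exact absurd (huniq _ h'.2 _ hx' hv) h'.1
    · simp at hx'; subst hx'; simp at hx
    · rfl
    · exact absurd (huniq _ h'.2 x hx' (Finset.mem_of_mem_erase hx)) h'.1
    · simp at hx'; subst hx'; exact absurd (huniq _ h.2 _ hx hv) h.1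
    · exact absurd (huniq _ h.2 x hx (Finset.mem_of_mem_erase hx')) h.1
    · by_contra hc
      exact Finset.disjoint_left.1 (q4 T h.2 T' h'.2 hc) hx hx'

lemma sum_card_Q {n : ℕ} (G : SimpleGraph (Fin n)) (t k : ℕ) (Q : Finset (Finset (Fin n)))
    (hQ : GoodQ G t k Q) : ∑ s ∈ Q, s.card = n := by
  obtain ⟨q1, q2, q3, q4⟩ := hQ
  have := Finset.card_biUnion (s := Q) (t := id) (fun s hs s' hs' hne => q4 s hs s' hs' hne)
  simp only [id] at this
  rw [← this]
  have : Q.biUnion id = Finset.univ := by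
    ext v; simp only [Finset.mem_biUnion, id, Finset.mem_univ, iff_true]
    exact q3 v
  rw [this]; simp

lemma Q_le {n : ℕ} (G : SimpleGraph (Fin n)) (t k : ℕ) (Q : Finset (Finset (Fin n)))
    (hQ : GoodQ G t k Q) : n ≤ t * k := by
  rw [← sum_card_Q G t k Q hQ, ← hQ.1, mul_comm]
  exact (Finset.sum_le_card_nsmul _ _ t fun s hs => (hQ.2.1 s hs).2.1).trans (by simp)

lemma Q_succ {n : ℕ} (G : SimpleGraph (Fin n)) (t k : ℕ) (ht : 1 ≤ t) (Q : Finset (Finset (Fin n)))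
    (hQ : GoodQ G t k Q) (hk : k < n) : ∃ Q', GoodQ G t (k+1) Q' := by
  have : ∃ s ∈ Q, 1 < s.card := by
    apply Finset.exists_lt_of_sum_lt
    rw [sum_card_Q G t k Q hQ]; simp [hQ.1, hk]
  obtain ⟨s, hs, h2⟩ := this
  obtain ⟨v, hv⟩ := (hQ.2.1 s hs).1
  exact ⟨_, splitQ_good G t k ht Q hQ s hs v hv h2⟩

lemma Q_up {n : ℕ} (G : SimpleGraph (Fin n)) (t k : ℕ) (ht : 1 ≤ t) (Q : Finset (Finset (Fin n)))
    (hQ : GoodQ G t k Q) (K : ℕ) (hkK : k ≤ K) (hK : K ≤ n) : ∃ Q', GoodQ G t K Q' := by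
  induction K, hkK using Nat.le_induction with
  | base => exact ⟨Q, hQ⟩
  | succ K h ih =>
    obtain ⟨Q', hQ'⟩ := ih (by omega)
    exact Q_succ G t K ht Q' hQ' (by omega)

lemma Q_two {n : ℕ} (G : SimpleGraph (Fin n)) (t k : ℕ) (ht : 1 ≤ t) (Q : Finset (Finset (Fin n)))
    (hQ : GoodQ G t k Q) (hk : k + 2 ≤ n) : 2 ≤ numUnorderedColourings n t (k+1) G := by
  have key : ∃ s ∈ Q, ∃ s' ∈ Q, ∃ v ∈ s, ∃ w ∈ s', v ≠ w ∧ 2 ≤ s.card ∧ 2 ≤ s'.card ∧ (s = s' → 3 ≤ s.card) := by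
    by_cases h3 : ∃ s ∈ Q, 3 ≤ s.card
    · obtain ⟨s, hs, h3⟩ := h3
      obtain ⟨v, hv, w, hw, hne⟩ := Finset.one_lt_card.1 (by omega : 1 < s.card)
      exact ⟨s, hs, s, hs, v, hv, w, hw, hne, by omega, by omega, fun _ => h3⟩
    · push Not at h3
      have hsum := sum_card_Q G t k Q hQ
      have h4 : ∑ s ∈ Q, s.card ≤ ∑ s ∈ Q, (1 + if 2 ≤ s.card then 1 else 0) := by
        refine Finset.sum_le_sum fun s hs => ?_
        have := h3 s hs
        split_ifs <;> omega
      rw [hsum, Finset.sum_add_distrib, ← Finset.card_filter] at h4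
      simp only [Finset.sum_const, smul_eq_mul, mul_one, hQ.1] at h4
      obtain ⟨s, hs, s', hs', hne⟩ := Finset.one_lt_card.1 (by omega : 1 < (Finset.filter (fun s => 2 ≤ s.card) Q).card)
      rw [Finset.mem_filter] at hs hs'
      obtain ⟨v, hv⟩ := (hQ.2.1 s hs.1).1
      obtain ⟨w, hw⟩ := (hQ.2.1 s' hs'.1).1
      refine ⟨s, hs.1, s', hs'.1, v, hv, w, hw, ?_, hs.2, hs'.2, fun h => absurd h hne⟩
      rintro rfl
      exact Finset.disjoint_left.1 (hQ.2.2.2 s hs.1 s' hs'.1 hne) hv hw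
  obtain ⟨s, hs, s', hs', v, hv, w, hw, hvw, c1, c2, c3⟩ := key
  have g1 := splitQ_good G t k ht Q hQ s hs v hv c1
  have g2 := splitQ_good G t k ht Q hQ s' hs' w hw c2
  have hne : splitQ Q s v ≠ splitQ Q s' w := by
    intro h
    have hvm : ({v} : Finset (Fin n)) ∈ splitQ Q s' w := h ▸ (mem_splitQ _ _ _ _).2 (Or.inl rfl)
    rcases (mem_splitQ _ _ _ _).1 hvm with h1 | h1 | h1
    · exact hvw (Finset.singleton_injective h1)
    · have hv' : v ∈ s'.erase w := h1 ▸ Finset.mem_singleton_self v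
      have : s = s' := by
        by_contra hc
        exact Finset.disjoint_left.1 (hQ.2.2.2 s hs s' hs' hc) hv (Finset.mem_of_mem_erase hv')
      have h3 := c3 this
      have := congrArg Finset.card h1
      rw [Finset.card_erase_of_mem hw, Finset.card_singleton] at this
      subst s'
      omega
    · have : s = {v} := by
        by_contra hc
        exact Finset.disjoint_left.1 (hQ.2.2.2 s hs _ h1.2 hc) hv (Finset.mem_singleton_self v)
      rw [this] at c1; simp at c1
  rw [num_eq]
  apply Finset.one_lt_card.2
  exact ⟨_, Finset.mem_filter.2 ⟨Finset.mem_univ _, g1⟩, _, Finset.mem_filter.2 ⟨Finset.mem_univ _, g2⟩, hne⟩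

lemma Q_to_bounded {n : ℕ} (x : Om n) (t k : ℕ) (Q : Finset (Finset (Fin n)))
    (hQ : GoodQ (gr x) t k Q) : HasBoundedColouring (gr x) t k := by
  obtain ⟨C, h1, h2, -⟩ := exists_col x t k Q hQ
  rw [hasBounded_iff]
  exact ⟨C, h1, fun c => (Finset.mem_Icc.1 (h2 c)).2⟩

lemma chi_upd {n : ℕ} (G G' : SimpleGraph (Fin n)) (t : ℕ) (ht : 1 ≤ t) (i : Fin n)
    (h : ∀ v w, v ≠ i → w ≠ i → (G'.Adj v w → G.Adj v w)) : chiBounded G' t ≤ chiBounded G t + 1 := by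
  apply chi_le
  have := chi_spec G t ht
  rw [hasBounded_iff] at this ⊢
  obtain ⟨C, h1, h2⟩ := this
  refine ⟨fun v => if v = i then Fin.last _ else (C v).castSucc, ?_, ?_⟩
  · intro v w hvw
    have hne := G'.ne_of_adj hvw
    by_cases hv : v = i
    · by_cases hw : w = i
      · exact absurd (hv.trans hw.symm) hne
      · simp only [hv, hw, if_true, if_false]
        exact (Fin.castSucc_lt_last _).ne'
    · by_cases hw : w = i
      · simp only [hv, hw, if_true, if_false]
        exact (Fin.castSucc_lt_last _).ne
      · simp only [hv, hw, if_false]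
        intro heq
        exact h1 v w (h v w hv hw hvw) (Fin.castSucc_injective _ heq)
  · intro c
    refine Fin.lastCases ?_ ?_ c
    · refine le_trans ?_ ht
      rw [Finset.card_le_one]
      intro v hv w hw
      rw [mem_fib] at hv hw
      by_cases hvi : v = i
      · by_cases hwi : w = i
        · rw [hvi, hwi]
        · rw [if_neg hwi] at hw; exact absurd hw (Fin.castSucc_lt_last _).ne
      · rw [if_neg hvi] at hv; exact absurd hv (Fin.castSucc_lt_last _).ne
    · intro c
      refine le_trans (Finset.card_le_card ?_) (h2 c)
      intro v hv
      rw [mem_fib] at hv ⊢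
      by_cases hvi : v = i
      · rw [if_pos hvi] at hv; exact absurd hv (Fin.castSucc_lt_last _).ne'
      · rw [if_neg hvi] at hv; exact Fin.castSucc_injective _ hv

lemma chi_lip {n : ℕ} (t : ℕ) (ht : 1 ≤ t) :
    Lip (fun x : Om n => (chiBounded (gr x) t : ℝ)) := by
  intro x i b
  have hagree : ∀ v w, v ≠ i → w ≠ i → ((gr (Function.update x i b)).Adj v w ↔ (gr x).Adj v w) := by
    intro v w hv hw
    simp [gr, Function.update_of_ne hv, Function.update_of_ne hw]
  have h1 := chi_upd (gr x) (gr (Function.update x i b)) t ht i (fun v w hv hw => (hagree v w hv hw).1)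
  have h2 := chi_upd (gr (Function.update x i b)) (gr x) t ht i (fun v w hv hw => (hagree v w hv hw).2)
  rw [abs_le]
  have h1' : (chiBounded (gr (Function.update x i b)) t : ℝ) ≤ chiBounded (gr x) t + 1 := by exact_mod_cast h1
  have h2' : (chiBounded (gr x) t : ℝ) ≤ chiBounded (gr (Function.update x i b)) t + 1 := by exact_mod_cast h2
  constructor <;> linarith

lemma Enkt_nonneg (n k a : ℕ) : 0 ≤ Enkt n k a := by
  unfold Enkt; rw [Ep_eq_avg]
  unfold avg
  exact div_nonneg (Finset.sum_nonneg fun _ _ => by positivity) (by positivity)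

lemma pr_chi_lt {n : ℕ} (a L : ℕ) (ha : 1 ≤ a) :
    pr (fun x : Om n => chiBounded (gr x) a < L) ≤ ∑ j ∈ Finset.range L, Enkt n j a := by
  have e : ∀ j, Enkt n j a = avg (fun x : Om n => (numUnorderedColourings n a j (gr x) : ℝ)) := fun j => Ep_eq_avg _ _
  simp_rw [e]
  rw [← avg_sum]
  apply markov
  · intro x; exact Finset.sum_nonneg fun _ _ => by positivity
  · intro x hx
    obtain ⟨k', hk', Q, hQ⟩ := bounded_to_Q _ _ _ (chi_spec (gr x) a ha)
    have h1 : 1 ≤ numUnorderedColourings n a k' (gr x) := by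
      rw [num_eq]; exact Finset.card_pos.2 ⟨Q, Finset.mem_filter.2 ⟨Finset.mem_univ _, hQ⟩⟩
    calc (1:ℝ) ≤ (numUnorderedColourings n a k' (gr x) : ℝ) := by exact_mod_cast h1
      _ ≤ _ := Finset.single_le_sum (f := fun j => (numUnorderedColourings n a j (gr x) : ℝ))
        (fun _ _ => by positivity) (Finset.mem_range.2 (by omega))

lemma Enkt_ge {n : ℕ} (a K : ℕ) (ha : 1 ≤ a) (hK : K + 2 ≤ n)
    (h : 1/2 ≤ pr (fun x : Om n => chiBounded (gr x) a ≤ K)) : 1 ≤ Enkt n (K+1) a := by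
  have h1 : pr (fun x : Om n => chiBounded (gr x) a ≤ K) ≤
      avg (fun x : Om n => (1/2) * (numUnorderedColourings n a (K+1) (gr x) : ℝ)) := by
    apply markov
    · intro x; positivity
    · intro x hx
      obtain ⟨k', hk', Q, hQ⟩ := bounded_to_Q _ _ _ (chi_spec (gr x) a ha)
      obtain ⟨Q', hQ'⟩ := Q_up _ a k' ha Q hQ K (by omega) (by omega)
      have := Q_two _ a K ha Q' hQ' hK
      have : (2:ℝ) ≤ numUnorderedColourings n a (K+1) (gr x) := by exact_mod_cast this
      linarith
  rw [avg_const_mul, ← Ep_eq_avg n (fun G => (numUnorderedColourings n a (K+1) G : ℝ))] at h1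
  unfold Enkt
  linarith

theorem assemble {n : ℕ} (hn : 0 < n) (a L K : ℕ) (ha : 1 ≤ a) (t ε : ℝ) (ht : 0 ≤ t) (hε : ε < 1)
    (hL : ∀ j < L, Enkt n j a ≤ ε)
    (hK : Real.exp (-t^2/(2*n)) < pr (fun x : Om n => (chiBounded (gr x) a) ≤ K))
    (hexp : Real.exp (-t^2/(2*n)) ≤ 1/2) (hKn : (K:ℝ) + 2*t + 2 ≤ n) :
    1 - L * ε - Real.exp (-t^2/(2*n)) ≤
      pr (fun x : Om n => |(chiBounded (gr x) a : ℝ) - fmThreshold n a| ≤ K + 2*t + 1 - L) := by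
  set K' := ⌊(K:ℝ) + 2*t⌋₊ with hK'
  have hK'1 : (K':ℝ) ≤ K + 2*t := Nat.floor_le (by positivity)
  have hmc := mcd_final n hn (fun x : Om n => (chiBounded (gr x) a : ℝ)) (chi_lip a ha) t K ht (by
    convert hK using 4; exact Nat.cast_le)
  have hup : 1 - Real.exp (-t^2/(2*n)) ≤ pr (fun x : Om n => chiBounded (gr x) a ≤ K') := by
    have h1 : pr (fun x : Om n => ¬ (chiBounded (gr x) a ≤ K')) ≤ Real.exp (-t^2/(2*n)) := by
      refine le_trans (pr_mono ?_) hmc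
      intro x hx
      push Not at hx
      have := Nat.lt_of_floor_lt hx
      exact this.le
    rw [pr_not] at h1
    linarith
  have hE := Enkt_ge a K' ha (by
    have : ((K' + 2 : ℕ):ℝ) ≤ n := by push_cast; linarith
    exact_mod_cast this) (by linarith)
  have hk1 : fmThreshold n a ≤ K' + 1 := Nat.sInf_le hE
  have hk2 : L ≤ fmThreshold n a := by
    have hm : fmThreshold n a ∈ {k | 1 ≤ Enkt n k a} := Nat.sInf_mem ⟨K'+1, hE⟩
    by_contra hc
    push Not at hc
    have h1 := hL _ hc
    have h2 : 1 ≤ Enkt n (fmThreshold n a) a := hm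
    linarith
  have hlow : pr (fun x : Om n => chiBounded (gr x) a < L) ≤ L * ε := by
    refine (pr_chi_lt a L ha).trans ?_
    refine (Finset.sum_le_card_nsmul _ _ ε fun j hj => hL j (Finset.mem_range.1 hj)).trans ?_
    simp
  have hbad : pr (fun x : Om n => ¬ (|(chiBounded (gr x) a : ℝ) - fmThreshold n a| ≤ K + 2*t + 1 - L)) ≤
      L * ε + Real.exp (-t^2/(2*n)) := by
    refine (pr_mono (F := fun x : Om n => chiBounded (gr x) a < L ∨ ¬ (chiBounded (gr x) a ≤ K')) ?_).trans
      ((pr_or_le _ _).trans ?_)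
    · intro x hx
      by_contra hc
      push Not at hc
      apply hx
      have a1 : (L:ℝ) ≤ chiBounded (gr x) a := by exact_mod_cast hc.1
      have a2 : (chiBounded (gr x) a : ℝ) ≤ K' := by exact_mod_cast hc.2
      have a3 : (L:ℝ) ≤ fmThreshold n a := by exact_mod_cast hk2
      have a4 : (fmThreshold n a : ℝ) ≤ K' + 1 := by exact_mod_cast hk1
      rw [abs_le]; constructor <;> linarith
    · rw [pr_not]; linarith
  rw [pr_not] at hbad
  linarith

end TM

namespace TM

def Clq {n : ℕ} (G : SimpleGraph (Fin n)) (S : Finset (Fin n)) : Prop := ∀ v ∈ S, ∀ w ∈ S, v ≠ w → G.Adj v w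

lemma pr_clq {n : ℕ} (S : Finset (Fin n)) :
    pr (fun x : Om n => Clq (gr x) S) ≤ (1/2:ℝ)^(S.card.choose 2) := by
  rw [← card_dec n S, ← pr_prescribed ((S ×ˢ S).filter fun p => p.2 < p.1) (fun _ _ => true)]
  apply pr_mono
  rintro x hx ⟨v, w⟩ hp
  rw [Finset.mem_filter, Finset.mem_product] at hp
  have := hx v hp.1.1 w hp.1.2 hp.2.ne'
  simp only [gr] at this
  rcases this with h | h
  · exact h.2
  · exact absurd h.1 (not_lt.2 hp.2.le)

lemma chi2_le {n : ℕ} (x : Om n) (s : ℕ) (h : ∀ S : Finset (Fin n), S.card = s → ¬ Clq (gr x) S) :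
    chiBounded (gr x) 2 ≤ n/2 + s := by
  obtain ⟨k, hk, Q, hQ⟩ := bounded_to_Q _ _ _ (chi_spec (gr x) 2 (by norm_num))
  have hk' : chiBounded (gr x) 2 = k := le_antisymm (chi_le _ _ _ (Q_to_bounded x 2 k Q hQ)) hk
  set T : Finset (Fin n) := Finset.univ.filter fun v => {v} ∈ Q with hT
  have hTc : Clq (gr x) T := by
    intro v hv w hw hne
    by_contra hadj
    have hv' : {v} ∈ Q := (Finset.mem_filter.1 hv).2
    have hw' : {w} ∈ Q := (Finset.mem_filter.1 hw).2
    obtain ⟨q1, q2, q3, q4⟩ := hQ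
    have hvw : ({v} : Finset (Fin n)) ≠ {w} := fun h => hne (Finset.singleton_injective h)
    have hin : ∀ A ∈ (Q.erase {v}).erase {w}, v ∉ A ∧ w ∉ A := by
      intro A hA
      simp only [Finset.mem_erase] at hA
      constructor
      · intro hvA
        exact Finset.disjoint_left.1 (q4 A hA.2.2 {v} hv' hA.2.1) hvA (by simp)
      · intro hvA
        exact Finset.disjoint_left.1 (q4 A hA.2.2 {w} hw' hA.1) hvA (by simp)
    have hnot : ({v, w} : Finset (Fin n)) ∉ (Q.erase {v}).erase {w} := fun h => (hin _ h).1 (by simp)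
    have hgood : GoodQ (gr x) 2 (k-1) (insert {v,w} ((Q.erase {v}).erase {w})) := by
      refine ⟨?_, ?_, ?_, ?_⟩
      · rw [Finset.card_insert_of_notMem hnot, Finset.card_erase_of_mem, Finset.card_erase_of_mem hv', q1]
        · have : 1 < Q.card := Finset.one_lt_card.2 ⟨_, hv', _, hw', hvw⟩
          omega
        · exact Finset.mem_erase.2 ⟨hvw.symm, hw'⟩
      · intro A hA
        rcases Finset.mem_insert.1 hA with rfl | hA
        · refine ⟨⟨v, by simp⟩, Finset.card_le_two, ?_⟩
          intro y hy z hz hyz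
          simp only [Finset.mem_insert, Finset.mem_singleton] at hy hz
          rcases hy with rfl | rfl <;> rcases hz with rfl | rfl
          · exact (gr x).ne_of_adj hyz rfl
          · exact hadj hyz
          · exact hadj hyz.symm
          · exact (gr x).ne_of_adj hyz rfl
        · simp only [Finset.mem_erase] at hA
          exact q2 A hA.2.2
      · intro y
        obtain ⟨A, hA, hy⟩ := q3 y
        by_cases h1 : A = {v}
        · subst h1
          exact ⟨_, Finset.mem_insert_self _ _, by simp at hy; simp [hy]⟩
        · by_cases h2 : A = {w}
          · subst h2
            exact ⟨_, Finset.mem_insert_self _ _, by simp at hy; simp [hy]⟩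
          · exact ⟨A, Finset.mem_insert_of_mem (by simp [h1, h2, hA]), hy⟩
      · intro A hA B hB hAB
        rcases Finset.mem_insert.1 hA with rfl | hA' <;> rcases Finset.mem_insert.1 hB with rfl | hB'
        · exact absurd rfl hAB
        · have := hin B hB'
          simp [this.1, this.2]
        · have := hin A hA'
          simp [this.1, this.2]
        · simp only [Finset.mem_erase] at hA' hB'
          exact q4 A hA'.2.2 B hB'.2.2 hAB
    have h1 := chi_le _ _ _ (Q_to_bounded x 2 (k-1) _ hgood)
    have : 0 < k := q1 ▸ Finset.card_pos.2 ⟨_, hv'⟩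
    omega
  have hTs : T.card < s := by
    by_contra hc
    push Not at hc
    obtain ⟨S, hS, hSc⟩ := Finset.exists_subset_card_eq hc
    exact h S hSc (fun v hv w hw => hTc v (hS hv) w (hS hw))
  have hsum := sum_card_Q _ _ _ _ hQ
  have h1 : ∑ A ∈ Q, 2 ≤ ∑ A ∈ Q, (A.card + if A.card = 1 then 1 else 0) := by
    refine Finset.sum_le_sum fun A hA => ?_
    have := Finset.card_pos.2 (hQ.2.1 A hA).1
    split_ifs <;> omega
  rw [Finset.sum_add_distrib, hsum, ← Finset.card_filter] at h1
  have h2 : (Q.filter fun A => A.card = 1).card ≤ T.card := by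
    apply Finset.card_le_card_of_surjOn (fun v => ({v} : Finset (Fin n)))
    intro A hA
    have hA := Finset.mem_filter.1 (Finset.mem_coe.1 hA)
    obtain ⟨v, rfl⟩ := Finset.card_eq_one.1 hA.2
    exact ⟨v, Finset.mem_coe.2 (Finset.mem_filter.2 ⟨Finset.mem_univ _, hA.1⟩), rfl⟩
  simp only [Finset.sum_const, smul_eq_mul, hQ.1] at h1
  omega

lemma two_bound (n : ℕ) (hn : 1 ≤ n) :
    1/2 ≤ pr (fun x : Om n => chiBounded (gr x) 2 ≤ n/2 + (2 * Nat.log 2 n + 6)) := by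
  set s := 2 * Nat.log 2 n + 6 with hs
  have h1 : pr (fun x : Om n => ¬ (chiBounded (gr x) 2 ≤ n/2 + s)) ≤ 1/2 := by
    have h2 : pr (fun x : Om n => ¬ (chiBounded (gr x) 2 ≤ n/2 + s)) ≤
        avg (fun x : Om n => ∑ S ∈ (Finset.univ : Finset (Fin n)).powersetCard s, if Clq (gr x) S then (1:ℝ) else 0) := by
      apply markov
      · intro x; exact Finset.sum_nonneg fun _ _ => by split_ifs <;> norm_num
      · intro x hx
        by_contra hc
        apply hx
        apply chi2_le
        intro S hS hcl
        apply hc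
        have : (if Clq (gr x) S then (1:ℝ) else 0) = 1 := if_pos hcl
        refine this.symm.le.trans ?_
        exact Finset.single_le_sum (f := fun S => if Clq (gr x) S then (1:ℝ) else 0)
          (fun _ _ => by split_ifs <;> norm_num) (Finset.mem_powersetCard.2 ⟨Finset.subset_univ _, hS⟩)
    rw [avg_sum] at h2
    refine h2.trans ?_
    have h3 : ∀ S ∈ (Finset.univ : Finset (Fin n)).powersetCard s, avg (fun x : Om n => if Clq (gr x) S then (1:ℝ) else 0) ≤ (1/2:ℝ)^(s.choose 2) := by
      intro S hS
      have := pr_clq S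
      rw [(Finset.mem_powersetCard.1 hS).2] at this
      exact this
    refine (Finset.sum_le_card_nsmul _ _ _ h3).trans ?_
    rw [Finset.card_powersetCard, Finset.card_univ, Fintype.card_fin, nsmul_eq_mul]
    have h4 : n.choose s ≤ n^s := Nat.choose_le_pow _ _
    have h5 : n ≤ 2^(Nat.log 2 n + 1) := (Nat.lt_pow_succ_log_self (by norm_num) n).le
    have h6 : n^s * 2 ≤ 2^(s.choose 2) := by
      set l := Nat.log 2 n
      calc n^s * 2 ≤ (2^(l+1))^s * 2 := by gcongr
        _ = 2^((l+1)*s+1) := by rw [← pow_mul, pow_succ]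
        _ ≤ 2^(s.choose 2) := by
          apply Nat.pow_le_pow_right (by norm_num)
          rw [Nat.choose_two_right, Nat.le_div_iff_mul_le (by norm_num)]
          have : s - 1 = 2*l+5 := by omega
          rw [this, hs]
          nlinarith
    have h7 : (n.choose s : ℝ) * 2 ≤ 2^(s.choose 2) := by
      have := (Nat.mul_le_mul_right 2 h4).trans h6
      exact_mod_cast this
    rw [one_div, inv_pow, ← div_eq_mul_inv, div_le_iff₀ (by positivity)]
    linarith
  rw [pr_not] at h1
  linarith

theorem case_two (n : ℕ) (hn : 1 ≤ n) (t : ℝ) (ht : 0 ≤ t)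
    (hexp : Real.exp (-t^2/(2*n)) < 1/2) (hKn : (n/2 : ℝ) + (2 * Nat.log 2 n + 6) + 2*t + 2 ≤ n) :
    1 - Real.exp (-t^2/(2*n)) ≤
      pr (fun x : Om n => |(chiBounded (gr x) 2 : ℝ) - fmThreshold n 2| ≤ (2 * Nat.log 2 n + 6) + 2*t + 1) := by
  have hc : (((n/2 : ℕ) : ℝ)) ≤ n/2 := Nat.cast_div_le
  have := assemble (n := n) (by omega) 2 ((n+1)/2) (n/2 + (2 * Nat.log 2 n + 6)) (by norm_num) t 0 ht (by norm_num)
    (by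
      intro j hj
      unfold Enkt
      rw [Ep_eq_avg]
      have : ∀ x : Om n, (numUnorderedColourings n 2 j (gr x) : ℝ) = 0 := by
        intro x
        rw [num_eq, Nat.cast_eq_zero, Finset.card_eq_zero, Finset.filter_eq_empty_iff]
        intro Q _ hQ
        have := Q_le _ _ _ _ hQ
        omega
      simp_rw [this]
      unfold avg; simp)
    (lt_of_lt_of_le hexp (two_bound n hn)) hexp.le
    (by push_cast; linarith)
  refine le_trans (by simp) (this.trans (pr_mono ?_))
  intro x hx
  refine hx.trans ?_
  have : ((n/2 : ℕ) : ℝ) ≤ (((n+1)/2 : ℕ) : ℝ) := by exact_mod_cast (by omega)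
  push_cast at this ⊢
  linarith

end TM

namespace TM

/-- profile weights -/
def gg (a : ℕ) (r : ℝ) (i : ℕ) : ℝ := r^i * (a.descFactorial i : ℝ) / (2^(i.choose 2) * (a:ℝ)^i)

lemma gg_zero (a : ℕ) (r : ℝ) : gg a r 0 = 1 := by simp [gg]

lemma gg_succ (a : ℕ) (r : ℝ) (i : ℕ) (hi : i ≤ a) (ha : 0 < a) :
    gg a r (i+1) = gg a r i * (r * ((a:ℝ) - i) / (2^i * a)) := by
  unfold gg
  have h1 : (i+1).choose 2 = i.choose 2 + i := by
    rw [Nat.choose_succ_succ' i 1]; simp; ring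
  have ha' : (a:ℝ) ≠ 0 := by positivity
  rw [h1, Nat.descFactorial_succ, Nat.cast_mul, Nat.cast_sub hi, pow_add, pow_succ, pow_succ]
  field_simp
  try ring

lemma gg_nonneg (a : ℕ) {r : ℝ} (hr : 0 ≤ r) (i : ℕ) : 0 ≤ gg a r i := by
  unfold gg; positivity

lemma gg_pos (a : ℕ) {r : ℝ} (hr : 0 < r) (i : ℕ) (hi : i ≤ a) (ha : 0 < a) : 0 < gg a r i := by
  unfold gg
  have : 0 < a.descFactorial i := Nat.pos_of_ne_zero (by
    intro h; rw [Nat.descFactorial_eq_zero_iff_lt] at h; omega)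
  positivity

lemma gg_dcoef (a : ℕ) (r : ℝ) (i : ℕ) (hi : i ≤ a) (ha : 0 < a) :
    gg a r i * dcoef (a - i) = dcoef a * (r / (a * 2^(a-1)))^i := by
  induction i with
  | zero => simp [gg_zero]
  | succ i ih =>
    have ih := ih (by omega)
    rw [gg_succ a r i (by omega) ha, pow_succ, ← mul_assoc, ← ih]
    have h1 : a - i = (a - (i+1)) + 1 := by omega
    have h2 : (dcoef (a-i) : ℝ) = dcoef (a-(i+1)) * (2^(a-(i+1)) * ((a:ℝ) - i)) := by
      unfold dcoef
      rw [h1]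
      generalize hb : a - (i+1) = b
      have hb' : (a:ℝ) - i = b + 1 := by
        have : a = b + 1 + i := by omega
        rw [this]; push_cast; ring
      have h3 : (b+1).choose 2 = b.choose 2 + b := by
        rw [Nat.choose_succ_succ' b 1]; simp; ring
      rw [h3, Nat.factorial_succ, hb']; push_cast; ring
    rw [h2]
    have h4 : (2:ℝ)^(a-1) = 2^(a-(i+1)) * 2^i := by
      rw [← pow_add]; congr 1; omega
    have ha' : (a:ℝ) ≠ 0 := by positivity
    rw [h4]
    field_simp

lemma gg_up (a : ℕ) {r : ℝ} (hr : 0 ≤ r) (i : ℕ) (hi : i ≤ a) (ha : 0 < a) :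
    2^(i+1) * gg a r (i+1) ≤ 2 * r * gg a r i := by
  rw [gg_succ a r i hi ha]
  have hg := gg_nonneg a hr i
  have ha' : (0:ℝ) < a := by positivity
  have : 2^(i+1) * (gg a r i * (r * ((a:ℝ) - i) / (2^i * a))) = 2 * r * gg a r i * (1 - i/a) := by
    field_simp; ring
  rw [this]
  have h2 : 1 - (i:ℝ)/a ≤ 1 := by have : 0 ≤ (i:ℝ)/a := by positivity
                                  linarith
  have := mul_le_mul_of_nonneg_left h2 (by positivity : 0 ≤ 2 * r * gg a r i)
  linarith

lemma gg_down (a : ℕ) {r : ℝ} (hr : 0 ≤ r) (i : ℕ) (hi : i ≤ a) (ha : 0 < a) :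
    r * (1/2)^i * gg a r i ≤ gg a r (i+1) + r/a * gg a r i := by
  rw [gg_succ a r i hi ha]
  have hg := gg_nonneg a hr i
  have ha' : (0:ℝ) < a := by positivity
  have : gg a r i * (r * ((a:ℝ) - i) / (2^i * a)) = r * (1/2)^i * gg a r i - r/a * gg a r i * (i/2^i) := by
    field_simp
    have : (2:ℝ)^i * (1/2)^i = 1 := by rw [← mul_pow]; norm_num
    linear_combination (-(a:ℝ)* r * gg a r i) * this
  rw [this]
  have h3 : (i:ℝ)/2^i ≤ 1 := by
    rw [div_le_one (by positivity)]; exact_mod_cast (Nat.lt_two_pow_self (n := i)).le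
  have := mul_le_mul_of_nonneg_left h3 (by positivity : 0 ≤ r/a * gg a r i)
  linarith

/-- total weight -/
def gf (a : ℕ) (r : ℝ) : ℝ := ∑ i ∈ Finset.range a, gg a r i

lemma sum_two_pow (a : ℕ) {r : ℝ} (hr : 0 ≤ r) (ha : 0 < a) :
    ∑ i ∈ Finset.range a, 2^i * gg a r i ≤ 2 * r * gf a r + 1 := by
  obtain ⟨b, rfl⟩ : ∃ b, a = b + 1 := ⟨a - 1, by omega⟩
  rw [Finset.sum_range_succ', gf, Finset.sum_range_succ, gg_zero]
  have h1 : ∑ i ∈ Finset.range b, (2:ℝ)^(i+1) * gg (b+1) r (i+1) ≤ ∑ i ∈ Finset.range b, 2 * r * gg (b+1) r i :=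
    Finset.sum_le_sum fun i hi => gg_up _ hr i (by have := Finset.mem_range.1 hi; omega) ha
  rw [← Finset.mul_sum] at h1
  have := gg_nonneg (b+1) hr b
  have : 0 ≤ r * gg (b+1) r b := by positivity
  norm_num
  linarith

lemma sum_half_pow (a : ℕ) {r : ℝ} (hr : 0 ≤ r) (ha : 0 < a) :
    r * ∑ i ∈ Finset.range a, (1/2)^i * gg a r i ≤ gf a r - 1 + r/a * gf a r := by
  obtain ⟨b, rfl⟩ : ∃ b, a = b + 1 := ⟨a - 1, by omega⟩
  have e : gf (b+1) r = ∑ i ∈ Finset.range b, gg (b+1) r i + gg (b+1) r b := by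
    rw [gf, Finset.sum_range_succ]
  have e2 : gf (b+1) r = ∑ i ∈ Finset.range b, gg (b+1) r (i+1) + 1 := by
    rw [gf, Finset.sum_range_succ', gg_zero]
  have h1 : ∑ i ∈ Finset.range b, r * (1/2)^i * gg (b+1) r i ≤
      ∑ i ∈ Finset.range b, (gg (b+1) r (i+1) + r/((b+1:ℕ):ℝ) * gg (b+1) r i) :=
    Finset.sum_le_sum fun i hi => gg_down _ hr i (by have := Finset.mem_range.1 hi; omega) ha
  rw [Finset.sum_add_distrib, ← Finset.mul_sum] at h1
  have h2 : r * (1/2)^b * gg (b+1) r b ≤ r/((b+1:ℕ):ℝ) * gg (b+1) r b := by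
    apply mul_le_mul_of_nonneg_right _ (gg_nonneg _ hr _)
    rw [div_eq_mul_inv]
    apply mul_le_mul_of_nonneg_left _ hr
    rw [one_mul, inv_pow]
    apply inv_anti₀ (by positivity)
    exact_mod_cast (Nat.lt_two_pow_self (n := b))
  have h3 : r/((b+1:ℕ):ℝ) * gf (b+1) r = r/((b+1:ℕ):ℝ) * ∑ i ∈ Finset.range b, gg (b+1) r i + r/((b+1:ℕ):ℝ) * gg (b+1) r b := by
    rw [e]; ring
  rw [h3, Finset.sum_range_succ, mul_add, Finset.mul_sum]
  have h4 : ∀ i, r * ((1/2)^i * gg (b+1) r i) = r * (1/2)^i * gg (b+1) r i := fun i => by ring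
  simp_rw [h4]
  linarith

lemma gf_ge (a : ℕ) {r : ℝ} (hr : 0 ≤ r) (ha : 4 ≤ a) :
    1 + r + r^2/2 * (1 - 1/a) + r^3/8*((1-1/a)*(1-2/a)) ≤ gf a r := by
  have ha' : (0:ℝ) < a := by positivity
  have g1 : gg a r 1 = r := by
    have := gg_succ a r 0 (by omega) (by omega)
    rw [gg_zero] at this; simp only [zero_add] at this
    rw [this]; field_simp; simp
  have g2 : gg a r 2 = r^2/2 * (1-1/a) := by
    have := gg_succ a r 1 (by omega) (by omega)
    simp only [Nat.reduceAdd] at this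
    rw [this, g1]; field_simp; push_cast; ring
  have g3 : gg a r 3 = r^3/8*((1-1/a)*(1-2/a)) := by
    have := gg_succ a r 2 (by omega) (by omega)
    simp only [Nat.reduceAdd] at this
    rw [this, g2]; field_simp; push_cast; ring
  have : ∑ i ∈ Finset.range 4, gg a r i ≤ gf a r :=
    Finset.sum_le_sum_of_subset_of_nonneg (Finset.range_subset_range.2 ha) fun i _ _ => gg_nonneg a hr i
  rw [Finset.sum_range_succ, Finset.sum_range_succ, Finset.sum_range_succ, Finset.sum_range_one, gg_zero, g1, g2, g3] at this
  exact this

lemma gg_one (a : ℕ) (r : ℝ) (ha : 0 < a) : gg a r 1 = r := by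
  have ha' : (0:ℝ) < a := by positivity
  have := gg_succ a r 0 (by omega) (by omega)
  rw [gg_zero] at this; simp only [zero_add] at this
  rw [this]; field_simp; simp

lemma gg_two (a : ℕ) (r : ℝ) (ha : 1 < a) : gg a r 2 = r^2/2 * (1-1/a) := by
  have ha' : (0:ℝ) < a := by positivity
  have := gg_succ a r 1 (by omega) (by omega)
  simp only [Nat.reduceAdd] at this
  rw [this, gg_one a r (by omega)]; field_simp; push_cast; ring

lemma gg_le64 (a : ℕ) {r : ℝ} (hr : 0 ≤ r) (hr8 : r ≤ 8) (i : ℕ) (ha : 0 < a) : gg a r i ≤ 64 := by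
  have ha' : (0:ℝ) < a := by positivity
  have h1 : (a.descFactorial i : ℝ) ≤ (a:ℝ)^i := by exact_mod_cast Nat.descFactorial_le_pow a i
  have h2 : r^i ≤ 8^i := by gcongr
  have h3 : (8:ℝ)^i ≤ 64 * 2^(i.choose 2) := by
    have : 3 * i ≤ 6 + i.choose 2 := by
      rw [Nat.choose_two_right]
      rcases Nat.lt_or_ge i 7 with h | h
      · interval_cases i <;> norm_num
      · have : i * 6 ≤ i * (i-1) := Nat.mul_le_mul_left _ (by omega)
        omega
    calc (8:ℝ)^i = 2^(3*i) := by rw [pow_mul]; norm_num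
      _ ≤ 2^(6 + i.choose 2) := pow_le_pow_right₀ (by norm_num) this
      _ = _ := by rw [pow_add]; norm_num
  unfold gg
  rw [div_le_iff₀ (by positivity)]
  calc r^i * (a.descFactorial i : ℝ) ≤ (64 * 2^(i.choose 2)) * (a:ℝ)^i := by
        apply mul_le_mul (h2.trans h3) h1 (by positivity) (by positivity)
    _ = _ := by ring

/-- tail telescoping for r ≤ 4 -/
lemma gg_tail (a : ℕ) {r : ℝ} (hr : 0 ≤ r) (hr4 : r ≤ 4) (ha : 0 < a) (N : ℕ) (hN : 3 + N ≤ a) :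
    ∑ i ∈ Finset.range N, (((3 + i : ℕ):ℝ) - 2.88) * gg a r (3+i) + (((3+N:ℕ):ℝ) - 1.7) * gg a r (3+N) ≤ 1.3 * gg a r 3 := by
  induction N with
  | zero => norm_num
  | succ N ih =>
    have ih := ih (by omega)
    rw [Finset.sum_range_succ]
    have h1 := gg_up a hr (3+N) (by omega) ha
    have hg := gg_nonneg a hr (3+N)
    have hg' := gg_nonneg a hr (3+(N+1))
    rw [show 3 + N + 1 = 3 + (N+1) by ring] at h1
    have h2 : 2 * (2:ℝ)^N * gg a r (3+(N+1)) ≤ gg a r (3+N) := by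
      have : (2:ℝ)^(3+(N+1)) = 16 * 2^N := by rw [pow_add, pow_succ]; ring
      rw [this] at h1
      have := mul_le_mul_of_nonneg_right hr4 hg
      linarith
    have h3 : (1:ℝ) + N ≤ 2^N := by exact_mod_cast (by have := Nat.lt_two_pow_self (n := N); omega : 1 + N ≤ 2^N)
    have h4 : (1 + (N:ℝ)) * gg a r (3+(N+1)) ≤ 2^N * gg a r (3+(N+1)) := mul_le_mul_of_nonneg_right h3 hg'
    have hNN : 0 ≤ (N:ℝ) * gg a r (3+(N+1)) := by positivity
    push_cast at ih ⊢
    nlinarith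
end TM

namespace TM

structure Asy (η : ℝ) (n a : ℕ) (δ : ℝ) : Prop where
  hδ1 : 0.1 ≤ δ
  hδ2 : δ ≤ 1.9
  ha : |(a:ℝ) - 2 / Real.log 2 * Real.log n| ≤ η * Real.log n
  hd : |Real.log (dcoef a) - (a * Real.log n - (1+δ) * Real.log n)| ≤ η * Real.log n
  hloga : Real.log a ≤ η * Real.log n
  hbig : 2000 ≤ η * Real.log n

lemma asy_ev (η : ℝ) (hη : 0 < η) : ∀ᶠ n : ℕ in atTop, 1 ≤ n ∧ 2000 ≤ η * Real.log n ∧ 2000 ≤ Real.log n ∧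
    Real.log (4 * Real.log n) ≤ η/10 * Real.log n ∧ 32 * (Real.log n)^2 ≤ n := by
  have h0 : Tendsto (fun n : ℕ => Real.log (n:ℝ)) atTop atTop :=
    Real.tendsto_log_atTop.comp tendsto_natCast_atTop_atTop
  have h1 := h0.eventually_ge_atTop (2000/η)
  have h2 := h0.eventually_ge_atTop 2000
  have h3 : ∀ᶠ x : ℝ in atTop, ‖Real.log x‖ ≤ η/40 * ‖x‖ :=
    (Real.isLittleO_log_id_atTop).def (by positivity)
  have h4 := (h0.const_mul_atTop (by norm_num : (0:ℝ) < 4)).eventually h3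
  have h5 : ∀ᶠ x : ℝ in atTop, ‖Real.log x ^ 2‖ ≤ (1/32) * ‖x‖ :=
    (Real.isLittleO_pow_log_id_atTop (n := 2)).def (by norm_num)
  have h6 := tendsto_natCast_atTop_atTop (R := ℝ).eventually h5
  filter_upwards [h1, h2, h4, h6, eventually_ge_atTop 1] with n h1 h2 h4 h6 h7
  refine ⟨h7, ?_, h2, ?_, ?_⟩
  · rw [div_le_iff₀ hη] at h1; linarith
  · have := (le_abs_self _).trans h4
    rw [Real.norm_of_nonneg (by linarith)] at this
    linarith
  · rw [Real.norm_of_nonneg (by positivity), Real.norm_of_nonneg (by positivity)] at h6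
    linarith

set_option maxHeartbeats 1000000 in
lemma exists_asy (η : ℝ) (hη : 0 < η) : ∀ᶠ n : ℕ in atTop, ∀ a : ℕ, 3 ≤ a →
    (n:ℝ)^(1.1:ℝ) < muExp (1/2) n a → muExp (1/2) n a < (n:ℝ)^(2.9:ℝ) → ∃ δ, Asy η n a δ := by
  filter_upwards [asy_ev η hη] with n ⟨hn1, hb, hb2, hll, hsq⟩ a ha3 hlo hhi
  set l := Real.log n with hl
  have hnpos : (0:ℝ) < n := by positivity
  have hlpos : 0 < l := by linarith
  have hmupos : 0 < muExp (1/2) n a := lt_trans (Real.rpow_pos_of_pos hnpos _) hlo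
  have hlog1 : 1.1 * l < Real.log (muExp (1/2) n a) := by
    rw [← Real.log_rpow hnpos]; exact Real.log_lt_log (Real.rpow_pos_of_pos hnpos _) hlo
  have hlog2 : Real.log (muExp (1/2) n a) < 2.9 * l := by
    rw [← Real.log_rpow hnpos]; exact Real.log_lt_log hmupos hhi
  have hdpos : (0:ℝ) < dcoef a := dcoef_pos a
  have hmd : muExp (1/2) n a * dcoef a = (n.descFactorial a : ℝ) := by
    rw [Nat.descFactorial_eq_factorial_mul_choose]
    unfold muExp dcoef
    push_cast
    have : (1/2:ℝ)^(a.choose 2) * 2^(a.choose 2) = 1 := by rw [← mul_pow]; norm_num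
    linear_combination ((n.choose a : ℝ) * a.factorial) * this
  have hsum : Real.log (muExp (1/2) n a) + Real.log (dcoef a) = Real.log (n.descFactorial a : ℝ) := by
    rw [← hmd, Real.log_mul hmupos.ne' hdpos.ne']
  have hdfpos : (0:ℝ) < (n.descFactorial a : ℝ) := by rw [← hmd]; positivity
  have hup : Real.log (n.descFactorial a : ℝ) ≤ a * l := by
    rw [hl, ← Real.log_pow]
    exact Real.log_le_log hdfpos (by exact_mod_cast Nat.descFactorial_le_pow n a)
  have han : a ≤ n := by
    by_contra h
    have : n.descFactorial a = 0 := Nat.descFactorial_eq_zero_iff_lt.2 (by omega)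
    rw [this] at hdfpos; simp at hdfpos
  have hapos : (0:ℝ) < a := by positivity
  have ha3' : (3:ℝ) ≤ a := by exact_mod_cast ha3
  have hl2 : 0.69 < Real.log 2 := by have := Real.log_two_gt_d9; linarith
  have hl2' : Real.log 2 < 0.7 := by have := Real.log_two_lt_d9; linarith
  have hch : ((a.choose 2 : ℕ):ℝ) = a * (a-1)/2 := by
    rw [Nat.cast_choose_two]
  have hdlog : Real.log (dcoef a) = a * (a-1)/2 * Real.log 2 + Real.log (a.factorial : ℝ) := by
    unfold dcoef
    have : (0:ℝ) < (a.factorial : ℝ) := by positivity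
    rw [Real.log_mul (by positivity) this.ne', Real.log_pow, hch]
  have hfac0 : 0 ≤ Real.log (a.factorial : ℝ) := Real.log_nonneg (by exact_mod_cast Nat.one_le_iff_ne_zero.2 (Nat.factorial_ne_zero a))
  have hfac1 : Real.log (a.factorial : ℝ) ≤ a * Real.log a := by
    rw [← Real.log_pow]
    exact Real.log_le_log (by positivity) (by exact_mod_cast Nat.factorial_le_pow a)
  -- upper bound
  have hA1 : ((a:ℝ)-1)/2 * Real.log 2 ≤ l := by
    have : a * (((a:ℝ)-1)/2 * Real.log 2) ≤ a * l := by
      have e1 : a * (((a:ℝ)-1)/2 * Real.log 2) = a * (a-1)/2 * Real.log 2 := by ring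
      rw [e1]; linarith
    exact le_of_mul_le_mul_left this hapos
  have hA2 : (a:ℝ) ≤ 4 * l := by nlinarith
  have hla : Real.log a ≤ η/10 * l := (Real.log_le_log hapos hA2).trans hll
  -- lower on descFactorial
  have hdn : (a:ℝ) * l - 1 ≤ Real.log (n.descFactorial a : ℝ) := by
    have h1 : ((n + 1 - a : ℕ):ℝ)^a ≤ (n.descFactorial a : ℝ) := by exact_mod_cast Nat.pow_sub_le_descFactorial n a
    have h2 : ((n + 1 - a : ℕ):ℝ) ≥ n * (1 - a/n) := by
      rw [Nat.cast_sub (by omega)]; push_cast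
      have : (n:ℝ) * (1 - a/n) = n - a := by field_simp
      linarith
    have han2 : (a:ℝ)/n * a ≤ 1/2 := by
      rw [div_mul_eq_mul_div, div_le_iff₀ hnpos]
      nlinarith
    have han3 : (a:ℝ)/n ≤ 1/2 := by
      have h0 : 0 ≤ (a:ℝ)/n := by positivity
      nlinarith
    have h3 : 1 + (a:ℝ) * (-(a/n)) ≤ (1 + (-(a/n:ℝ)))^a := one_add_mul_le_pow (by linarith) a
    have h4 : (n:ℝ)^a * (1/2) ≤ (n.descFactorial a : ℝ) := by
      refine le_trans ?_ h1
      calc (n:ℝ)^a * (1/2) ≤ (n:ℝ)^a * (1 + (-(a/n:ℝ)))^a := by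
            apply mul_le_mul_of_nonneg_left _ (by positivity)
            linarith
        _ = (n * (1 - a/n:ℝ))^a := by rw [mul_pow]; ring
        _ ≤ _ := by
            apply pow_le_pow_left₀ _ h2
            apply mul_nonneg hnpos.le; linarith
    have h5 := Real.log_le_log (by positivity) h4
    rw [Real.log_mul (by positivity) (by norm_num), Real.log_pow, one_div, Real.log_inv] at h5
    linarith
  -- lower bound on a
  have hB1 : (a:ℝ) * l - 2.9 * l - 1 ≤ a * (a-1)/2 * Real.log 2 + a * Real.log a := by linarith
  have hlaa : Real.log a ≤ a := (Real.log_le_sub_one_of_pos hapos).trans (by linarith)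
  have hB2 : l/120 ≤ a := by
    have : (a:ℝ) * (l * (1/30) - 1) ≤ a * (((a:ℝ)-1)/2 * Real.log 2 + Real.log a) := by
      have e1 : (a:ℝ) * (((a:ℝ)-1)/2 * Real.log 2 + Real.log a) = a * (a-1)/2 * Real.log 2 + a * Real.log a := by ring
      have e2 : (0:ℝ) ≤ (a-3) * l := mul_nonneg (by linarith) hlpos.le
      rw [e1]; linarith
    have h1 := le_of_mul_le_mul_left this hapos
    have h2 : ((a:ℝ)-1)/2 * Real.log 2 ≤ ((a:ℝ)-1)/2 * 1 := mul_le_mul_of_nonneg_left (by linarith) (by linarith)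
    linarith
  have hB3 : l - 360 ≤ ((a:ℝ)-1)/2 * Real.log 2 + Real.log a := by
    have : (a:ℝ) * (l - 360) ≤ a * (((a:ℝ)-1)/2 * Real.log 2 + Real.log a) := by
      have e1 : (a:ℝ) * (((a:ℝ)-1)/2 * Real.log 2 + Real.log a) = a * (a-1)/2 * Real.log 2 + a * Real.log a := by ring
      rw [e1]; linarith
    exact le_of_mul_le_mul_left this hapos
  refine ⟨Real.log (muExp (1/2) n a) / l - 1, ?_, ?_, ?_, ?_, ?_, hb⟩
  · rw [le_sub_iff_add_le, le_div_iff₀ hlpos]; linarith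
  · rw [sub_le_iff_le_add, div_le_iff₀ hlpos]; linarith
  · have e : 2 / Real.log 2 * l = 2 * l / Real.log 2 := by ring
    rw [abs_le]
    constructor
    · have : 2 / Real.log 2 * l ≤ a + η * l := by
        rw [e, div_le_iff₀ (by linarith)]
        nlinarith
      linarith
    · have : (a:ℝ) - 1 ≤ 2 / Real.log 2 * l := by
        rw [e, le_div_iff₀ (by linarith)]
        linarith
      linarith
  · have e : (1 + (Real.log (muExp (1/2) n a) / l - 1)) * l = Real.log (muExp (1/2) n a) := by field_simp; ring
    rw [e, abs_le]
    constructor <;> linarith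
  · have : η/10 * l ≤ η * l := by nlinarith
    linarith
end TM

namespace TM

lemma fact_lower (n : ℕ) (hn : 0 < n) : n * Real.log n - n ≤ Real.log (n.factorial : ℝ) := by
  have h := Real.pow_div_factorial_le_exp (n:ℝ) (by positivity) n
  have h1 : (0:ℝ) < n.factorial := by positivity
  rw [div_le_iff₀ h1] at h
  have hn' : (0:ℝ) < n := by positivity
  have := Real.log_le_log (by positivity) h
  rw [Real.log_mul (Real.exp_pos _).ne' h1.ne', Real.log_exp, Real.log_pow] at this
  linarith

lemma l2bd : 0.6931 < Real.log 2 ∧ Real.log 2 < 0.6932 := by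
  have := Real.log_two_gt_d9; have := Real.log_two_lt_d9
  constructor <;> linarith

lemma two_div_l2 : 2.885 < 2 / Real.log 2 ∧ 2/Real.log 2 < 2.8855 := by
  have h1 := Real.log_two_gt_d9; have h2 := Real.log_two_lt_d9
  constructor
  · rw [lt_div_iff₀ (by linarith)]; linarith
  · rw [div_lt_iff₀ (by linarith)]; linarith

lemma Asy.basic {η : ℝ} {n a : ℕ} {δ : ℝ} (h : Asy η n a δ) (hη : 0 < η) (hη1 : η ≤ 0.00000001) :
    100000000000 ≤ Real.log n ∧ 2.88 * Real.log n ≤ a ∧ a ≤ 2.89 * Real.log n ∧ 100000000000 ≤ (a:ℝ) ∧ 0 < n ∧ 0 < a ∧ (a:ℝ)^2 ≤ n := by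
  have hb := h.hbig
  have hl : 100000000000 ≤ Real.log n := by
    by_contra hc
    push Not at hc
    rcases le_or_gt (Real.log n) 0 with h0 | h0
    · nlinarith
    · nlinarith
  have hl0 : 0 < Real.log n := by linarith
  have ha := abs_le.1 h.ha
  obtain ⟨t1, t2⟩ := two_div_l2
  have hηl : η * Real.log n ≤ 0.00000001 * Real.log n := by nlinarith
  have a1 : 2.88 * Real.log n ≤ a := by nlinarith
  have a2 : (a:ℝ) ≤ 2.89 * Real.log n := by nlinarith
  have a3 : 100000000000 ≤ (a:ℝ) := by linarith
  have hn : 0 < n := by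
    rcases Nat.eq_zero_or_pos n with h0 | h0
    · rw [h0] at hl0; simp at hl0
    · exact h0
  have hapos : (0:ℝ) < a := by linarith
  refine ⟨hl, a1, a2, a3, hn, by exact_mod_cast hapos, ?_⟩
  have hn' : (0:ℝ) < n := by positivity
  rw [← Real.log_le_log_iff (by positivity) hn', Real.log_pow]
  have := h.hloga
  push_cast
  linarith

def gm (a : ℕ) (r : ℝ) : ℝ := ∑ i ∈ Finset.range a, (i:ℝ) * gg a r i

lemma gf_ge_one (a : ℕ) {r : ℝ} (hr : 0 ≤ r) (ha : 4 ≤ a) : 1 + r ≤ gf a r := by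
  have := gf_ge a hr ha
  have ha' : (4:ℝ) ≤ a := by exact_mod_cast ha
  have h1 : (1:ℝ)/a ≤ 1/2 := by rw [div_le_div_iff₀ (by linarith) (by norm_num)]; linarith
  have h2 : (2:ℝ)/a ≤ 1/2 := by rw [div_le_div_iff₀ (by linarith) (by norm_num)]; linarith
  have : 0 ≤ r^2/2 * (1 - 1/(a:ℝ)) := mul_nonneg (by positivity) (by linarith)
  have : 0 ≤ r^3/8*((1-1/(a:ℝ))*(1-2/a)) := mul_nonneg (by positivity) (mul_nonneg (by linarith) (by linarith))
  linarith

lemma gm_le (a : ℕ) {r : ℝ} (hr : 0 ≤ r) (ha : 4 ≤ a) : gm a r + gf a r ≤ 2 * r * gf a r + 1 := by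
  refine le_trans ?_ (sum_two_pow a hr (by omega))
  rw [gm, gf, ← Finset.sum_add_distrib]
  apply Finset.sum_le_sum
  intro i _
  have h1 : (i:ℝ) + 1 ≤ 2^i := by exact_mod_cast (Nat.lt_two_pow_self (n := i))
  have := mul_le_mul_of_nonneg_right h1 (gg_nonneg a hr i)
  linarith

lemma gm_nonneg (a : ℕ) {r : ℝ} (hr : 0 ≤ r) : 0 ≤ gm a r :=
  Finset.sum_nonneg fun i _ => mul_nonneg (by positivity) (gg_nonneg a hr i)

lemma gD_eq (a : ℕ) (r : ℝ) : (a:ℝ) * gf a r - gm a r = ∑ i ∈ Finset.range a, ((a:ℝ) - i) * gg a r i := by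
  rw [gf, gm, Finset.mul_sum, ← Finset.sum_sub_distrib]
  exact Finset.sum_congr rfl fun i _ => by ring

lemma gD_ge (a : ℕ) {r : ℝ} (hr : 0 ≤ r) (ha : 4 ≤ a) : (a:ℝ) ≤ (a:ℝ) * gf a r - gm a r := by
  rw [gD_eq]
  have := Finset.single_le_sum (f := fun i : ℕ => ((a:ℝ) - i) * gg a r i) (s := Finset.range a) (a := 0)
    (fun i hi => mul_nonneg (by
      have : (i:ℝ) ≤ a := by exact_mod_cast (Finset.mem_range.1 hi).le
      linarith) (gg_nonneg a hr i)) (Finset.mem_range.2 (by omega))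
  simpa [gg_zero] using this

lemma gD_le (a : ℕ) {r : ℝ} (hr : 0 ≤ r) (hr8 : r ≤ 8) (ha : 4 ≤ a) : (a:ℝ) * gf a r - gm a r ≤ 64 * (a:ℝ)^2 := by
  have h1 : gf a r ≤ a * 64 := by
    have := Finset.sum_le_card_nsmul (Finset.range a) (fun i => gg a r i) 64 fun i _ => gg_le64 a hr hr8 i (by omega)
    rw [Finset.card_range, nsmul_eq_mul] at this
    exact this
  have := gm_nonneg a hr
  have := mul_le_mul_of_nonneg_left h1 (by positivity : (0:ℝ) ≤ a)
  nlinarith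

lemma jensen_half (a : ℕ) {r : ℝ} (hr : 0 ≤ r) (M : ℝ) (hM : gm a r = M * gf a r) :
    Real.exp (-M * Real.log 2) * gf a r ≤ ∑ i ∈ Finset.range a, (1/2)^i * gg a r i := by
  have : ∑ i ∈ Finset.range a, Real.exp (-M * Real.log 2) * ((1 + (M - i) * Real.log 2) * gg a r i) ≤ ∑ i ∈ Finset.range a, (1/2)^i * gg a r i := by
    apply Finset.sum_le_sum
    intro i _
    rw [← mul_assoc]
    apply mul_le_mul_of_nonneg_right _ (gg_nonneg a hr i)
    have e : (1/2:ℝ)^i = Real.exp (-M * Real.log 2) * Real.exp ((M - i) * Real.log 2) := by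
      rw [← Real.exp_add, show -M * Real.log 2 + (M - i) * Real.log 2 = -(i * Real.log 2) by ring, Real.exp_neg, ← Real.log_pow,
        Real.exp_log (by positivity), one_div, inv_pow]
    rw [e]
    apply mul_le_mul_of_nonneg_left _ (Real.exp_pos _).le
    linarith [Real.add_one_le_exp ((M - i) * Real.log 2)]
  refine le_trans (le_of_eq ?_) this
  rw [← Finset.mul_sum]
  congr 1
  have : ∑ i ∈ Finset.range a, (1 + (M - i) * Real.log 2) * gg a r i = (1 + M * Real.log 2) * gf a r - Real.log 2 * gm a r := by
    rw [gf, gm, Finset.mul_sum, Finset.mul_sum, ← Finset.sum_sub_distrib]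
    exact Finset.sum_congr rfl fun i _ => by ring
  rw [this, hM]; ring

lemma sq_le_cosh (x : ℝ) : x^2 ≤ Real.exp x + Real.exp (-x) - 2 := by
  have h0 : ∀ y : ℝ, 0 ≤ y → y^2 ≤ Real.exp y + Real.exp (-y) - 2 := by
    intro y hy
    have h1 : y/2 ≤ Real.sinh (y/2) := Real.self_le_sinh_iff.2 (by linarith)
    rw [Real.sinh_eq] at h1
    have h2 : Real.exp y = Real.exp (y/2) * Real.exp (y/2) := by rw [← Real.exp_add]; congr 1; ring
    have h3 : Real.exp (-y) = Real.exp (-(y/2)) * Real.exp (-(y/2)) := by rw [← Real.exp_add]; congr 1; ring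
    have h4 : Real.exp (y/2) * Real.exp (-(y/2)) = 1 := by rw [← Real.exp_add]; simp
    rw [h2, h3]
    nlinarith
  rcases le_total 0 x with h | h
  · exact h0 x h
  · have := h0 (-x) (by linarith)
    rw [neg_neg] at this; nlinarith

lemma var_bound (a : ℕ) {r : ℝ} (hr : 1/2 ≤ r) (hr8 : r ≤ 8) (ha : 4 ≤ a) (ha' : 1000000 ≤ (a:ℝ)) (M : ℝ) (hM : gm a r = M * gf a r) :
    ∑ i ∈ Finset.range a, ((i:ℝ) - M)^2 * gg a r i ≤ 1.75 * gf a r := by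
  have hr0 : 0 ≤ r := by linarith
  have hf1 : 1 ≤ gf a r := by linarith [gf_ge_one a hr0 ha]
  set L := Real.log 2 with hL
  obtain ⟨hL1, hL2⟩ := l2bd
  set c := Real.sqrt 2 * r with hc
  have hs2 : Real.sqrt 2 * Real.sqrt 2 = 2 := Real.mul_self_sqrt (by norm_num)
  have hs1 : 1.4142 < Real.sqrt 2 := Real.lt_sqrt_of_sq_lt (by norm_num)
  have hs3 : Real.sqrt 2 < 1.41422 := by rw [Real.sqrt_lt' (by norm_num)]; norm_num
  have hcpos : 0 < c := by positivity
  set m := Real.log c / L with hm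
  have hmL : m * L = Real.log c := div_mul_cancel₀ _ (by linarith)
  -- shift to m
  have h1 : ∑ i ∈ Finset.range a, ((i:ℝ) - M)^2 * gg a r i ≤ ∑ i ∈ Finset.range a, ((i:ℝ) - m)^2 * gg a r i := by
    have e : ∑ i ∈ Finset.range a, ((i:ℝ) - m)^2 * gg a r i = ∑ i ∈ Finset.range a, ((i:ℝ) - M)^2 * gg a r i + (M-m)^2 * gf a r := by
      have e1 : ∑ i ∈ Finset.range a, ((i:ℝ) - m)^2 * gg a r i = ∑ i ∈ Finset.range a, (((i:ℝ) - M)^2 * gg a r i) + (2*(M-m)) * ∑ i ∈ Finset.range a, ((i:ℝ) * gg a r i) + (m^2 - M^2) * ∑ i ∈ Finset.range a, gg a r i := by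
        rw [Finset.mul_sum, Finset.mul_sum, ← Finset.sum_add_distrib, ← Finset.sum_add_distrib]
        exact Finset.sum_congr rfl fun i _ => by ring
      rw [e1, ← gm, ← gf, hM]; ring
    rw [e]
    have : 0 ≤ (M-m)^2 * gf a r := by positivity
    linarith
  have h2 : L^2 * ∑ i ∈ Finset.range a, ((i:ℝ) - m)^2 * gg a r i ≤
      c⁻¹ * ∑ i ∈ Finset.range a, 2^i * gg a r i + c * ∑ i ∈ Finset.range a, (1/2)^i * gg a r i - 2 * gf a r := by
    rw [gf, Finset.mul_sum, Finset.mul_sum, Finset.mul_sum, Finset.mul_sum, ← Finset.sum_add_distrib, ← Finset.sum_sub_distrib]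
    apply Finset.sum_le_sum
    intro i _
    have h := sq_le_cosh (((i:ℝ) - m) * L)
    have e1 : Real.exp (((i:ℝ) - m) * L) = c⁻¹ * 2^i := by
      rw [sub_mul, hmL, Real.exp_sub, Real.exp_log hcpos, hL, ← Real.log_pow, Real.exp_log (by positivity)]; field_simp
    have e2 : Real.exp (-(((i:ℝ) - m) * L)) = c * (1/2)^i := by
      rw [Real.exp_neg, e1, mul_inv, inv_inv, one_div, inv_pow]
    rw [e1, e2] at h
    have := mul_le_mul_of_nonneg_right h (gg_nonneg a hr0 i)
    linarith
  have h3 := sum_two_pow a hr0 (by omega)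
  have h4 := sum_half_pow a hr0 (by omega)
  have hra : r / a ≤ 0.00001 := by rw [div_le_iff₀ (by linarith)]; linarith
  have h5 : c * ∑ i ∈ Finset.range a, (1/2)^i * gg a r i ≤ Real.sqrt 2 * (gf a r - 1 + 0.00001 * gf a r) := by
    rw [hc, mul_assoc]
    apply mul_le_mul_of_nonneg_left _ (by positivity)
    have := mul_le_mul_of_nonneg_right hra (by linarith : 0 ≤ gf a r)
    linarith
  have h6 : c⁻¹ * ∑ i ∈ Finset.range a, 2^i * gg a r i ≤ Real.sqrt 2 * gf a r + Real.sqrt 2 := by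
    rw [inv_mul_le_iff₀ hcpos]
    refine h3.trans ?_
    have : c * (Real.sqrt 2 * gf a r + Real.sqrt 2) = 2 * r * gf a r + 2 * r := by
      rw [hc]; linear_combination (r * gf a r + r) * hs2
    rw [this]; linarith
  have h7 : 0 ≤ ∑ i ∈ Finset.range a, ((i:ℝ) - m)^2 * gg a r i := Finset.sum_nonneg fun i _ => mul_nonneg (sq_nonneg _) (gg_nonneg a hr0 i)
  have h8 : 0.4803 * ∑ i ∈ Finset.range a, ((i:ℝ) - m)^2 * gg a r i ≤ L^2 * ∑ i ∈ Finset.range a, ((i:ℝ) - m)^2 * gg a r i :=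
    mul_le_mul_of_nonneg_right (by nlinarith) h7
  have h9 : Real.sqrt 2 * gf a r ≤ 1.41422 * gf a r := mul_le_mul_of_nonneg_right hs3.le (by linarith)
  nlinarith
end TM

namespace TM

def gM (a : ℕ) (r : ℝ) : ℝ := gm a r / gf a r

def Fk (n a : ℕ) (r : ℝ) : ℝ :=
  ((a:ℝ) - gM a r) * (Real.log (n.factorial:ℝ) / n) - Real.log n + Real.log (a * gf a r - gm a r) - Real.log (dcoef a)
    + (Real.log a + ((a:ℝ)-1) * Real.log 2 - Real.log r) * gM a r + 1

lemma Fk_cont (n a : ℕ) (ha : 4 ≤ a) : ContinuousOn (Fk n a) (Set.Icc (1/2) 8) := by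
  have h1 : Continuous (gf a) := by unfold gf gg; fun_prop
  have h2 : Continuous (gm a) := by unfold gm gg; fun_prop
  have hpos : ∀ r ∈ Set.Icc (1/2:ℝ) 8, gf a r ≠ 0 := fun r hr => by
    have := gf_ge_one a (by linarith [hr.1] : 0 ≤ r) ha
    have := hr.1
    linarith
  have hM : ContinuousOn (gM a) (Set.Icc (1/2) 8) := h2.continuousOn.div h1.continuousOn hpos
  have hD : ContinuousOn (fun r => Real.log (a * gf a r - gm a r)) (Set.Icc (1/2) 8) := by
    apply ContinuousOn.log (by fun_prop)
    intro r hr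
    have := gD_ge a (by linarith [hr.1] : 0 ≤ r) ha
    have : (4:ℝ) ≤ a := by exact_mod_cast ha
    linarith
  have hlog : ContinuousOn (fun r : ℝ => Real.log r) (Set.Icc (1/2) 8) := by
    apply ContinuousOn.log continuousOn_id
    intro r hr; have := hr.1; simp; linarith
  unfold Fk
  fun_prop

lemma gM_bd (a : ℕ) {r : ℝ} (hr : 1/2 ≤ r) (hr8 : r ≤ 8) (ha : 4 ≤ a) : 0 ≤ gM a r ∧ gM a r ≤ 17 := by
  have hr0 : 0 ≤ r := by linarith
  have hf := gf_ge_one a hr0 ha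
  have hm := gm_le a hr0 ha
  constructor
  · exact div_nonneg (gm_nonneg a hr0) (by linarith)
  · rw [gM, div_le_iff₀ (by linarith)]; nlinarith

lemma log8 : Real.log 8 < 2.08 := by
  have : (8:ℝ) = 2^3 := by norm_num
  rw [this, Real.log_pow]; have := l2bd.2; push_cast; linarith

lemma logr_bd {r : ℝ} (hr : 1/2 ≤ r) (hr8 : r ≤ 8) : |Real.log r| ≤ 3 := by
  rw [abs_le]
  constructor
  · have := Real.log_le_log (by norm_num) hr
    rw [one_div, Real.log_inv] at this
    have := l2bd.2; linarith
  · have := Real.log_le_log (by linarith) hr8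
    linarith [log8]

lemma B_bd {η : ℝ} {n a : ℕ} {δ : ℝ} (h : Asy η n a δ) (hη : 0 < η) (hη1 : η ≤ 0.00000001) {r : ℝ} (hr : 1/2 ≤ r) (hr8 : r ≤ 8) :
    |Real.log a + ((a:ℝ)-1) * Real.log 2 - Real.log r - 2 * Real.log n| ≤ 2 * (η * Real.log n) := by
  obtain ⟨hl, a1, a2, a3, hn, ha0, hsq⟩ := h.basic hη hη1
  have hla := h.hloga
  have hb := h.hbig
  have hr' := abs_le.1 (logr_bd hr hr8)
  have ha := abs_le.1 h.ha
  obtain ⟨L1, L2⟩ := l2bd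
  set L := Real.log 2
  have e : 2 / L * Real.log n * L = 2 * Real.log n := by field_simp
  have h1 : (a:ℝ) * L - 2 * Real.log n ≤ (η * Real.log n) * L := by
    rw [← e, ← sub_mul]; exact mul_le_mul_of_nonneg_right ha.2 (by linarith)
  have h2 : -(η * Real.log n) * L ≤ (a:ℝ) * L - 2 * Real.log n := by
    rw [← e, ← sub_mul]; exact mul_le_mul_of_nonneg_right ha.1 (by linarith)
  have h3 : 0 ≤ Real.log a := Real.log_nonneg (by linarith)
  have h4 : (η * Real.log n) * L ≤ (η * Real.log n) * 0.6932 := mul_le_mul_of_nonneg_left L2.le (by linarith)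
  rw [abs_le]
  constructor <;> linarith

lemma w_bd {η : ℝ} {n a : ℕ} {δ : ℝ} (h : Asy η n a δ) (hη : 0 < η) (hη1 : η ≤ 0.00000001) :
    Real.log n - 1 ≤ Real.log (n.factorial:ℝ) / n ∧ (a:ℝ) * (Real.log (n.factorial:ℝ) / n) ≤ a * (Real.log n - 1) + 1 := by
  obtain ⟨hl, a1, a2, a3, hn, ha0, hsq⟩ := h.basic hη hη1
  have hn' : (0:ℝ) < n := by positivity
  have f1 := fact_lower n hn
  have f2 := log_fact_le n hn
  constructor
  · rw [le_div_iff₀ hn']; linarith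
  · rw [← mul_div_assoc, div_le_iff₀ hn']
    have h0 : (a:ℝ) * (1 + Real.log n) ≤ n := by nlinarith
    have : (a:ℝ) * Real.log (n.factorial:ℝ) ≤ a * (n * Real.log n - n + 1 + Real.log n) := mul_le_mul_of_nonneg_left f2 (by positivity)
    linarith

lemma Fk_bd {η : ℝ} {n a : ℕ} {δ : ℝ} (h : Asy η n a δ) (hη : 0 < η) (hη1 : η ≤ 0.00000001) {r : ℝ} (hr : 1/2 ≤ r) (hr8 : r ≤ 8) :
    |Fk n a r - Real.log n * (gM a r + δ - 2 / Real.log 2)| ≤ 60 * (η * Real.log n) := by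
  obtain ⟨hl, a1, a2, a3, hn, ha0, hsq⟩ := h.basic hη hη1
  have ha4 : 4 ≤ a := by
    have : (4:ℝ) ≤ a := by linarith
    exact_mod_cast this
  have hr0 : 0 ≤ r := by linarith
  obtain ⟨M0, M1⟩ := gM_bd a hr hr8 ha4
  have hB := abs_le.1 (B_bd h hη hη1 hr hr8)
  obtain ⟨w1, w2⟩ := w_bd h hη hη1
  have hla := h.hloga
  have hb := h.hbig
  have ha := abs_le.1 h.ha
  have hd := abs_le.1 h.hd
  have hD1 := gD_ge a hr0 ha4
  have hD2 := gD_le a hr0 hr8 ha4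
  have hDl : 0 ≤ Real.log (a * gf a r - gm a r) := Real.log_nonneg (by linarith)
  have hDu : Real.log (a * gf a r - gm a r) ≤ 3 * (η * Real.log n) := by
    have := Real.log_le_log (by linarith) hD2
    rw [Real.log_mul (by norm_num) (by positivity), Real.log_pow] at this
    have l64 : Real.log 64 ≤ 63 := by
      have := Real.log_le_sub_one_of_pos (by norm_num : (0:ℝ) < 64); linarith
    push_cast at this
    linarith
  unfold Fk
  set M := gM a r
  set l := Real.log n
  set w := Real.log (n.factorial:ℝ) / n
  set B := Real.log a + ((a:ℝ)-1) * Real.log 2 - Real.log r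
  have b1 : (B - 2 * l) * M ≤ 2 * (η * l) * 17 := by
    have x1 : (B - 2*l) * M ≤ 2 * (η*l) * M := mul_le_mul_of_nonneg_right hB.2 M0
    have x2 : 2 * (η*l) * M ≤ 2 * (η * l) * 17 := mul_le_mul_of_nonneg_left M1 (by linarith)
    linarith
  have b2 : -(2 * (η * l) * 17) ≤ (B - 2 * l) * M := by
    have x1 : -(2 * (η*l)) * M ≤ (B - 2*l) * M := mul_le_mul_of_nonneg_right hB.1 M0
    have x2 : 2 * (η*l) * M ≤ 2 * (η * l) * 17 := mul_le_mul_of_nonneg_left M1 (by linarith)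
    linarith
  have c1 : (a - M) * (l - 1) ≤ (a - M) * w := mul_le_mul_of_nonneg_left w1 (by linarith)
  have c2 : (a - M) * w ≤ (a - M) * (l - 1) + 1 := by
    have := mul_le_mul_of_nonneg_left w1 M0
    linarith
  rw [abs_le]
  constructor <;> linarith

lemma exists_root {η : ℝ} {n a : ℕ} {δ : ℝ} (h : Asy η n a δ) (hη : 0 < η) (hη1 : η ≤ 0.00000001) :
    ∃ r : ℝ, 1/2 ≤ r ∧ r ≤ 8 ∧ Fk n a r = 0 := by
  obtain ⟨hl, a1, a2, a3, hn, ha0, hsq⟩ := h.basic hη hη1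
  have ha4 : 4 ≤ a := by
    have : (4:ℝ) ≤ a := by linarith
    exact_mod_cast this
  obtain ⟨t1, t2⟩ := two_div_l2
  have hl0 : 0 < Real.log n := by linarith
  have hηl : η * Real.log n ≤ 0.00000001 * Real.log n := mul_le_mul_of_nonneg_right hη1 hl0.le
  have hlo : Fk n a (1/2) ≤ 0 := by
    have h1 := (abs_le.1 (Fk_bd h hη hη1 (le_refl (1/2:ℝ)) (by norm_num))).2
    have hM : gM a (1/2) ≤ 2/3 := by
      have hf := gf_ge_one a (by norm_num : (0:ℝ) ≤ 1/2) ha4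
      have hm := gm_le a (by norm_num : (0:ℝ) ≤ 1/2) ha4
      rw [gM, div_le_iff₀ (by linarith)]; linarith
    have := h.hδ2
    have : Real.log n * (gM a (1/2) + δ - 2 / Real.log 2) ≤ Real.log n * (-0.3) := mul_le_mul_of_nonneg_left (by linarith) hl0.le
    linarith
  have hhi : 0 ≤ Fk n a 8 := by
    have h1 := (abs_le.1 (Fk_bd h hη hη1 (by norm_num : (1/2:ℝ) ≤ 8) (le_refl _))).1
    have hM : 2.99 ≤ gM a 8 := by
      have hf := gf_ge_one a (by norm_num : (0:ℝ) ≤ 8) ha4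
      have hMf : gm a 8 = gM a 8 * gf a 8 := by rw [gM, div_mul_cancel₀ _ (by linarith)]
      have hj := jensen_half a (by norm_num : (0:ℝ) ≤ 8) _ hMf
      have hs := sum_half_pow a (by norm_num : (0:ℝ) ≤ 8) ha0
      have h8a : (8:ℝ)/a ≤ 0.00001 := by rw [div_le_iff₀ (by linarith)]; linarith
      have h2 : 8 * Real.exp (-gM a 8 * Real.log 2) * gf a 8 ≤ (1 + 0.00001) * gf a 8 := by
        have := mul_le_mul_of_nonneg_right h8a (by linarith : 0 ≤ gf a 8)
        linarith
      have h3 := le_of_mul_le_mul_right h2 (by linarith)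
      have h4 : 8 * Real.exp (-gM a 8 * Real.log 2) = Real.exp ((3 - gM a 8) * Real.log 2) := by
        rw [show (3 - gM a 8) * Real.log 2 = Real.log 2 * 3 + -gM a 8 * Real.log 2 by ring, Real.exp_add]
        congr 1
        rw [mul_comm, show (3:ℝ) = ((3:ℕ):ℝ) by norm_num, ← Real.log_pow, Real.exp_log (by norm_num)]; norm_num
      rw [h4] at h3
      have h5 := Real.add_one_le_exp ((3 - gM a 8) * Real.log 2)
      have := l2bd.1
      by_contra hc
      push Not at hc
      nlinarith
    have := h.hδ1
    have : Real.log n * 0.1 ≤ Real.log n * (gM a 8 + δ - 2 / Real.log 2) := mul_le_mul_of_nonneg_left (by linarith) hl0.le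
    linarith
  obtain ⟨r, hr, hr'⟩ := intermediate_value_Icc (by norm_num : (1/2:ℝ) ≤ 8) (Fk_cont n a ha4) ⟨hlo, hhi⟩
  exact ⟨r, hr.1, hr.2, hr'⟩
end TM

namespace TM

structure Prof (n a : ℕ) (η δ : ℝ) (K : ℕ → ℝ) (k A B M : ℝ) : Prop where
  hK : ∀ i, i < a → 0 < K i
  hk : ∑ i ∈ Finset.range a, K i = k
  hkpos : 0 < k
  hM : ∑ i ∈ Finset.range a, (i:ℝ) * K i = M * k
  hn : ((a:ℝ) - M) * k = n
  hlog : ∀ i, i < a → Real.log (K i) + Real.log (dcoef (a - i)) = A + B * ((a:ℝ) - i)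
  hroot : A * k + B * n - k = Real.log (n.factorial : ℝ)
  hMδ : |M + δ - 2 / Real.log 2| ≤ 60 * η
  h0 : K 0 ≤ (δ/2 + 60 * η) * k
  h1 : K 1 ≤ 0.42 * k
  hvar : ∑ i ∈ Finset.range a, ((i:ℝ) - M)^2 * K i ≤ 1.75 * k
  hexp : Real.exp (δ * Real.log 2) * ∑ i ∈ Finset.range a, 2^i * K i ≤ 14.8 * k
  hB : |B - 2 * Real.log n| ≤ 2 * (η * Real.log n)

lemma p0_bd (a : ℕ) {r : ℝ} (hr : 1/2 ≤ r) (hr8 : r ≤ 8) (ha : 4 ≤ a) (ha' : 1000000 ≤ (a:ℝ)) (δ e : ℝ)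
    (he : 0 ≤ e) (hδ : 0.1 ≤ δ) (h : 2.88 - e ≤ gM a r + δ) : 1 ≤ (δ/2 + e) * gf a r := by
  have hr0 : 0 ≤ r := by linarith
  have hf1 := gf_ge_one a hr0 ha
  have hia : (1:ℝ)/a ≤ 0.001 := by rw [div_le_iff₀ (by linarith)]; linarith
  have hia2 : (2:ℝ)/a ≤ 0.001 := by rw [div_le_iff₀ (by linarith)]; linarith
  rcases le_or_gt r 4 with h4 | h4
  · have hMf : gm a r = gM a r * gf a r := by rw [gM, div_mul_cancel₀ _ (by linarith)]
    have h1 : 2 ≤ 2.88 * gf a r - gm a r := by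
      have e : 2.88 * gf a r - gm a r = ∑ i ∈ Finset.range a, (2.88 - (i:ℝ)) * gg a r i := by
        rw [gf, gm, Finset.mul_sum, ← Finset.sum_sub_distrib]
        exact Finset.sum_congr rfl fun i _ => by ring
      rw [e]
      obtain ⟨N, rfl⟩ : ∃ N, a = 3 + N := ⟨a - 3, by omega⟩
      rw [Finset.sum_range_add, Finset.sum_range_succ, Finset.sum_range_succ, Finset.sum_range_one, gg_zero, gg_one _ _ (by omega), gg_two _ _ (by omega)]
      have ht := gg_tail (3+N) hr0 h4 (by omega) N le_rfl
      have hg : 0 ≤ (((3+N:ℕ):ℝ) - 1.7) * gg (3+N) r (3+N) := mul_nonneg (by linarith) (gg_nonneg _ hr0 _)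
      have hg3 : gg (3+N) r 3 ≤ r^3/8 := by
        have := gg_up (3+N) hr0 2 (by omega) (by omega)
        rw [gg_two _ _ (by omega)] at this
        have h5 : (0:ℝ) ≤ 1/((3+N:ℕ):ℝ) := by positivity
        have h6 : 0 ≤ 2 * r * (r^2/2 * (1/((3+N:ℕ):ℝ))) := by positivity
        norm_num at this h6 ⊢
        nlinarith
      have hneg : ∑ i ∈ Finset.range N, (2.88 - ((3+i:ℕ):ℝ)) * gg (3+N) r (3+i) = - ∑ i ∈ Finset.range N, (((3+i:ℕ):ℝ) - 2.88) * gg (3+N) r (3+i) := by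
        rw [← Finset.sum_neg_distrib]
        exact Finset.sum_congr rfl fun i _ => by ring
      rw [hneg]
      have h2 : 0.999 * (r^2/2) ≤ r^2/2 * (1 - 1/((3+N:ℕ):ℝ)) := by
        have : 0 ≤ r^2/2 := by positivity
        nlinarith
      push_cast at h2 ht hg ⊢
      have h3 : r^3 ≤ 4 * r^2 := by nlinarith [sq_nonneg r]
      have h4' : r^2 ≤ 4 * r := by nlinarith
      nlinarith
    nlinarith
  · have h5 := gf_ge a hr0 ha
    have h20 : 20 ≤ gf a r := by
      have x1 : 16 ≤ r^2 := by nlinarith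
      have x2 : 64 ≤ r^3 := by nlinarith
      have y1 : 0.999 ≤ 1 - 1/(a:ℝ) := by linarith
      have y2 : 0.998 ≤ (1 - 1/(a:ℝ)) * (1 - 2/a) := by nlinarith
      have z1 : 8 * 0.999 ≤ r^2/2 * (1 - 1/(a:ℝ)) := by nlinarith
      have z2 : 8 * 0.998 ≤ r^3/8*((1-1/(a:ℝ))*(1-2/a)) := by nlinarith
      linarith
    nlinarith

lemma p1_bd (a : ℕ) {r : ℝ} (hr : 1/2 ≤ r) (ha : 4 ≤ a) (ha' : 1000000 ≤ (a:ℝ)) : gg a r 1 ≤ 0.42 * gf a r := by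
  have hr0 : 0 ≤ r := by linarith
  have hia : (1:ℝ)/a ≤ 0.001 := by rw [div_le_iff₀ (by linarith)]; linarith
  have hia2 : (2:ℝ)/a ≤ 0.001 := by rw [div_le_iff₀ (by linarith)]; linarith
  rw [gg_one a r (by omega)]
  have h5 := gf_ge a hr0 ha
  have z2 : 0 ≤ r^3/8*((1-1/(a:ℝ))*(1-2/a)) := mul_nonneg (by positivity) (mul_nonneg (by linarith) (by linarith))
  have z1 : r^2/2 * 0.999 ≤ r^2/2 * (1 - 1/(a:ℝ)) := mul_le_mul_of_nonneg_left (by linarith) (by positivity)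
  nlinarith [sq_nonneg (r - 1.4)]

lemma exp_bd (a : ℕ) {r : ℝ} (hr : 1/2 ≤ r) (hr8 : r ≤ 8) (ha : 4 ≤ a) (ha' : 1000000 ≤ (a:ℝ)) (δ e : ℝ)
    (he : 0 ≤ e) (he1 : e ≤ 0.000001) (hδ : δ ≤ 1.9) (h : gM a r + δ ≤ 2/Real.log 2 + e) :
    Real.exp (δ * Real.log 2) * ∑ i ∈ Finset.range a, 2^i * gg a r i ≤ 14.8 * gf a r := by
  have hr0 : 0 ≤ r := by linarith
  have hf1 := gf_ge_one a hr0 ha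
  have hMf : gm a r = gM a r * gf a r := by rw [gM, div_mul_cancel₀ _ (by linarith)]
  have hj := jensen_half a hr0 _ hMf
  have hs := sum_half_pow a hr0 (by omega)
  have h2 := sum_two_pow a hr0 (by omega)
  obtain ⟨L1, L2⟩ := l2bd
  set L := Real.log 2
  set f := gf a r
  set E := Real.exp (δ * L) with hE
  have hEpos : 0 < E := Real.exp_pos _
  have hE4 : E ≤ 4 := by
    have : E ≤ Real.exp (L * 2) := Real.exp_le_exp.2 (by nlinarith)
    rw [Real.exp_mul, Real.exp_log (by norm_num)] at this
    norm_num at this; exact this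
  have hra : r / a ≤ 0.00001 := by rw [div_le_iff₀ (by linarith)]; linarith
  -- E * exp(-2-eL) ≤ exp(-M L)
  have h3 : E * (1/7.3895) ≤ Real.exp (-gM a r * L) := by
    have h4 : Real.exp (δ * L + (-2 - e * L)) ≤ Real.exp (-gM a r * L) := by
      apply Real.exp_le_exp.2
      have : (gM a r + δ) * L ≤ (2/L + e) * L := mul_le_mul_of_nonneg_right h (by linarith)
      have e2 : 2 / L * L = 2 := by field_simp
      rw [add_mul, add_mul, e2] at this
      linarith
    rw [Real.exp_add] at h4
    refine le_trans (mul_le_mul_of_nonneg_left ?_ hEpos.le) h4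
    have h5 : Real.exp (-2 - e*L) = (Real.exp (2 + e * L))⁻¹ := by rw [← Real.exp_neg]; congr 1; ring
    rw [h5, one_div]
    apply inv_anti₀ (Real.exp_pos _)
    have h6 : Real.exp (2 + e*L) = Real.exp 1 * Real.exp 1 * Real.exp (e*L) := by rw [← Real.exp_add, ← Real.exp_add]; congr 1; ring
    have h7 := Real.exp_one_lt_d9
    have h8 : Real.exp (e*L) ≤ 1 + 0.00001 := by
      have heL : e * L ≤ 0.000001 := by nlinarith
      have heL0 : 0 ≤ e * L := by positivity
      have h9 : Real.exp (e*L) ≤ Real.exp (0.000001) := Real.exp_le_exp.2 heL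
      have h10 := Real.exp_bound' (x := 0.000001) (by norm_num) (by norm_num) (n := 2) (by norm_num)
      norm_num [Finset.sum_range_succ, Nat.factorial] at h10
      refine h9.trans ?_
      norm_num; linarith
    rw [h6]
    have h11 : Real.exp 1 * Real.exp 1 ≤ 7.38906 := by nlinarith [Real.exp_pos 1]
    have h12 : Real.exp 1 * Real.exp 1 * Real.exp (e*L) ≤ 7.38906 * (1 + 0.00001) :=
      mul_le_mul h11 h8 (Real.exp_pos _).le (by norm_num)
    linarith
  have h6 : r * (E * (1/7.3895) * f) ≤ f - 1 + 0.00001 * f := by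
    have x1 : E * (1/7.3895) * f ≤ Real.exp (-gM a r * L) * f := mul_le_mul_of_nonneg_right h3 (by linarith)
    have x2 := mul_le_mul_of_nonneg_left (x1.trans hj) hr0
    have x3 : r / a * f ≤ 0.00001 * f := mul_le_mul_of_nonneg_right hra (by linarith)
    linarith
  have h7 : E * (r * f) ≤ 7.3895 * (f - 1 + 0.00001 * f) := by
    have : r * (E * (1/7.3895) * f) = E * (r * f) / 7.3895 := by ring
    rw [this, div_le_iff₀ (by norm_num)] at h6
    linarith
  have h8 := mul_le_mul_of_nonneg_left h2 hEpos.le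
  have h9 : E * (2 * r * f + 1) = 2 * (E * (r*f)) + E := by ring
  rw [h9] at h8
  linarith

lemma exists_prof {η : ℝ} {n a : ℕ} {δ : ℝ} (h : Asy η n a δ) (hη : 0 < η) (hη1 : η ≤ 0.00000001) :
    ∃ (K : ℕ → ℝ) (k A B M : ℝ), Prof n a η δ K k A B M ∧ 0 ≤ M ∧ M ≤ 17 := by
  obtain ⟨r, hr, hr8, hF⟩ := exists_root h hη hη1
  obtain ⟨hl, a1, a2, a3, hn, ha0, hsq⟩ := h.basic hη hη1
  have ha4 : 4 ≤ a := by
    have : (4:ℝ) ≤ a := by linarith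
    exact_mod_cast this
  have hr0 : 0 ≤ r := by linarith
  have hrpos : 0 < r := by linarith
  have hn' : (0:ℝ) < n := by positivity
  have hl0 : 0 < Real.log n := by linarith
  have hf := gf_ge_one a hr0 ha4
  have hfpos : 0 < gf a r := by linarith
  have hD := gD_ge a hr0 ha4
  set D := a * gf a r - gm a r with hDdef
  have hDpos : 0 < D := by linarith
  set κ := n / D with hκ
  have hκpos : 0 < κ := by positivity
  have hMf : gm a r = gM a r * gf a r := by rw [gM, div_mul_cancel₀ _ (by linarith)]
  set M := gM a r with hM
  set B := Real.log a + ((a:ℝ)-1) * Real.log 2 - Real.log r with hB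
  set A := Real.log κ + Real.log (dcoef a) - B * a with hA
  have hFb := Fk_bd h hη hη1 hr hr8
  have hMδ : |M + δ - 2 / Real.log 2| ≤ 60 * η := by
    rw [hF, zero_sub, abs_neg, abs_mul, abs_of_pos hl0] at hFb
    have : Real.log n * |M + δ - 2 / Real.log 2| ≤ Real.log n * (60 * η) := by linarith
    exact le_of_mul_le_mul_left this hl0
  have hnk : ((a:ℝ) - M) * (κ * gf a r) = n := by
    have : ((a:ℝ) - M) * (κ * gf a r) = κ * D := by rw [hDdef, hMf]; ring
    rw [this, hκ, div_mul_cancel₀ _ hDpos.ne']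
  have hsumk : ∀ φ : ℕ → ℝ, ∑ i ∈ Finset.range a, φ i * (κ * gg a r i) = κ * ∑ i ∈ Finset.range a, φ i * gg a r i := by
    intro φ; rw [Finset.mul_sum]; exact Finset.sum_congr rfl fun i _ => by ring
  have hMb := abs_le.1 hMδ
  obtain ⟨t1, t2⟩ := two_div_l2
  refine ⟨fun i => κ * gg a r i, κ * gf a r, A, B, M, ⟨?_, ?_, ?_, ?_, hnk, ?_, ?_, hMδ, ?_, ?_, ?_, ?_, ?_⟩, gM_bd a hr hr8 ha4⟩
  · intro i hi; exact mul_pos hκpos (gg_pos a hrpos i hi.le ha0)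
  · rw [← Finset.mul_sum]; rfl
  · positivity
  · rw [hsumk (fun i => (i:ℝ))]
    have : ∑ i ∈ Finset.range a, (i:ℝ) * gg a r i = gm a r := rfl
    rw [this, hMf]; ring
  · intro i hi
    have hg := gg_pos a hrpos i hi.le ha0
    have hd := dcoef_pos (a - i)
    rw [← Real.log_mul (by positivity) hd.ne', mul_assoc, gg_dcoef a r i hi.le ha0, Real.log_mul hκpos.ne' (by have := dcoef_pos a; positivity),
      Real.log_mul (dcoef_pos a).ne' (by positivity), Real.log_pow, Real.log_div hrpos.ne' (by positivity), Real.log_mul (by positivity) (by positivity), Real.log_pow,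
      Nat.cast_sub (by omega)]
    rw [hA, hB]; push_cast; ring
  · have e : Fk n a r = (a - M) * (Real.log (n.factorial:ℝ) / n) - A - B * (a - M) + 1 := by
      rw [hA, hκ, Real.log_div hn'.ne' hDpos.ne', Fk]; ring
    rw [hF] at e
    have e2 : κ * gf a r * ((a - M) * (Real.log (n.factorial:ℝ) / n)) = Real.log (n.factorial:ℝ) := by
      rw [show κ * gf a r * ((a - M) * (Real.log (n.factorial:ℝ) / n)) = ((a - M) * (κ * gf a r)) * (Real.log (n.factorial:ℝ) / n) by ring, hnk]
      field_simp
    have e3 : κ * gf a r * (B * (a - M)) = B * n := by rw [← hnk]; ring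
    linear_combination (κ * gf a r) * e + e2 - e3
  · have := p0_bd a hr hr8 ha4 (by linarith) δ (60*η) (by linarith) h.hδ1 (by linarith)
    simp only [gg_zero]
    nlinarith
  · have := p1_bd a hr ha4 (by linarith)
    have := mul_le_mul_of_nonneg_left this hκpos.le
    linarith
  · rw [hsumk (fun i => ((i:ℝ) - M)^2)]
    have := mul_le_mul_of_nonneg_left (var_bound a hr hr8 ha4 (by linarith) M hMf) hκpos.le
    linarith
  · rw [hsumk (fun i => 2^i)]
    have := mul_le_mul_of_nonneg_left (exp_bd a hr hr8 ha4 (by linarith) δ (60*η) (by linarith) (by linarith) h.hδ2 (by linarith)) hκpos.le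
    linarith
  · exact B_bd h hη hη1 hr hr8
end TM

namespace TM

def TT (a : ℕ) (A B lm : ℝ) (i : ℕ) : ℝ := A + B * ((a:ℝ) - i) - ((a:ℝ) - i) * lm

set_option maxHeartbeats 1000000 in
lemma T_bounds {η : ℝ} {n a : ℕ} {δ : ℝ} {K : ℕ → ℝ} {k A B M : ℝ} (h : Asy η n a δ) (hP : Prof n a η δ K k A B M)
    (hM0 : 0 ≤ M) (hM17 : M ≤ 17) (hη : 0 < η) (hη1 : η ≤ 0.000000001) (s : ℝ) (hs : 0 ≤ s) (hs1 : s ≤ 0.031 * Real.log n) (i : ℕ) :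
    TT a A B (Real.log n - s) i ≤ Real.log n * (2 / Real.log 2 * s - δ - i + 0.0000002 * (1 + i + s)) ∧
    Real.log n * (2 / Real.log 2 * s - δ - 1.031 * i - 0.0000002 * (1 + i + s)) ≤ TT a A B (Real.log n - s) i := by
  obtain ⟨hl, a1, a2, a3, hn, ha0, hsq⟩ := h.basic hη (by linarith)
  obtain ⟨w1, w2⟩ := w_bd h hη (by linarith)
  have hb := h.hbig
  have ha := abs_le.1 h.ha
  have hB := abs_le.1 hP.hB
  have hMδ := abs_le.1 hP.hMδ
  have hkpos := hP.hkpos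
  have hnk := hP.hn
  have hroot := hP.hroot
  have hn' : (0:ℝ) < n := by positivity
  set w := Real.log (n.factorial:ℝ) / n with hw
  have hwn : Real.log (n.factorial:ℝ) = w * n := by rw [hw]; field_simp
  have hA : A = (a - M) * w - B * (a - M) + 1 := by
    have : A * k = ((a - M) * w - B * (a - M) + 1) * k := by
      have := hroot
      rw [hwn, ← hnk] at this
      linarith
    exact mul_right_cancel₀ hkpos.ne' this
  set l := Real.log n with hl_def
  set x := 2 / Real.log 2 with hx
  set e := (a:ℝ) - x * l with he
  set e1 := (a - M) * (w - (l - 1)) with he1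
  have he1a : 0 ≤ e1 := mul_nonneg (by linarith) (by linarith)
  have he1b : e1 ≤ 1 := by
    have := mul_le_mul_of_nonneg_left w1 hM0
    rw [he1]; linarith
  set c := B - l + 1 with hc
  have hηl : η * l ≤ 0.000000001 * l := mul_le_mul_of_nonneg_right hη1 (by linarith)
  have hT : TT a A B (l - s) i = e1 + 1 + l * (x - δ - i) + l * (M + δ - x) + (c - l) * (M - i) - x * l + x * s * l - e + s * e + i - s * i := by
    rw [TT, hA, he1, hc, he]; ring
  have hi : (0:ℝ) ≤ i := by positivity
  have hc1 : c - l ≤ 0.000000003 * l := by rw [hc]; linarith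
  have hc2 : -(0.000000003 * l) ≤ c - l := by rw [hc]; linarith
  have hci1 : (c-l) * i ≤ 0.000000003 * l * i := mul_le_mul_of_nonneg_right hc1 hi
  have hci2 : -(0.000000003 * l) * i ≤ (c-l) * i := mul_le_mul_of_nonneg_right hc2 hi
  have hcM1 : (c-l) * M ≤ 0.000000003 * l * 17 := (mul_le_mul_of_nonneg_right hc1 hM0).trans (mul_le_mul_of_nonneg_left hM17 (by linarith))
  have hcM2 : -(0.000000003 * l * 17) ≤ (c-l) * M := by
    have x1 := mul_le_mul_of_nonneg_right hc2 hM0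
    have x2 : 0.000000003 * l * M ≤ 0.000000003 * l * 17 := mul_le_mul_of_nonneg_left hM17 (by linarith)
    linarith
  have hse1 : s * e ≤ s * (0.000000001 * l) := mul_le_mul_of_nonneg_left (by linarith) hs
  have hse2 : s * (-(0.000000001 * l)) ≤ s * e := mul_le_mul_of_nonneg_left (by linarith) hs
  have hlM1 : l * (M + δ - x) ≤ l * (60 * 0.000000001) := mul_le_mul_of_nonneg_left (by linarith) (by linarith)
  have hlM2 : l * (-(60 * 0.000000001)) ≤ l * (M + δ - x) := mul_le_mul_of_nonneg_left (by linarith) (by linarith)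
  have hsi0 : 0 ≤ s * i := by positivity
  have hsi : s * i ≤ 0.031 * l * i := mul_le_mul_of_nonneg_right hs1 hi
  have hil : (i:ℝ) * 100000000000 ≤ l * i := by nlinarith
  have hls : 0 ≤ l * s := mul_nonneg (by linarith) hs
  rw [hT]
  constructor
  · linarith
  · linarith

lemma k_bounds {η : ℝ} {n a : ℕ} {δ : ℝ} {K : ℕ → ℝ} {k A B M : ℝ} (h : Asy η n a δ) (hP : Prof n a η δ K k A B M)
    (hM0 : 0 ≤ M) (hM17 : M ≤ 17) (hη : 0 < η) (hη1 : η ≤ 0.000000001) :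
    k ≤ 0.00000000001 * n ∧ k * Real.log n ≤ Real.log 2 / 2 * (1 + 0.00001) * n ∧ k * Real.log n ≤ 0.3467 * n := by
  obtain ⟨hl, a1, a2, a3, hn, ha0, hsq⟩ := h.basic hη (by linarith)
  have ha := abs_le.1 h.ha
  have hkpos := hP.hkpos
  have hnk := hP.hn
  obtain ⟨L1, L2⟩ := l2bd
  have hL3 := Real.log_two_lt_d9
  set l := Real.log n
  set L := Real.log 2
  have hηl : η * l ≤ 0.000000001 * l := mul_le_mul_of_nonneg_right hη1 (by linarith)
  have e : 2 / L * L = 2 := by field_simp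
  have h1 : (2 / L - 0.00000001) * l ≤ a - M := by linarith
  have h2 : 2 * l ≤ L * (1 + 0.00001) * (a - M) := by
    have x1 : L * (1 + 0.00001) * ((2 / L - 0.00000001) * l) ≤ L * (1 + 0.00001) * (a - M) := mul_le_mul_of_nonneg_left h1 (by positivity)
    have x2 : L * (1 + 0.00001) * ((2 / L - 0.00000001) * l) = (2/L * L - 0.00000001 * L) * (1 + 0.00001) * l := by ring
    rw [x2, e] at x1
    have : 2 * l ≤ (2 - 0.00000001 * L) * (1+0.00001) * l := mul_le_mul_of_nonneg_right (by linarith) (by linarith)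
    linarith
  have h3 : k * l ≤ L / 2 * (1 + 0.00001) * n := by
    have := mul_le_mul_of_nonneg_right h2 hkpos.le
    rw [mul_assoc, mul_assoc, hnk] at this
    linarith
  refine ⟨?_, h3, ?_⟩
  · have : k * 100000000000 ≤ (a - M) * k := by nlinarith
    linarith
  · have hn' : (0:ℝ) < n := by positivity
    have : L / 2 * (1 + 0.00001) * n ≤ 0.3467 * n := mul_le_mul_of_nonneg_right (by linarith) hn'.le
    linarith

lemma psi_le_log (T : ℝ) : psi (Real.exp T) ≤ max T 0 + 1 := by
  unfold psi
  by_cases h : Real.exp T ≤ 1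
  · rw [if_pos h]; have := le_max_right T 0; linarith
  · rw [if_neg h, Real.log_exp]
    push Not at h
    have h1 : 1 ≤ Real.sqrt (Real.exp T) := Real.one_le_sqrt.2 h.le
    have h2 : 2 / Real.sqrt (Real.exp T) ≤ 2 := by rw [div_le_iff₀ (by linarith)]; linarith
    have := le_max_left T 0
    linarith

lemma psi_le_exp (T τ : ℝ) (hτ : 0 < τ) (hτ1 : τ ≤ 1/2) :
    psi (Real.exp T) ≤ T - 1 + (2 + 1 / (Real.exp 1 * τ)) * Real.exp (-τ * T) := by
  have he : 0 < Real.exp 1 * τ := by positivity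
  unfold psi
  by_cases h : Real.exp T ≤ 1
  · rw [if_pos h]
    have hT : T ≤ 0 := by rwa [Real.exp_le_one_iff] at h
    have h1 : 1 ≤ Real.exp (-τ * T) := by
      rw [Real.one_le_exp_iff]; nlinarith
    have h2 : -T ≤ 1 / (Real.exp 1 * τ) * Real.exp (-τ * T) := by
      rw [div_mul_eq_mul_div, one_mul, le_div_iff₀ he]
      have h3 := Real.add_one_le_exp (-τ * T - 1)
      rw [Real.exp_sub, le_div_iff₀ (Real.exp_pos 1)] at h3
      linarith
    linarith
  · rw [if_neg h, Real.log_exp]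
    push Not at h
    have hT : 0 < T := by rwa [Real.one_lt_exp_iff] at h
    have h2 : 2 / Real.sqrt (Real.exp T) ≤ 2 * Real.exp (-τ * T) := by
      rw [← Real.exp_half, div_eq_mul_inv, ← Real.exp_neg]
      apply mul_le_mul_of_nonneg_left _ (by norm_num)
      apply Real.exp_le_exp.2; nlinarith
    have h3 : 0 ≤ 1 / (Real.exp 1 * τ) * Real.exp (-τ * T) := by positivity
    linarith
end TM

namespace TM

lemma exp_neg_lower (s : ℝ) (hs : 0 ≤ s) (hs1 : s ≤ 1/2) : 0.4 * s^2 ≤ s - 1 + Real.exp (-s) := by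
  have h := Real.exp_bound (x := -s) (by rw [abs_neg, abs_of_nonneg hs]; linarith) (n := 4) (by norm_num)
  rw [abs_neg, abs_of_nonneg hs] at h
  have h := (abs_le.1 h).1
  norm_num [Finset.sum_range_succ, Nat.factorial] at h
  have h1 : s^3 ≤ 1/2 * s^2 := by nlinarith [sq_nonneg s]
  have h2 : s^4 ≤ 1/4 * s^2 := by nlinarith [sq_nonneg s]
  nlinarith

lemma h_lower (s : ℝ) (hs : 1/2 ≤ s) (hs1 : s ≤ 1.3864) : 0.0624 ≤ Real.exp (-s) * (s - 1 + Real.exp (-s)) := by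
  set Q := Real.exp (-s) with hQ
  have hQpos : 0 < Q := Real.exp_pos _
  rcases le_or_gt 1 s with h1 | h1
  · have h2 : 0.2499 ≤ Q := by
      have x1 : Real.exp (-1.3864) ≤ Q := Real.exp_le_exp.2 (by linarith)
      have x2 : Real.exp (-1.3864) = Real.exp (-(2 * Real.log 2)) * Real.exp (2 * Real.log 2 - 1.3864) := by rw [← Real.exp_add]; congr 1; ring
      have x3 : Real.exp (-(2 * Real.log 2)) = 1/4 := by
        rw [Real.exp_neg, show 2 * Real.log 2 = Real.log 2 + Real.log 2 by ring, Real.exp_add, Real.exp_log (by norm_num)]; norm_num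
      have x4 := Real.add_one_le_exp (2 * Real.log 2 - 1.3864)
      have := Real.log_two_gt_d9
      rw [x2, x3] at x1
      linarith
    nlinarith
  · have h2 : 0.606 * (1.5 - s) ≤ Q := by
      have x1 : Q = Real.exp (-(1/2)) * Real.exp (1/2 - s) := by rw [hQ, ← Real.exp_add]; congr 1; ring
      have x2 := Real.add_one_le_exp (1/2 - s)
      have x3 : 0.606 ≤ Real.exp (-(1/2)) := by
        have h := Real.exp_bound (x := -(1/2)) (by rw [abs_neg]; norm_num) (n := 5) (by norm_num)
        have h := (abs_le.1 h).1
        norm_num [Finset.sum_range_succ, Nat.factorial] at h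
        norm_num; linarith
      rw [x1]
      calc 0.606 * (1.5 - s) ≤ 0.606 * Real.exp (1/2 - s) := by nlinarith
        _ ≤ _ := mul_le_mul_of_nonneg_right x3 (Real.exp_pos _).le
    have h3 : 0.394 * s - 0.091 ≤ s - 1 + Q := by linarith
    have h4 : 0.606 * (1.5 - s) * (0.394 * s - 0.091) ≤ Q * (s - 1 + Q) :=
      mul_le_mul h2 h3 (by linarith) hQpos.le
    nlinarith

/-- bundle of hypotheses for the final inequality -/
structure FH (n a : ℕ) (η δ : ℝ) (K : ℕ → ℝ) (k A B M : ℝ) : Prop where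
  asy : Asy η n a δ
  prof : Prof n a η δ K k A B M
  M0 : 0 ≤ M
  M17 : M ≤ 17
  η0 : 0 < η
  η1 : η ≤ 0.000000001

variable {n a : ℕ} {η δ : ℝ} {K : ℕ → ℝ} {k A B M : ℝ}

lemma FH.case1 (h : FH n a η δ K k A B M) (s : ℝ) (hs : 0 ≤ s) (hs1 : s ≤ 0.031 * Real.log n)
    (hX : 2 / Real.log 2 * s ≤ δ - 0.04) :
    ∑ i ∈ Finset.range a, K i * psi (Real.exp (TT a A B (Real.log n - s) i)) ≤ n * Real.exp (-0.035 * Real.log n) := by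
  obtain ⟨hl, a1, a2, a3, hn, ha0, hsq⟩ := h.asy.basic h.η0 (by linarith [h.η1])
  obtain ⟨k1, k2, k3⟩ := k_bounds h.asy h.prof h.M0 h.M17 h.η0 h.η1
  have t1 := two_div_l2.1
  have hδ := h.asy.hδ2
  have hs2 : s ≤ 1 := by nlinarith
  have hT : ∀ i : ℕ, TT a A B (Real.log n - s) i ≤ -0.035 * Real.log n := by
    intro i
    have := (T_bounds h.asy h.prof h.M0 h.M17 h.η0 h.η1 s hs hs1 i).1
    have hi : (0:ℝ) ≤ i := by positivity
    have h2 : Real.log n * (2 / Real.log 2 * s - δ - i + 0.0000002 * (1 + i + s)) ≤ Real.log n * (-0.035) :=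
      mul_le_mul_of_nonneg_left (by linarith) (by linarith)
    linarith
  have : ∑ i ∈ Finset.range a, K i * psi (Real.exp (TT a A B (Real.log n - s) i)) ≤ ∑ i ∈ Finset.range a, K i * Real.exp (-0.035 * Real.log n) := by
    apply Finset.sum_le_sum
    intro i hi
    apply mul_le_mul_of_nonneg_left _ (h.prof.hK i (Finset.mem_range.1 hi)).le
    have h1 := hT i
    have h2 : Real.exp (TT a A B (Real.log n - s) i) ≤ 1 := Real.exp_le_one_iff.2 (by linarith)
    rw [psi, if_pos h2]
    exact Real.exp_le_exp.2 h1
  refine this.trans ?_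
  rw [← Finset.sum_mul, h.prof.hk]
  have hn' : (0:ℝ) < n := by positivity
  exact mul_le_mul_of_nonneg_right (by linarith) (Real.exp_pos _).le

lemma IIA_num (X δ : ℝ) (hX0 : 0.06 ≤ X) (hX1 : X ≤ 1.4428) (hδ : 0.1 ≤ δ) (hδ2 : δ ≤ 1.9) :
    0.3467 * ((δ/2 + 0.00000006) * (max (X - δ) 0 + 0.0000004) + 0.42 * (max (X - δ - 1) 0 + 0.0000006)) + 0.00000000001 ≤ 0.048 * X^2 := by
  rcases le_total (X - δ) 0 with h1 | h1
  · rw [max_eq_right h1, max_eq_right (by linarith)]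
    nlinarith
  · rw [max_eq_left h1]
    rcases le_total (X - δ - 1) 0 with h2 | h2
    · rw [max_eq_right h2]
      nlinarith [sq_nonneg (X - 2 * δ)]
    · rw [max_eq_left h2]
      nlinarith [sq_nonneg (X - 2 * δ)]

lemma FH.case2a (h : FH n a η δ K k A B M) (s : ℝ) (hs : 0 ≤ s) (hs1 : s ≤ 0.031 * Real.log n)
    (hX : δ - 0.04 ≤ 2 / Real.log 2 * s) (hs2 : s ≤ 1/2) :
    ∑ i ∈ Finset.range a, K i * psi (Real.exp (TT a A B (Real.log n - s) i)) ≤ n * (s - 1 + Real.exp (-s)) := by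
  obtain ⟨hl, a1, a2, a3, hn, ha0, hsq⟩ := h.asy.basic h.η0 (by linarith [h.η1])
  obtain ⟨k1, k2, k3⟩ := k_bounds h.asy h.prof h.M0 h.M17 h.η0 h.η1
  obtain ⟨t1, t2⟩ := two_div_l2
  have hδ := h.asy.hδ1
  have hδ2 := h.asy.hδ2
  have hη1 := h.η1
  have hn' : (0:ℝ) < n := by positivity
  set X := 2 / Real.log 2 * s with hXdef
  have hX1 : X ≤ 1.4428 := by nlinarith
  set l := Real.log n
  have hl0 : 0 < l := by linarith
  have hT := fun i => (T_bounds h.asy h.prof h.M0 h.M17 h.η0 h.η1 s hs hs1 i).1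
  have hmax : ∀ i : ℕ, max (TT a A B (l - s) i) 0 ≤ l * (max (X - δ - i) 0 + 0.0000002 * (2 + i)) := by
    intro i
    have hi : (0:ℝ) ≤ i := by positivity
    have x1 := le_max_left (X - δ - i) 0
    have x2 := le_max_right (X - δ - i) 0
    apply max_le
    · refine (hT i).trans (mul_le_mul_of_nonneg_left ?_ hl0.le)
      linarith
    · apply mul_nonneg hl0.le; positivity
  have hmax2 : ∀ i : ℕ, 2 ≤ i → max (TT a A B (l - s) i) 0 = 0 := by
    intro i hi
    have hi : (2:ℝ) ≤ i := by exact_mod_cast hi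
    apply max_eq_right
    refine (hT i).trans ?_
    apply mul_nonpos_of_nonneg_of_nonpos hl0.le
    linarith
  have hK := fun i hi => h.prof.hK i hi
  have ha2 : 2 ≤ a := by
    have : (2:ℝ) ≤ a := by linarith
    exact_mod_cast this
  have s1 : ∑ i ∈ Finset.range a, K i * psi (Real.exp (TT a A B (l - s) i)) ≤ ∑ i ∈ Finset.range a, (K i * max (TT a A B (l - s) i) 0 + K i) := by
    apply Finset.sum_le_sum
    intro i hi
    have := mul_le_mul_of_nonneg_left (psi_le_log (TT a A B (l - s) i)) (hK i (Finset.mem_range.1 hi)).le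
    linarith
  rw [Finset.sum_add_distrib, h.prof.hk] at s1
  have s2 : ∑ i ∈ Finset.range a, K i * max (TT a A B (l - s) i) 0 = K 0 * max (TT a A B (l - s) 0) 0 + K 1 * max (TT a A B (l - s) 1) 0 := by
    have : ∑ i ∈ Finset.range 2, K i * max (TT a A B (l - s) i) 0 = ∑ i ∈ Finset.range a, K i * max (TT a A B (l - s) i) 0 := by
      apply Finset.sum_subset (Finset.range_subset_range.2 ha2)
      intro i _ hi
      rw [hmax2 i (by have := Finset.mem_range.not.1 hi; omega), mul_zero]
    rw [← this, Finset.sum_range_succ, Finset.sum_range_one]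
  rw [s2] at s1
  have m0 := hmax 0
  have m1 := hmax 1
  have hk := h.prof.hkpos
  push_cast at m0 m1
  have n0 : K 0 * max (TT a A B (l - s) 0) 0 ≤ ((δ/2 + 0.00000006) * k) * (l * (max (X - δ) 0 + 0.0000004)) := by
    apply mul_le_mul
    · refine h.prof.h0.trans (mul_le_mul_of_nonneg_right (by linarith) hk.le)
    · refine m0.trans (le_of_eq ?_); norm_num
    · exact le_max_right _ _
    · positivity
  have n1 : K 1 * max (TT a A B (l - s) 1) 0 ≤ (0.42 * k) * (l * (max (X - δ - 1) 0 + 0.0000006)) := by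
    apply mul_le_mul h.prof.h1
    · refine m1.trans (le_of_eq ?_); norm_num
    · exact le_max_right _ _
    · positivity
  have hb : 0 ≤ (δ/2 + 0.00000006) * (max (X - δ) 0 + 0.0000004) + 0.42 * (max (X - δ - 1) 0 + 0.0000006) := by positivity
  have s3 := mul_le_mul_of_nonneg_right k3 hb
  have s4 := mul_le_mul_of_nonneg_left (IIA_num X δ (by linarith) hX1 hδ hδ2) hn'.le
  have s5 := exp_neg_lower s hs hs2
  have s6 : 0.048 * X^2 ≤ 0.4 * s^2 := by
    have : X^2 ≤ 8.33 * s^2 := by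
      rw [hXdef, mul_pow]
      apply mul_le_mul_of_nonneg_right _ (sq_nonneg s)
      nlinarith
    nlinarith [sq_nonneg s]
  have s7 := mul_le_mul_of_nonneg_left (s6.trans s5) hn'.le
  linarith
end TM

namespace TM
variable {n a : ℕ} {η δ : ℝ} {K : ℕ → ℝ} {k A B M : ℝ}

lemma max_quad (z W : ℝ) (hW : 0 < W) : max z 0 ≤ (z^2 / W + 2 * z + W) / 4 := by
  have h1 : (z^2 / W + 2 * z + W) / 4 = (z + W)^2 / (4 * W) := by field_simp; ring
  have h2 : (z^2 / W + 2 * z + W) / 4 - z = (z - W)^2 / (4 * W) := by field_simp; ring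
  apply max_le
  · have : 0 ≤ (z - W)^2 / (4 * W) := by positivity
    linarith
  · rw [h1]; positivity

set_option maxHeartbeats 2000000 in
lemma FH.case2b (h : FH n a η δ K k A B M) (s : ℝ) (hs1 : s ≤ 0.031 * Real.log n)
    (hs2 : 1/2 ≤ s) (hs3 : s ≤ 1.3864) :
    ∑ i ∈ Finset.range a, K i * psi (Real.exp (TT a A B (Real.log n - s) i)) ≤ n * (s - 1 + Real.exp (-s)) := by
  obtain ⟨hl, a1, a2, a3, hn, ha0, hsq⟩ := h.asy.basic h.η0 (by linarith [h.η1])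
  obtain ⟨k1, k2, k3⟩ := k_bounds h.asy h.prof h.M0 h.M17 h.η0 h.η1
  obtain ⟨L1, L2⟩ := l2bd
  have hη1 := h.η1
  have hM17 := h.M17
  have hM0 := h.M0
  have hs : 0 ≤ s := by linarith
  have hn' : (0:ℝ) < n := by positivity
  have hk := h.prof.hkpos
  set L := Real.log 2 with hL
  set X := 2 / L * s with hXdef
  set l := Real.log n
  have hl0 : 0 < l := by linarith
  have hT := fun i => (T_bounds h.asy h.prof h.M0 h.M17 h.η0 h.η1 s hs hs1 i).1
  have hXL : L / 2 * X = s := by rw [hXdef]; field_simp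
  -- z_i = L/2 * (X - δ - i)
  set z : ℕ → ℝ := fun i => L/2 * (X - δ - i) with hz
  have hmax : ∀ i : ℕ, max (TT a A B (l - s) i) 0 ≤ l * (2 / L * max (z i) 0 + 0.0000002 * (3 + i)) := by
    intro i
    have hi : (0:ℝ) ≤ i := by positivity
    have x1 : X - δ - i ≤ 2 / L * max (z i) 0 := by
      have y1 : X - δ - i = 2 / L * z i := by rw [hz]; field_simp
      rw [y1]
      exact mul_le_mul_of_nonneg_left (le_max_left _ _) (by positivity)
    have x2 : 0 ≤ 2 / L * max (z i) 0 := mul_nonneg (by positivity) (le_max_right _ _)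
    apply max_le
    · refine (hT i).trans (mul_le_mul_of_nonneg_left ?_ hl0.le)
      linarith
    · apply mul_nonneg hl0.le; positivity
  set Q := Real.exp (-s) with hQ
  have hQpos : 0 < Q := Real.exp_pos _
  have hQ1 : Q ≤ 0.7 := by
    have := Real.add_one_le_exp s
    have e : Q * Real.exp s = 1 := by rw [hQ, ← Real.exp_add]; simp
    nlinarith
  have hh := h_lower s hs2 hs3
  have htQ : 0.08 ≤ s - 1 + Q := by
    by_contra hc
    push Not at hc
    nlinarith
  set W := s - 1 + 2 * Q with hW
  have hWpos : 0 < W := by linarith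
  have hW2 : W ≤ 2 := by linarith
  -- mean of z
  set zb := L/2 * (X - δ - M) with hzb
  have hMδ := abs_le.1 h.prof.hMδ
  have hzb1 : s - 1 - 0.0000001 ≤ zb ∧ zb ≤ s - 1 + 0.0000001 := by
    have e : zb = s - L/2 * (M + δ - 2/L) - 1 := by
      have : L/2 * (2/L) = 1 := by field_simp
      rw [hzb]; linear_combination hXL - this
    have y1 : L/2 * (M + δ - 2/L) ≤ L/2 * (0.00000006) := mul_le_mul_of_nonneg_left (by linarith) (by positivity)
    have y2 : L/2 * (-(0.00000006)) ≤ L/2 * (M + δ - 2/L) := mul_le_mul_of_nonneg_left (by linarith) (by positivity)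
    constructor <;> linarith
  have hsumz : ∑ i ∈ Finset.range a, K i * z i = zb * k := by
    have : ∑ i ∈ Finset.range a, K i * z i = L/2*(X-δ) * ∑ i ∈ Finset.range a, K i - L/2 * ∑ i ∈ Finset.range a, (i:ℝ) * K i := by
      rw [Finset.mul_sum, Finset.mul_sum, ← Finset.sum_sub_distrib]
      exact Finset.sum_congr rfl fun i _ => by rw [hz]; ring
    rw [this, h.prof.hk, h.prof.hM, hzb]; ring
  have hsumz2 : ∑ i ∈ Finset.range a, K i * (z i)^2 ≤ (0.2104 + zb^2) * k := by
    have : ∑ i ∈ Finset.range a, K i * (z i)^2 = L^2/4 * ∑ i ∈ Finset.range a, ((i:ℝ) - M)^2 * K i - L * zb * ∑ i ∈ Finset.range a, (i:ℝ) * K i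
        + (L * zb * M + zb^2) * ∑ i ∈ Finset.range a, K i := by
      rw [Finset.mul_sum, Finset.mul_sum, Finset.mul_sum, ← Finset.sum_sub_distrib, ← Finset.sum_add_distrib]
      exact Finset.sum_congr rfl fun i _ => by rw [hz, hzb]; ring
    rw [this, h.prof.hk, h.prof.hM]
    have hv := mul_le_mul_of_nonneg_left h.prof.hvar (by positivity : 0 ≤ L^2/4)
    have hL4 : L^2/4 * 1.75 * k ≤ 0.2104 * k := mul_le_mul_of_nonneg_right (by nlinarith) hk.le
    linarith
  have hsumm : ∑ i ∈ Finset.range a, K i * max (z i) 0 ≤ ((0.2104 + zb^2) / W + 2 * zb + W)/4 * k := by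
    calc ∑ i ∈ Finset.range a, K i * max (z i) 0 ≤ ∑ i ∈ Finset.range a, K i * (((z i)^2 / W + 2 * z i + W)/4) := by
          apply Finset.sum_le_sum
          intro i hi
          exact mul_le_mul_of_nonneg_left (max_quad _ _ hWpos) (h.prof.hK i (Finset.mem_range.1 hi)).le
      _ = ((∑ i ∈ Finset.range a, K i * (z i)^2) / W + 2 * (∑ i ∈ Finset.range a, K i * z i) + W * ∑ i ∈ Finset.range a, K i)/4 := by
          rw [Finset.sum_div, Finset.mul_sum, Finset.mul_sum, ← Finset.sum_add_distrib, ← Finset.sum_add_distrib, Finset.sum_div]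
          exact Finset.sum_congr rfl fun i _ => by ring
      _ ≤ ((0.2104 + zb^2) * k / W + 2 * (zb * k) + W * k)/4 := by
          rw [hsumz, h.prof.hk]
          have := div_le_div_of_nonneg_right hsumz2 hWpos.le
          linarith
      _ = _ := by ring
  have hG : ((0.2104 + zb^2) / W + 2 * zb + W)/4 ≤ s - 1 + Q - 0.001 := by
    have y1 : zb^2 ≤ (s-1)^2 + 0.000001 := by nlinarith
    have y2 : (0.2104 + zb^2)/W ≤ W - 0.01 := by
      rw [div_le_iff₀ hWpos]
      have : W * W = (s-1)^2 + 4 * (Q * (s - 1 + Q)) := by rw [hW]; ring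
      nlinarith
    rw [hW] at y2 ⊢
    linarith
  have s1 : ∑ i ∈ Finset.range a, K i * psi (Real.exp (TT a A B (l - s) i)) ≤
      ∑ i ∈ Finset.range a, (2 * l / L * (K i * max (z i) 0) + l * 0.0000002 * (3 * K i + i * K i) + K i) := by
    apply Finset.sum_le_sum
    intro i hi
    have hKi := (h.prof.hK i (Finset.mem_range.1 hi)).le
    have x1 := mul_le_mul_of_nonneg_left (psi_le_log (TT a A B (l - s) i)) hKi
    have x2 := mul_le_mul_of_nonneg_left (hmax i) hKi
    have x3 : K i * (l * (2 / L * max (z i) 0 + 0.0000002 * (3 + i))) = 2 * l / L * (K i * max (z i) 0) + l * 0.0000002 * (3 * K i + i * K i) := by ring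
    linarith
  rw [Finset.sum_add_distrib, Finset.sum_add_distrib, ← Finset.mul_sum, ← Finset.mul_sum, Finset.sum_add_distrib, ← Finset.mul_sum, h.prof.hk, h.prof.hM] at s1
  have s2 : 2 * l / L * (∑ i ∈ Finset.range a, K i * max (z i) 0) ≤ n * (1 + 0.00001) * (s - 1 + Q - 0.001) := by
    have x1 : ∑ i ∈ Finset.range a, K i * max (z i) 0 ≤ (s - 1 + Q - 0.001) * k := hsumm.trans (mul_le_mul_of_nonneg_right hG hk.le)
    have x2 := mul_le_mul_of_nonneg_left x1 (by positivity : 0 ≤ 2 * l / L)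
    refine x2.trans ?_
    have x3 : 2 / L * (k * l) ≤ n * (1 + 0.00001) := by
      have := mul_le_mul_of_nonneg_left k2 (by positivity : 0 ≤ 2 / L)
      have e : 2 / L * (L / 2 * (1 + 0.00001) * n) = n * (1 + 0.00001) := by field_simp
      linarith
    have x4 : 2 * l / L * ((s - 1 + Q - 0.001) * k) = 2 / L * (k * l) * (s - 1 + Q - 0.001) := by ring
    rw [x4]
    exact mul_le_mul_of_nonneg_right x3 (by linarith)
  have s3 : l * 0.0000002 * (3 * k + M * k) ≤ 0.000002 * n := by
    have : l * 0.0000002 * (3 * k + M * k) = (k * l) * (0.0000002 * (3 + M)) := by ring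
    rw [this]
    have y := mul_le_mul k3 (by linarith : 0.0000002 * (3 + M) ≤ 0.000004) (by positivity) (by positivity)
    linarith
  have s4 : n * (1 + 0.00001) * (s - 1 + Q - 0.001) ≤ n * (s - 1 + Q - 0.0009) := by
    rw [mul_assoc]
    apply mul_le_mul_of_nonneg_left _ hn'.le
    linarith
  linarith

set_option maxHeartbeats 2000000 in
lemma FH.case3 (h : FH n a η δ K k A B M) (s : ℝ) (hs1 : s ≤ 0.031 * Real.log n) (hs2 : 1.386 ≤ s) :
    ∑ i ∈ Finset.range a, K i * psi (Real.exp (TT a A B (Real.log n - s) i)) ≤ n * (s - 1 + Real.exp (-s)) + 1 + Real.log n := by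
  obtain ⟨hl, a1, a2, a3, hn, ha0, hsq⟩ := h.asy.basic h.η0 (by linarith [h.η1])
  obtain ⟨k1, k2, k3⟩ := k_bounds h.asy h.prof h.M0 h.M17 h.η0 h.η1
  obtain ⟨L1, L2⟩ := l2bd
  have hs : 0 ≤ s := by linarith
  have hn' : (0:ℝ) < n := by positivity
  have hk := h.prof.hkpos
  have hδ0 : 0 ≤ δ := by linarith [h.asy.hδ1]
  set L := Real.log 2 with hL
  set l := Real.log n with hldef
  have hl0 : 0 < l := by linarith
  have hT := fun i => (T_bounds h.asy h.prof h.M0 h.M17 h.η0 h.η1 s hs hs1 i).2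
  set τ := L / (1.05 * l) with hτ
  have hτpos : 0 < τ := by positivity
  have hτ1 : τ ≤ 1/2 := by rw [hτ, div_le_iff₀ (by positivity)]; linarith
  have hτl : τ * l = L / 1.05 := by rw [hτ]; field_simp
  set Cc := 2 + 1 / (Real.exp 1 * τ) with hCc
  have hCc0 : 0 ≤ Cc := by positivity
  have he : ∀ i : ℕ, Real.exp (-τ * TT a A B (l - s) i) ≤ (Real.exp (-1.904 * s) * 1.001) * (Real.exp (δ * L) * 2^i) := by
    intro i
    have hi : (0:ℝ) ≤ i := by positivity
    have x1 : τ * (l * (2 / L * s - δ - 1.031 * i - 0.0000002 * (1 + i + s))) ≤ τ * TT a A B (l - s) i := mul_le_mul_of_nonneg_left (hT i) hτpos.le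
    rw [← mul_assoc, hτl] at x1
    have e1 : L / 1.05 * (2 / L * s - δ - 1.031 * i - 0.0000002 * (1 + i + s)) = (2/L * L)/1.05 * s - L / 1.05 * (δ + 1.031 * i + 0.0000002 * (1 + i + s)) := by ring
    have e2 : 2 / L * L = 2 := by field_simp
    rw [e1, e2] at x1
    have y1 : L / 1.05 * (δ + 1.031 * i + 0.0000002 * (1 + i + s)) = L * (δ/1.05) + L * ((1.031+0.0000002)/1.05 * i) + L * (0.0000002 * (1 + s)/1.05) := by ring
    have y2 : L * (δ/1.05) ≤ L * δ := mul_le_mul_of_nonneg_left (div_le_self hδ0 (by norm_num)) (by linarith)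
    have y3 : L * ((1.031+0.0000002)/1.05 * i) ≤ L * i := mul_le_mul_of_nonneg_left (mul_le_of_le_one_left hi (by norm_num)) (by linarith)
    have y4 : L * (0.0000002 * (1 + s)/1.05) ≤ 1 * (0.0000002 * (1 + s)/1.05) := mul_le_mul_of_nonneg_right (by linarith) (by positivity)
    have u1 : 1.9045 * s ≤ 2/1.05 * s := mul_le_mul_of_nonneg_right (by norm_num) hs
    have u2 : 0.0000002 * (1 + s)/1.05 ≤ 0.0000002 * (1 + s) := div_le_self (by positivity) (by norm_num)
    rw [y1] at x1
    have z1 : -τ * TT a A B (l - s) i ≤ -1.904 * s + (δ * L + L * i) + 0.0000002 := by linarith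
    have z2 := Real.exp_le_exp.2 z1
    rw [Real.exp_add, Real.exp_add, Real.exp_add] at z2
    have z3 : Real.exp (L * i) = 2^i := by rw [hL, Real.exp_mul, Real.exp_log (by norm_num), Real.rpow_natCast]
    have z4 : Real.exp 0.0000002 ≤ 1.001 := by
      have h10 := Real.exp_bound' (x := 0.0000002) (by norm_num) (by norm_num) (n := 1) (by norm_num)
      norm_num [Finset.sum_range_succ, Nat.factorial] at h10
      norm_num; linarith
    rw [z3] at z2
    refine z2.trans ?_
    have : Real.exp (-1.904 * s) * (Real.exp (δ * L) * 2 ^ i) * Real.exp 0.0000002 ≤ Real.exp (-1.904 * s) * (Real.exp (δ * L) * 2 ^ i) * 1.001 :=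
      mul_le_mul_of_nonneg_left z4 (by positivity)
    linarith
  have s1 : ∑ i ∈ Finset.range a, K i * psi (Real.exp (TT a A B (l - s) i)) ≤
      ∑ i ∈ Finset.range a, ((A + (B - (l - s)) * a) * K i - (B - (l-s)) * (i * K i) - K i + (Cc * (Real.exp (-1.904 * s) * 1.001) * Real.exp (δ * L)) * (2^i * K i)) := by
    apply Finset.sum_le_sum
    intro i hi
    have hKi := (h.prof.hK i (Finset.mem_range.1 hi)).le
    have x1 := mul_le_mul_of_nonneg_left (psi_le_exp (TT a A B (l - s) i) τ hτpos hτ1) hKi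
    have x2 := mul_le_mul_of_nonneg_left (mul_le_mul_of_nonneg_left (he i) hCc0) hKi
    refine x1.trans ?_
    rw [mul_add]
    refine (add_le_add_right x2 _).trans (le_of_eq ?_)
    rw [TT]; ring
  rw [Finset.sum_add_distrib, Finset.sum_sub_distrib, Finset.sum_sub_distrib, ← Finset.mul_sum, ← Finset.mul_sum, ← Finset.mul_sum, h.prof.hk, h.prof.hM] at s1
  have e1 : (A + (B - (l - s)) * a) * k - (B - (l - s)) * (M * k) - k = Real.log (n.factorial:ℝ) - (l - s) * n := by
    have x1 := h.prof.hroot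
    have x2 := h.prof.hn
    linear_combination x1 + (B - (l-s)) * x2
  rw [e1] at s1
  have hf := log_fact_le n hn
  -- main term
  have s2 : (Cc * (Real.exp (-1.904 * s) * 1.001) * Real.exp (δ * L)) * ∑ i ∈ Finset.range a, 2^i * K i ≤ n * Real.exp (-s) := by
    have x1 := mul_le_mul_of_nonneg_left h.prof.hexp (by positivity : 0 ≤ Cc * (Real.exp (-1.904 * s) * 1.001))
    have x2 : Cc * (Real.exp (-1.904 * s) * 1.001) * (14.8 * k) = (Cc * k) * (14.8148 * Real.exp (-1.904 * s)) := by ring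
    have x3 : Cc * k ≤ 0.195 * n := by
      have c1 : Cc ≤ 1.06 * l / (2.718 * L) := by
        have d1 : 1 / (Real.exp 1 * τ) = 1.05 * l / (Real.exp 1 * L) := by rw [hτ]; field_simp
        have d2 : 1.05 * l / (Real.exp 1 * L) ≤ 1.05 * l / (2.718 * L) := by
          have := Real.exp_one_gt_d9
          gcongr; linarith
        have d3 : 2 ≤ 0.01 * l / (2.718 * L) := by rw [le_div_iff₀ (by positivity)]; linarith
        have d4 : 1.06 * l / (2.718 * L) = 1.05 * l / (2.718 * L) + 0.01 * l / (2.718 * L) := by ring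
        rw [hCc, d1, d4]; linarith
      have c2 := mul_le_mul_of_nonneg_right c1 hk.le
      have c3 : 1.06 * l / (2.718 * L) * k = 1.06 / (2.718 * L) * (k * l) := by ring
      have c4 := mul_le_mul_of_nonneg_left k2 (by positivity : 0 ≤ 1.06 / (2.718 * L))
      have c5 : 1.06 / (2.718 * L) * (L / 2 * (1 + 0.00001) * n) = 1.06 / 2.718 / 2 * (1 + 0.00001) * n := by field_simp
      have c6 : 1.06 / 2.718 / 2 * (1 + 0.00001) * (n:ℝ) ≤ 0.196 * n := mul_le_mul_of_nonneg_right (by norm_num) hn'.le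
      have c7 : 1.06 / 2.718 / 2 * (1 + 0.00001) * (n:ℝ) ≤ 0.1951 * n := mul_le_mul_of_nonneg_right (by norm_num) hn'.le
      have c8 : 1.06 / 2.718 / 2 * (1 + 0.00001) * (n:ℝ) ≤ 0.195 * n := mul_le_mul_of_nonneg_right (by norm_num) hn'.le
      linarith
    have x4 : 0.195 * 14.8148 * Real.exp (-1.904 * s) ≤ Real.exp (-s) := by
      have y1 : Real.exp (-s) = Real.exp (-1.904 * s) * Real.exp (0.904 * s) := by rw [← Real.exp_add]; congr 1; ring
      have y2 : 3 ≤ Real.exp (0.904 * s) := by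
        have z1 : Real.exp (1 + 0.2) ≤ Real.exp (0.904 * s) := Real.exp_le_exp.2 (by linarith)
        rw [Real.exp_add] at z1
        have z2 := Real.add_one_le_exp (0.2:ℝ)
        have z3 := Real.exp_one_gt_d9
        nlinarith
      rw [y1]
      have := mul_le_mul_of_nonneg_left y2 (Real.exp_pos (-1.904 * s)).le
      have := Real.exp_pos (-1.904 * s)
      linarith
    have x5 := mul_le_mul_of_nonneg_right x3 (by positivity : 0 ≤ 14.8148 * Real.exp (-1.904 * s))
    have x6 := mul_le_mul_of_nonneg_left x4 hn'.le
    linarith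
  linarith

lemma FH.final (h : FH n a η δ K k A B M) (s : ℝ) (hs : 0 ≤ s) (hs1 : s ≤ 0.031 * Real.log n) :
    ∑ i ∈ Finset.range a, K i * psi (Real.exp (TT a A B (Real.log n - s) i)) ≤
      n * (s - 1 + Real.exp (-s)) + n * Real.exp (-0.035 * Real.log n) + 1 + Real.log n := by
  obtain ⟨hl, a1, a2, a3, hn, ha0, hsq⟩ := h.asy.basic h.η0 (by linarith [h.η1])
  have hn' : (0:ℝ) < n := by positivity
  have e1 : 0 ≤ n * Real.exp (-0.035 * Real.log n) := by positivity
  have e2 : 0 ≤ n * (s - 1 + Real.exp (-s)) := mul_nonneg hn'.le (by linarith [Real.add_one_le_exp (-s)])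
  rcases le_total (2 / Real.log 2 * s) (δ - 0.04) with h1 | h1
  · have := h.case1 s hs hs1 h1; linarith
  rcases le_total s (1/2) with h2 | h2
  · have := h.case2a s hs hs1 h1 h2; linarith
  rcases le_total s 1.386 with h3 | h3
  · have := h.case2b s hs1 h2 (by linarith); linarith
  · have := h.case3 s hs1 h3; linarith
end TM

namespace TM
variable {n a : ℕ} {η δ : ℝ} {K : ℕ → ℝ} {k A B M : ℝ}

lemma sum_Icc_refl {β : Type*} [AddCommMonoid β] (a : ℕ) (f : ℕ → β) : ∑ u ∈ Finset.Icc 1 a, f u = ∑ i ∈ Finset.range a, f (a - i) := by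
  apply Finset.sum_bij' (fun u _ => a - u) (fun i _ => a - i)
  · intro u hu; rw [Finset.mem_Icc] at hu; rw [Finset.mem_range]; omega
  · intro u hu; rw [Finset.mem_range] at hu; rw [Finset.mem_Icc]; omega
  · intro u hu; rw [Finset.mem_Icc] at hu; omega
  · intro u hu; rw [Finset.mem_range] at hu; omega
  · intro u hu; rw [Finset.mem_Icc] at hu; congr 1; omega

lemma FH.Kd (h : FH n a η δ K k A B M) (i : ℕ) (hi : i < a) :
    K i * dcoef (a - i) = Real.exp (A + B * ((a:ℝ) - i)) := by
  rw [← h.prof.hlog i hi, Real.exp_add, Real.exp_log (h.prof.hK i hi), Real.exp_log (dcoef_pos _)]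

lemma FH.A_le (h : FH n a η δ K k A B M) : A ≤ -2 * Real.log n := by
  obtain ⟨hl, a1, a2, a3, hn, ha0, hsq⟩ := h.asy.basic h.η0 (by linarith [h.η1])
  obtain ⟨k1, k2, k3⟩ := k_bounds h.asy h.prof h.M0 h.M17 h.η0 h.η1
  have hη1 := h.η1
  have hk := h.prof.hkpos
  have hroot := h.prof.hroot
  have hB := (abs_le.1 h.prof.hB).1
  have hn' : (0:ℝ) < n := by positivity
  have hf : Real.log (n.factorial:ℝ) ≤ n * Real.log n := by
    rw [← Real.log_pow]
    apply Real.log_le_log (by positivity)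
    exact_mod_cast Nat.factorial_le_pow n
  set l := Real.log n
  have hl0 : 0 < l := by linarith
  have x1 : 2 * (η * l) ≤ 0.1 * l := by nlinarith
  have x2 : (1.9 * l) * n ≤ B * n := mul_le_mul_of_nonneg_right (by linarith) hn'.le
  have x3 : 1 * (n:ℝ) ≤ l * n := mul_le_mul_of_nonneg_right (by linarith) hn'.le
  have x4 : A * k ≤ (-2 * l) * k := by linarith
  exact le_of_mul_le_mul_right x4 hk

lemma FH.low (h : FH n a η δ K k A B M) (j : ℕ) (hj : (j:ℝ) + 1 ≤ k) : Enkt n j a ≤ Real.exp (-2 * Real.log n) := by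
  have hk := h.prof.hkpos
  have hfm := first_moment n j a (Real.exp B) (Real.exp_pos _)
  have hsum : ∑ u ∈ Finset.Icc 1 a, (Real.exp B)^u / dcoef u = Real.exp (-A) * k := by
    rw [sum_Icc_refl, ← h.prof.hk, Finset.mul_sum]
    apply Finset.sum_congr rfl
    intro i hi
    have hi' := Finset.mem_range.1 hi
    have := h.Kd i hi'
    rw [div_eq_iff (dcoef_pos _).ne', mul_assoc, this, ← Real.exp_add, ← Real.exp_nat_mul]
    congr 1
    rw [Nat.cast_sub hi'.le]; ring
  rw [hsum] at hfm
  have hfac : (0:ℝ) < j.factorial := by positivity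
  have hnf : (0:ℝ) < n.factorial := by positivity
  have h1 : Enkt n j a ≤ n.factorial * ((Real.exp B)⁻¹)^n * Real.exp (-A) ^ j * (k^j / j.factorial) := by
    rw [mul_div_assoc', le_div_iff₀ hfac]
    rw [mul_pow] at hfm
    linarith
  have h2 := Real.pow_div_factorial_le_exp k hk.le j
  have h3 : Enkt n j a ≤ n.factorial * ((Real.exp B)⁻¹)^n * Real.exp (-A) ^ j * Real.exp k :=
    h1.trans (mul_le_mul_of_nonneg_left h2 (by positivity))
  have h4 : n.factorial * ((Real.exp B)⁻¹)^n * Real.exp (-A) ^ j * Real.exp k = Real.exp (A * (k - j)) := by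
    rw [← Real.exp_neg, ← Real.exp_nat_mul, ← Real.exp_nat_mul]
    nth_rewrite 1 [← Real.exp_log hnf]
    rw [← Real.exp_add, ← Real.exp_add, ← Real.exp_add, ← h.prof.hroot]
    congr 1; ring
  rw [h4] at h3
  refine h3.trans (Real.exp_le_exp.2 ?_)
  have hA := h.A_le
  obtain ⟨hl, _⟩ := h.asy.basic h.η0 (by linarith [h.η1])
  nlinarith
end TM

namespace TM

lemma psi_step (x y : ℝ) (hx : 1 ≤ x) (hxy : x ≤ y) :
    Real.log x - 1 + 2 / Real.sqrt x ≤ Real.log y - 1 + 2 / Real.sqrt y := by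
  have hx0 : 0 < x := by linarith
  have hy0 : 0 < y := by linarith
  set p := Real.sqrt x with hp
  set q := Real.sqrt y with hq
  have hp1 : 1 ≤ p := by rw [hp]; exact Real.one_le_sqrt.2 hx
  have hpq : p ≤ q := Real.sqrt_le_sqrt hxy
  have ex : x = p^2 := (Real.sq_sqrt hx0.le).symm
  have ey : y = q^2 := (Real.sq_sqrt hy0.le).symm
  rw [ex, ey, Real.log_pow, Real.log_pow]
  have hp0 : 0 < p := by linarith
  have hq0 : 0 < q := by linarith
  have h1 := Real.one_sub_inv_le_log_of_pos (show 0 < q / p by positivity)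
  rw [Real.log_div hq0.ne' hp0.ne', inv_div] at h1
  have h2 : 2 / p - 2 / q ≤ 2 * (1 - p / q) := by
    have e1 : 2 / p - 2 / q = 2 * (1 - p / q) * (1 / p) := by field_simp
    rw [e1]
    apply mul_le_of_le_one_right
    · have : p / q ≤ 1 := (div_le_one hq0).2 hpq
      linarith
    · exact (div_le_one hp0).2 hp1
  push_cast
  linarith

lemma psi_nonneg (x : ℝ) (hx : 0 ≤ x) : 0 ≤ psi x := by
  unfold psi
  split_ifs with h
  · exact hx
  · have := psi_step 1 x le_rfl (by linarith)
    norm_num at this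
    linarith

lemma psi_mono (x y : ℝ) (hxy : x ≤ y) : psi x ≤ psi y := by
  unfold psi
  by_cases h1 : y ≤ 1
  · rw [if_pos h1, if_pos (hxy.trans h1)]; exact hxy
  · rw [if_neg h1]
    push Not at h1
    by_cases h2 : x ≤ 1
    · rw [if_pos h2]
      have := psi_step 1 y le_rfl h1.le
      norm_num at this
      linarith
    · rw [if_neg h2]
      exact psi_step x y (by linarith) hxy

lemma psi_le_self (x : ℝ) : psi x ≤ x := by
  unfold psi
  split_ifs with h
  · exact le_rfl
  · push Not at h
    have h1 := Real.log_le_sub_one_of_pos (show 0 < x by linarith)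
    have h2 : 2 / Real.sqrt x ≤ 2 := div_le_self (by norm_num) (Real.one_le_sqrt.2 h.le)
    linarith

lemma exists_sizes {ι : Type*} [Fintype ι] (n : ℕ) (v : ι → ℕ) (h : ∑ i, v i = n) :
    ∃ c : Fin n → ι, ∀ i, (fib c i).card = v i := by
  have e : Fin n ≃ (Σ i, Fin (v i)) := Fintype.equivOfCardEq (by simp [h])
  refine ⟨fun x => (e x).1, fun i => ?_⟩
  have : fib (fun x => (e x).1) i = (Finset.univ : Finset (Fin (v i))).map
      ⟨fun y => e.symm ⟨i, y⟩, fun y y' hy => by simpa using hy⟩ := by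
    ext x
    rw [mem_fib]
    simp only [Finset.mem_map, Finset.mem_univ, true_and]
    constructor
    · intro hx
      subst hx
      exact ⟨(e x).2, e.symm_apply_apply x⟩
    · rintro ⟨y, rfl⟩; exact congrArg Sigma.fst (e.apply_symm_apply ⟨i, y⟩)
  rw [this, Finset.card_map, Finset.card_univ, Fintype.card_fin]

lemma exists_profile_col (n a : ℕ) (κ : ℕ → ℕ) (h : ∑ i ∈ Finset.range a, (a - i) * κ i = n) :
    ∃ c : Fin n → (Σ i : Fin a, Fin (κ i)), (∀ p, (fib c p).card = a - p.1) ∧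
      ∀ i < a, KK (fun p => (fib c p).card) Finset.univ (a - i) = κ i := by
  obtain ⟨c, hc⟩ := exists_sizes (ι := Σ i : Fin a, Fin (κ i)) n (fun p => a - p.1) (by
    rw [← h, Fintype.sum_sigma, Finset.sum_range]
    exact Finset.sum_congr rfl fun i _ => by simp [mul_comm])
  refine ⟨c, hc, fun i hi => ?_⟩
  unfold KK
  simp_rw [hc]
  have : (Finset.univ.filter fun p : (Σ i : Fin a, Fin (κ i)) => a - (p.1:ℕ) = a - i) =
      (Finset.univ : Finset (Fin (κ i))).map ⟨fun y => (⟨⟨i, hi⟩, y⟩ : Σ i : Fin a, Fin (κ i)), fun y y' hy => by simpa using hy⟩ := by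
    ext ⟨⟨j, hj⟩, y⟩
    simp only [Finset.mem_map, Finset.mem_univ, true_and, Finset.mem_filter]
    constructor
    · intro hx
      have : j = i := by omega
      subst this
      exact ⟨y, rfl⟩
    · rintro ⟨y', hy⟩
      have := congrArg (fun p : (Σ i : Fin a, Fin (κ i)) => (p.1:ℕ)) hy
      have this : i = j := this
      rw [this]
  rw [this, Finset.card_map, Finset.card_univ, Fintype.card_fin]

lemma pr_col_le {n : ℕ} {ι : Type*} [Fintype ι] (c : Fin n → ι) (a : ℕ) (hc : ∀ i, (fib c i).card ≤ a) :
    pr (fun x : Om n => ∃ σ : Equiv.Perm (Fin n), Proper x (c ∘ σ)) ≤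
      pr (fun x : Om n => chiBounded (gr x) a ≤ Fintype.card ι) := by
  apply pr_mono
  rintro x ⟨σ, hσ⟩
  apply chi_le
  rw [hasBounded_iff]
  let e := Fintype.equivFin ι
  refine ⟨fun v => e (c (σ v)), fun v w h hvw => hσ v w h (e.injective hvw), fun j => ?_⟩
  refine le_trans (le_of_eq ?_) (hc (e.symm j))
  apply Finset.card_bij (fun x _ => σ x)
  · intro y hy; rw [mem_fib] at hy ⊢; rw [← hy]; simp
  · intro y _ y' _ h; exact σ.injective h
  · intro y hy
    rw [mem_fib] at hy
    exact ⟨σ.symm y, by rw [mem_fib]; simp [hy], by simp⟩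

lemma hm_lemma {n : ℕ} {ι : Type*} [Fintype ι] (c : Fin n → ι) (ρ m0 : ℕ) (hρ : 2 ≤ ρ)
    (h : m0 ≤ KK (fun p => (fib c p).card) Finset.univ 1) :
    ∑ i ∈ Finset.univ.filter (fun i => ρ ≤ (fib c i).card), (fib c i).card + m0 ≤ n := by
  have h1 : KK (fun p => (fib c p).card) Finset.univ 1 = ∑ i ∈ Finset.univ.filter (fun i => (fib c i).card = 1), (fib c i).card := by
    unfold KK
    rw [Finset.card_eq_sum_ones]
    exact Finset.sum_congr rfl fun i hi => by rw [(Finset.mem_filter.1 hi).2]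
  have h2 : Disjoint (Finset.univ.filter (fun i => ρ ≤ (fib c i).card)) (Finset.univ.filter (fun i => (fib c i).card = 1)) := by
    rw [Finset.disjoint_left]
    intro i hi hi'
    have := (Finset.mem_filter.1 hi).2
    have := (Finset.mem_filter.1 hi').2
    omega
  calc _ ≤ ∑ i ∈ Finset.univ.filter (fun i => ρ ≤ (fib c i).card), (fib c i).card + ∑ i ∈ Finset.univ.filter (fun i => (fib c i).card = 1), (fib c i).card := by rw [← h1]; exact Nat.add_le_add_left h _
    _ = ∑ i ∈ _, (fib c i).card := (Finset.sum_union h2).symm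
    _ ≤ ∑ i, (fib c i).card := Finset.sum_le_sum_of_subset (Finset.subset_univ _)
    _ = n := sum_fib c
end TM

namespace TM
variable {n a : ℕ} {η δ : ℝ} {K : ℕ → ℝ} {k A B M : ℝ}

lemma wt_le (u u' t a : ℕ) (hu : u ≤ a) (hu' : u' ≤ a) : wt u u' t ≤ (a:ℝ)^t * (a:ℝ)^t * 2^t.choose 2 := by
  unfold wt
  have h1 : (u.choose t : ℝ) ≤ (a:ℝ)^t := by
    have : u.choose t ≤ u^t := Nat.choose_le_pow u t
    exact_mod_cast this.trans (Nat.pow_le_pow_left hu t)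
  have h2 : (u'.choose t : ℝ) * t.factorial ≤ (a:ℝ)^t := by
    have : t.factorial * u'.choose t ≤ u'^t := by
      rw [← Nat.descFactorial_eq_factorial_mul_choose]; exact Nat.descFactorial_le_pow u' t
    have := this.trans (Nat.pow_le_pow_left hu' t)
    rw [mul_comm] at this
    exact_mod_cast this
  rw [mul_assoc (u.choose t : ℝ)]
  gcongr

/-- collected numeric facts -/
lemma FH.num (h : FH n a η δ K k A B M) : (a:ℝ) ≤ Real.exp (0.000000001 * Real.log n) ∧ Real.log n ≤ Real.exp (0.000000001 * Real.log n)
    ∧ (n:ℝ) = Real.exp (Real.log n) := by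
  obtain ⟨hl, a1, a2, a3, hn, ha0, hsq⟩ := h.asy.basic h.η0 (by linarith [h.η1])
  have h1 : Real.log a ≤ 0.000000001 * Real.log n := h.asy.hloga.trans (mul_le_mul_of_nonneg_right h.η1 (by linarith))
  have h2 : (a:ℝ) ≤ Real.exp (0.000000001 * Real.log n) := by
    rw [← Real.log_le_iff_le_exp (by positivity)]; exact h1
  refine ⟨h2, by linarith, (Real.exp_log (by positivity)).symm⟩

lemma FH.small_term (h : FH n a η δ K k A B M) (u u' t ρ m0 : ℕ) (hu : u ≤ a) (hu' : u' ≤ a)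
    (hm0 : Real.exp (0.97 * Real.log n) ≤ m0) (hρ : (ρ:ℝ) ≤ 0.8 * a + 1) (ht : 2 ≤ t) (htρ : t < ρ) :
    wt u u' t * (Real.exp 1 / m0)^t ≤ Real.exp (-1.65 * Real.log n) := by
  obtain ⟨hl, a1, a2, a3, hn, ha0, hsq⟩ := h.asy.basic h.η0 (by linarith [h.η1])
  obtain ⟨n1, n2, n3⟩ := h.num
  obtain ⟨L1, L2⟩ := l2bd
  set l := Real.log n
  set L := Real.log 2 with hL
  have hm0pos : (0:ℝ) < m0 := lt_of_lt_of_le (Real.exp_pos _) hm0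
  have h1 : Real.exp 1 / m0 ≤ Real.exp (1 - 0.97 * l) := by
    rw [Real.exp_sub]
    exact div_le_div_of_nonneg_left (Real.exp_pos _).le (Real.exp_pos _) hm0
  have h2 : (2:ℝ)^t.choose 2 = Real.exp (L * (t * (t-1) / 2)) := by
    rw [← Nat.cast_choose_two, mul_comm, Real.exp_nat_mul, hL, Real.exp_log (by norm_num)]
  have ht' : (2:ℝ) ≤ t := by exact_mod_cast ht
  have htρ' : (t:ℝ) + 1 ≤ ρ := by exact_mod_cast htρ
  calc wt u u' t * (Real.exp 1 / m0)^t ≤ ((a:ℝ)^t * (a:ℝ)^t * 2^t.choose 2) * (Real.exp (1 - 0.97 * l))^t := by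
        apply mul_le_mul (wt_le u u' t a hu hu') _ (by positivity) (by positivity)
        exact pow_le_pow_left₀ (by positivity) h1 t
    _ ≤ ((Real.exp (0.000000001 * l))^t * (Real.exp (0.000000001 * l))^t * 2^t.choose 2) * (Real.exp (1 - 0.97 * l))^t := by
        have := pow_le_pow_left₀ (by positivity) n1 t
        gcongr
    _ = Real.exp (t * (0.000000002 * l + L * (t-1) / 2 + 1 - 0.97 * l)) := by
        rw [h2, ← Real.exp_nat_mul, ← Real.exp_nat_mul, ← Real.exp_add, ← Real.exp_add, ← Real.exp_add]
        congr 1; ring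
    _ ≤ _ := by
        apply Real.exp_le_exp.2
        rcases le_total t 10 with h10 | h10
        · have h10' : (t:ℝ) ≤ 10 := by exact_mod_cast h10
          have x1 : 0.000000002 * l + L * (t-1) / 2 + 1 - 0.97 * l ≤ -0.96 * l := by nlinarith
          have x2 := mul_le_mul_of_nonneg_left x1 (by linarith : (0:ℝ) ≤ t)
          nlinarith
        · have h10' : (10:ℝ) ≤ t := by exact_mod_cast h10
          have x0 : L * (t - 1) ≤ 0.6932 * (0.8 * (2.89 * l)) := mul_le_mul L2.le (by linarith) (by linarith) (by norm_num)
          have x1 : 0.000000002 * l + L * (t-1) / 2 + 1 - 0.97 * l ≤ -0.165 * l := by linarith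
          have x2 := mul_le_mul_of_nonneg_left x1 (by linarith : (0:ℝ) ≤ t)
          nlinarith

lemma FH.small_cell (h : FH n a η δ K k A B M) (u u' ρ m0 : ℕ) (hu : u ≤ a) (hu' : u' ≤ a)
    (hm0 : Real.exp (0.97 * Real.log n) ≤ m0) (hρ : (ρ:ℝ) ≤ 0.8 * a + 1) :
    ∑ t ∈ smallSet ρ, wt u u' t * (Real.exp 1 / m0)^t ≤ Real.exp (Real.exp (-1.6 * Real.log n)) := by
  obtain ⟨hl, a1, a2, a3, hn, ha0, hsq⟩ := h.asy.basic h.η0 (by linarith [h.η1])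
  obtain ⟨n1, n2, n3⟩ := h.num
  set l := Real.log n
  unfold smallSet
  rw [Finset.sum_insert (by simp)]
  rw [wt_zero, pow_zero, mul_one]
  have h1 : ∑ t ∈ Finset.Ico 2 ρ, wt u u' t * (Real.exp 1 / m0)^t ≤ (Finset.Ico 2 ρ).card • Real.exp (-1.65 * l) := by
    apply Finset.sum_le_card_nsmul
    intro t ht
    rw [Finset.mem_Ico] at ht
    exact h.small_term u u' t ρ m0 hu hu' hm0 hρ ht.1 ht.2
  have h2 : ((Finset.Ico 2 ρ).card : ℝ) ≤ a := by
    rw [Nat.card_Ico]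
    have : ρ - 2 ≤ a := by
      have : (ρ:ℝ) ≤ (a + 1 : ℕ) := by push_cast; linarith
      have : ρ ≤ a + 1 := by exact_mod_cast this
      omega
    exact_mod_cast this
  have h3 : (a:ℝ) * Real.exp (-1.65 * l) ≤ Real.exp (-1.6 * l) := by
    calc (a:ℝ) * Real.exp (-1.65 * l) ≤ Real.exp (0.000000001 * l) * Real.exp (-1.65 * l) := by gcongr
      _ = Real.exp (0.000000001 * l + -1.65 * l) := (Real.exp_add _ _).symm
      _ ≤ _ := Real.exp_le_exp.2 (by linarith)
  rw [nsmul_eq_mul] at h1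
  have h4 := mul_le_mul_of_nonneg_right h2 (Real.exp_pos (-1.65 * l)).le
  have := Real.add_one_le_exp (Real.exp (-1.6 * l))
  linarith

lemma FH.small {ι : Type*} [Fintype ι] (h : FH n a η δ K k A B M) (c : Fin n → ι) (hv : ∀ i, (fib c i).card ∈ Finset.Icc 1 a) (ρ m0 : ℕ)
    (hm0 : Real.exp (0.97 * Real.log n) ≤ m0) (hρ : (ρ:ℝ) ≤ 0.8 * a + 1) :
    ∏ p : ι × ι, ∑ t ∈ smallSet ρ, wt (fib c p.1).card (fib c p.2).card t * (Real.exp 1 / m0)^t ≤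
      Real.exp (Real.exp (0.4 * Real.log n)) := by
  have hcard : Fintype.card ι ≤ n := by
    rw [← sum_fib c, ← Finset.card_univ, Finset.card_eq_sum_ones]
    exact Finset.sum_le_sum fun i _ => (Finset.mem_Icc.1 (hv i)).1
  have hc' : (Fintype.card ι : ℝ) ≤ n := by exact_mod_cast hcard
  obtain ⟨n1, n2, n3⟩ := h.num
  set l := Real.log n
  calc _ ≤ ∏ p : ι × ι, Real.exp (Real.exp (-1.6 * l)) := by
        apply Finset.prod_le_prod
        · intro p _
          exact Finset.sum_nonneg fun t _ => mul_nonneg (wt_nonneg _ _ _) (by positivity)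
        · intro p _
          exact h.small_cell _ _ ρ m0 (Finset.mem_Icc.1 (hv _)).2 (Finset.mem_Icc.1 (hv _)).2 hm0 hρ
    _ = Real.exp ((Fintype.card ι * Fintype.card ι : ℝ) * Real.exp (-1.6 * l)) := by
        rw [Finset.prod_const, Finset.card_univ, Fintype.card_prod, ← Real.exp_nat_mul]
        push_cast; rfl
    _ ≤ Real.exp ((n * n : ℝ) * Real.exp (-1.6 * l)) := by
        apply Real.exp_le_exp.2
        gcongr
    _ = _ := by
        rw [n3, ← Real.exp_add, ← Real.exp_add]
        have : Real.log (Real.exp l) = l := Real.log_exp l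
        congr 2; ring
end TM

namespace TM
variable {n a : ℕ} {η δ : ℝ} {K : ℕ → ℝ} {k A B M : ℝ}

lemma FH.phi_sum (h : FH n a η δ K k A B M) (κ : ℕ → ℕ) (m0 m : ℕ) (hκ : ∀ i < a, i ≠ a - 1 → (κ i : ℝ) ≤ K i)
    (hκ1 : (κ (a-1) : ℝ) ≤ 2 * m0) (hm0 : Real.exp (0.97 * Real.log n) ≤ m0)
    (hm : m0 ≤ m) (hmn : m ≤ n) :
    ∑ i ∈ Finset.range a, (κ i : ℝ) * psi (κ i * (dcoef (a-i) * ((m:ℝ)⁻¹)^(a-i))) ≤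
      n * ((Real.log n - Real.log m) - 1 + Real.exp (-(Real.log n - Real.log m))) + n * Real.exp (-0.035 * Real.log n) + 1 + Real.log n + 4 * m0 := by
  obtain ⟨hl, a1, a2, a3, hn, ha0, hsq⟩ := h.asy.basic h.η0 (by linarith [h.η1])
  have hm0pos : (0:ℝ) < m0 := lt_of_lt_of_le (Real.exp_pos _) hm0
  have hm' : (m0:ℝ) ≤ m := by exact_mod_cast hm
  have hmn' : (m:ℝ) ≤ n := by exact_mod_cast hmn
  have hmpos : (0:ℝ) < m := by linarith
  have s0 : 0 ≤ Real.log n - Real.log m := by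
    have := Real.log_le_log hmpos hmn'
    linarith
  have s1 : Real.log n - Real.log m ≤ 0.031 * Real.log n := by
    have : 0.97 * Real.log n ≤ Real.log m := (Real.le_log_iff_exp_le hmpos).2 (hm0.trans hm')
    linarith
  have hfin := h.final _ s0 s1
  rw [show Real.log n - (Real.log n - Real.log m) = Real.log m by ring] at hfin
  have hkey : ∀ i < a, K i * (dcoef (a-i) * ((m:ℝ)⁻¹)^(a-i)) = Real.exp (TT a A B (Real.log m) i) := by
    intro i hi
    rw [← mul_assoc, h.Kd i hi, TT, Real.exp_sub, inv_pow, div_eq_mul_inv]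
    congr 2
    rw [← Nat.cast_sub hi.le, Real.exp_nat_mul, Real.exp_log hmpos]
  have hterm : ∀ i ∈ Finset.range a, (κ i : ℝ) * psi (κ i * (dcoef (a-i) * ((m:ℝ)⁻¹)^(a-i))) ≤
      K i * psi (Real.exp (TT a A B (Real.log m) i)) + if i = a - 1 then 4 * (m0:ℝ) else 0 := by
    intro i hi
    have hi' := Finset.mem_range.1 hi
    have hd := dcoef_pos (a - i)
    have hpos : 0 ≤ K i * psi (Real.exp (TT a A B (Real.log m) i)) :=
      mul_nonneg (h.prof.hK i hi').le (psi_nonneg _ (Real.exp_pos _).le)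
    by_cases hc : i = a - 1
    · rw [if_pos hc]
      have e1 : a - i = 1 := by omega
      rw [e1]
      have e2 : dcoef 1 = 1 := by norm_num [dcoef]
      rw [e2, one_mul, pow_one, hc]
      rw [hc] at hpos
      have x1 : (κ (a-1) : ℝ) * psi (κ (a-1) * (m:ℝ)⁻¹) ≤ κ (a-1) * (κ (a-1) * (m:ℝ)⁻¹) :=
        mul_le_mul_of_nonneg_left (psi_le_self _) (by positivity)
      have x2 : (κ (a-1) : ℝ) * (κ (a-1) * (m:ℝ)⁻¹) ≤ 4 * m0 := by
        rw [← mul_assoc, ← div_eq_mul_inv, div_le_iff₀ hmpos]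
        have y1 := mul_le_mul hκ1 hκ1 (by positivity) (by positivity)
        have y2 := mul_le_mul_of_nonneg_left hm' hm0pos.le
        linarith
      linarith
    · rw [if_neg hc, add_zero, ← hkey i hi']
      have x1 := hκ i hi' hc
      apply mul_le_mul x1 (psi_mono _ _ _) (psi_nonneg _ (by positivity)) (h.prof.hK i hi').le
      exact mul_le_mul_of_nonneg_right x1 (by positivity)
  refine (Finset.sum_le_sum hterm).trans ?_
  rw [Finset.sum_add_distrib, Finset.sum_ite_eq' (Finset.range a) (a-1), if_pos (Finset.mem_range.2 (by omega))]
  linarith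

lemma FH.phi (h : FH n a η δ K k A B M) (κ : ℕ → ℕ) (m0 m : ℕ) (hκ : ∀ i < a, i ≠ a - 1 → (κ i : ℝ) ≤ K i)
    (hκ1 : (κ (a-1) : ℝ) ≤ 2 * m0) (hm0 : Real.exp (0.97 * Real.log n) ≤ m0) (hm0' : (m0:ℝ) ≤ 2 * Real.exp (0.97 * Real.log n))
    (hm : m0 ≤ m) (hmn : m ≤ n) :
    ((m.factorial : ℝ) * (m:ℝ)^(n-m)) * Real.exp (∑ i ∈ Finset.range a, (κ i : ℝ) * psi (κ i * (dcoef (a-i) * ((m:ℝ)⁻¹)^(a-i)))) ≤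
      n.factorial * Real.exp (10 * Real.exp (0.97 * Real.log n)) := by
  have hs := h.phi_sum κ m0 m hκ hκ1 hm0 hm hmn
  obtain ⟨hl, a1, a2, a3, hn, ha0, hsq⟩ := h.asy.basic h.η0 (by linarith [h.η1])
  obtain ⟨n1, n2, n3⟩ := h.num
  set Sg := ∑ i ∈ Finset.range a, (κ i : ℝ) * psi (κ i * (dcoef (a-i) * ((m:ℝ)⁻¹)^(a-i)))
  have hm0pos : (0:ℝ) < m0 := lt_of_lt_of_le (Real.exp_pos _) hm0
  have hm' : (m0:ℝ) ≤ m := by exact_mod_cast hm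
  have hmn' : (m:ℝ) ≤ n := by exact_mod_cast hmn
  have hmpos : (0:ℝ) < m := by linarith
  have hnpos : (0:ℝ) < n := by linarith
  have hmN : 0 < m := by exact_mod_cast hmpos
  have f1 := log_fact_le m hmN
  have f2 := fact_lower n hn
  have hmf : (0:ℝ) < m.factorial := by positivity
  have hnf : (0:ℝ) < n.factorial := by positivity
  rw [← Real.log_le_log_iff (by positivity) (by positivity), Real.log_mul (by positivity) (Real.exp_pos _).ne',
    Real.log_mul (by positivity) (by positivity), Real.log_mul (by positivity) (Real.exp_pos _).ne', Real.log_exp, Real.log_exp,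
    Real.log_pow, Nat.cast_sub hmn]
  have e1 : (n:ℝ) * Real.exp (-(Real.log n - Real.log m)) = m := by
    rw [neg_sub, Real.exp_sub, Real.exp_log hmpos, Real.exp_log hnpos]; field_simp
  have e2 : (n:ℝ) * Real.exp (-0.035 * Real.log n) ≤ Real.exp (0.97 * Real.log n) := by
    nth_rewrite 1 [n3]
    rw [← Real.exp_add]
    exact Real.exp_le_exp.2 (by linarith)
  have e3 : 2 + 2 * Real.log n ≤ Real.exp (0.97 * Real.log n) := by
    have x1 : Real.exp (0.000000001 * Real.log n) * (0.9 * Real.log n) ≤ Real.exp (0.97 * Real.log n) := by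
      have : Real.exp (0.97 * Real.log n) = Real.exp (0.000000001 * Real.log n) * Real.exp ((0.97 - 0.000000001) * Real.log n) := by
        rw [← Real.exp_add]; congr 1; ring
      rw [this]
      apply mul_le_mul_of_nonneg_left _ (Real.exp_pos _).le
      have := Real.add_one_le_exp ((0.97 - 0.000000001) * Real.log n)
      linarith
    have x2 : Real.exp (0.000000001 * Real.log n) * 3 ≤ Real.exp (0.000000001 * Real.log n) * (0.9 * Real.log n) :=
      mul_le_mul_of_nonneg_left (by linarith) (Real.exp_pos _).le
    linarith
  have hlm : Real.log m ≤ Real.log n := Real.log_le_log hmpos hmn'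
  have e4 : (n:ℝ) * (Real.log n - Real.log m - 1 + Real.exp (-(Real.log n - Real.log m))) = n * Real.log n - n * Real.log m - n + m := by
    rw [mul_add, e1]; ring
  rw [e4] at hs
  have e5 : ((n:ℝ) - m) * Real.log m = n * Real.log m - m * Real.log m := by ring
  linarith
end TM

namespace TM
variable {n a : ℕ} {η δ : ℝ} {K : ℕ → ℝ} {k A B M : ℝ}

lemma FH.a_sq (h : FH n a η δ K k A B M) : (a:ℝ) * a ≤ Real.exp (0.000000002 * Real.log n) := by
  obtain ⟨n1, n2, n3⟩ := h.num
  calc (a:ℝ) * a ≤ Real.exp (0.000000001 * Real.log n) * Real.exp (0.000000001 * Real.log n) := by gcongr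
    _ = _ := by rw [← Real.exp_add]; congr 1; ring

lemma FH.profile (h : FH n a η δ K k A B M) : ∃ (κ : ℕ → ℕ) (m0 : ℕ),
    (∑ i ∈ Finset.range a, (a - i) * κ i = n) ∧ (∀ i < a, i ≠ a - 1 → (κ i : ℝ) ≤ K i) ∧
    (κ (a-1) : ℝ) ≤ 2 * m0 ∧ m0 ≤ κ (a-1) ∧ Real.exp (0.97 * Real.log n) ≤ m0 ∧ (m0:ℝ) ≤ 2 * Real.exp (0.97 * Real.log n) ∧
    ((∑ i ∈ Finset.range a, κ i : ℕ) : ℝ) ≤ k + 2 * Real.exp (0.97 * Real.log n) := by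
  obtain ⟨hl, a1, a2, a3, hn, ha0, hsq⟩ := h.asy.basic h.η0 (by linarith [h.η1])
  obtain ⟨n1, n2, n3⟩ := h.num
  have haa := h.a_sq
  have hnpos : (0:ℝ) < n := by positivity
  set l := Real.log n with hldef
  set E := Real.exp (0.97 * l) with hE
  have hEpos : 0 < E := Real.exp_pos _
  set ν := Real.exp (-0.03 * l) with hν
  have hν0 : 0 < ν := Real.exp_pos _
  have hν1 : ν ≤ 1 := Real.exp_le_one_iff.2 (by linarith)
  have hνn : ν * n = E := by
    rw [n3, hν, ← Real.exp_add, hE]; congr 1; ring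
  have haE : (a:ℝ) * a ≤ E := haa.trans (Real.exp_le_exp.2 (by linarith))
  have hKpos := h.prof.hK
  let κ0 : ℕ → ℕ := fun i => ⌊(1-ν) * K i⌋₊
  have hκ0 : ∀ i < a, (κ0 i : ℝ) ≤ (1-ν) * K i := fun i hi =>
    Nat.floor_le (mul_nonneg (by linarith) (hKpos i hi).le)
  have hκ0' : ∀ i, (1-ν) * K i - 1 ≤ κ0 i := fun i => by
    have := Nat.lt_floor_add_one ((1-ν) * K i)
    show _ ≤ (⌊(1-ν) * K i⌋₊ : ℝ)
    linarith
  have hkapK : ∀ i < a, (κ0 i : ℝ) ≤ K i := fun i hi => by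
    have := hκ0 i hi
    have := mul_pos hν0 (hKpos i hi)
    linarith
  set P := ∑ i ∈ Finset.range a, (a - i) * κ0 i with hP
  have hPr : (P:ℝ) = ∑ i ∈ Finset.range a, ((a:ℝ) - i) * κ0 i := by
    rw [hP]; push_cast
    exact Finset.sum_congr rfl fun i hi => by rw [Nat.cast_sub (Finset.mem_range.1 hi).le]
  have hsumK : ∑ i ∈ Finset.range a, ((a:ℝ) - i) * ((1-ν) * K i) = (1-ν) * n := by
    rw [← h.prof.hn]
    have e : ((a:ℝ) - M) * k = a * ∑ i ∈ Finset.range a, K i - ∑ i ∈ Finset.range a, (i:ℝ) * K i := by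
      rw [h.prof.hk, h.prof.hM]; ring
    rw [e, Finset.mul_sum, ← Finset.sum_sub_distrib, Finset.mul_sum]
    exact Finset.sum_congr rfl fun i _ => by ring
  have hP1 : (P:ℝ) ≤ n - E := by
    have : (P:ℝ) ≤ (1-ν) * n := by
      rw [hPr, ← hsumK]
      apply Finset.sum_le_sum
      intro i hi
      have hi' := Finset.mem_range.1 hi
      have : (i:ℝ) ≤ a := by exact_mod_cast hi'.le
      exact mul_le_mul_of_nonneg_left (hκ0 i hi') (by linarith)
    linarith
  have hP2 : (n:ℝ) - E - a * a ≤ P := by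
    have : (1-ν) * n - a * a ≤ (P:ℝ) := by
      rw [hPr, ← hsumK]
      have e : (a:ℝ) * a = ∑ i ∈ Finset.range a, (a:ℝ) := by rw [Finset.sum_const, Finset.card_range, nsmul_eq_mul]
      rw [e, ← Finset.sum_sub_distrib]
      apply Finset.sum_le_sum
      intro i hi
      have hi' := Finset.mem_range.1 hi
      have h1 : (i:ℝ) ≤ a := by exact_mod_cast hi'.le
      have h2 := mul_le_mul_of_nonneg_left (hκ0' i) (by linarith : (0:ℝ) ≤ a - i)
      have h3 : (0:ℝ) ≤ i := by positivity
      linarith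
    linarith
  have hPn : P ≤ n := by
    have : (P:ℝ) ≤ n := by linarith
    exact_mod_cast this
  have hm0r : ((n - P : ℕ) : ℝ) = n - P := Nat.cast_sub hPn
  have hmem : a - 1 ∈ Finset.range a := Finset.mem_range.2 (by omega)
  have hKa : K (a-1) ≤ E := by
    have := h.Kd (a-1) (by omega)
    rw [show a - (a-1) = 1 by omega, show dcoef 1 = 1 by norm_num [dcoef], mul_one, Nat.cast_sub (by omega)] at this
    rw [this]
    apply Real.exp_le_exp.2
    have hA := h.A_le
    have hB := (abs_le.1 h.prof.hB).2
    have hη := mul_le_mul_of_nonneg_right h.η1 (by linarith : 0 ≤ l)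
    push_cast
    rw [show (a:ℝ) - (a - 1) = 1 by ring]
    linarith
  refine ⟨fun i => κ0 i + if i = a - 1 then n - P else 0, n - P, ?_, ?_, ?_, ?_, ?_, ?_, ?_⟩
  · simp_rw [mul_add, Finset.sum_add_distrib]
    rw [← hP]
    have : ∑ i ∈ Finset.range a, (a - i) * (if i = a - 1 then n - P else 0) = n - P := by
      rw [Finset.sum_eq_single_of_mem (a-1) hmem]
      · rw [if_pos rfl, show a - (a-1) = 1 by omega, one_mul]
      · intro i _ hi; rw [if_neg hi, mul_zero]
    rw [this]; omega
  · intro i hi hi'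
    show ((κ0 i + if i = a - 1 then n - P else 0 : ℕ) : ℝ) ≤ _
    rw [if_neg hi', add_zero]; exact hkapK i hi
  · show ((κ0 (a-1) + if a - 1 = a - 1 then n - P else 0 : ℕ) : ℝ) ≤ _
    rw [if_pos rfl, Nat.cast_add, hm0r]
    have := hkapK (a-1) (by omega)
    linarith
  · show n - P ≤ κ0 (a-1) + if a - 1 = a - 1 then n - P else 0
    rw [if_pos rfl]; omega
  · rw [hm0r]; linarith
  · rw [hm0r]; linarith
  · rw [Finset.sum_add_distrib, Finset.sum_ite_eq' (Finset.range a) (a-1), if_pos hmem, Nat.cast_add, hm0r, Nat.cast_sum]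
    have : ∑ i ∈ Finset.range a, (κ0 i : ℝ) ≤ k := by
      rw [← h.prof.hk]
      exact Finset.sum_le_sum fun i hi => hkapK i (Finset.mem_range.1 hi)
    linarith

lemma FH.high (h : FH n a η δ K k A B M) : ∃ Kc : ℕ, (Kc : ℝ) ≤ k + 2 * Real.exp (0.97 * Real.log n) ∧
    Real.exp (-20 * Real.exp (0.97 * Real.log n)) ≤ pr (fun x : Om n => chiBounded (gr x) a ≤ Kc) := by
  obtain ⟨κ, m0, p1, p2, p3, p4, p5, p6, p7⟩ := h.profile
  obtain ⟨c, hc1, hc2⟩ := exists_profile_col n a κ p1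
  obtain ⟨hl, a1, a2, a3, hn, ha0, hsq⟩ := h.asy.basic h.η0 (by linarith [h.η1])
  obtain ⟨n1, n2, n3⟩ := h.num
  have haa := h.a_sq
  obtain ⟨L1, L2⟩ := l2bd
  have hcard : Fintype.card (Σ i : Fin a, Fin (κ i)) = ∑ i ∈ Finset.range a, κ i := by
    rw [Fintype.card_sigma, Finset.sum_range]; simp
  have hv : ∀ p, (fib c p).card ∈ Finset.Icc 1 a := by
    intro p
    have := p.1.2
    rw [hc1, Finset.mem_Icc]; omega
  set ρ := ⌈0.8 * (a:ℝ)⌉₊ with hρ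
  have hρ1 : 0.8 * (a:ℝ) ≤ ρ := Nat.le_ceil _
  have hρ2 : (ρ:ℝ) ≤ 0.8 * a + 1 := (Nat.ceil_lt_add_one (by positivity)).le
  have hρ3 : a < 2 * ρ := by
    have : (a:ℝ) < (2 * ρ : ℕ) := by push_cast; linarith
    exact_mod_cast this
  have hρ4 : 2 ≤ ρ := by
    have : ((2:ℕ):ℝ) ≤ ρ := by push_cast; linarith
    exact_mod_cast this
  have hm0pos : 0 < m0 := by
    have : (0:ℝ) < m0 := lt_of_lt_of_le (Real.exp_pos _) p5
    exact_mod_cast this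
  have hm := hm_lemma c ρ m0 hρ4 (by
    have := hc2 (a-1) (by omega)
    rw [show a - (a-1) = 1 by omega] at this
    rw [this]; exact p4)
  have hS := h.small c hv ρ m0 p5 hρ2
  set l := Real.log n with hldef
  have he : (a:ℝ)^2 * n ≤ Real.exp (-0.59 * l) * 2^ρ := by
    have x1 : (2:ℝ)^ρ = Real.exp (ρ * Real.log 2) := by rw [Real.exp_nat_mul, Real.exp_log (by norm_num)]
    rw [x1, ← Real.exp_add, sq]
    calc (a:ℝ) * a * n ≤ Real.exp (0.000000002 * l) * Real.exp l := by
          have : (n:ℝ) ≤ Real.exp l := n3.le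
          gcongr
      _ = Real.exp (0.000000002 * l + l) := (Real.exp_add _ _).symm
      _ ≤ _ := by
          apply Real.exp_le_exp.2
          have := mul_le_mul (by linarith : 0.8 * (2.88 * l) ≤ ρ) L1.le (by norm_num) (by positivity)
          linarith
  have hmain := second_moment_profile hn c a ρ m0 hρ3 (by omega) hm0pos hv hm (Real.exp (-0.59 * l)) (Real.exp_pos _).le
    (Real.exp_le_one_iff.2 (by linarith)) he _ (Real.exp (10 * Real.exp (0.97 * l))) (Real.exp_pos _).le hS (by
      intro m hmm
      rw [Finset.mem_Icc] at hmm
      have := h.phi κ m0 m p2 p3 p5 p6 hmm.1 hmm.2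
      rw [sum_Icc_refl]
      have e : ∑ i ∈ Finset.range a, ((KK (fun i => (fib c i).card) Finset.univ (a-i) : ℝ) *
        psi (KK (fun i => (fib c i).card) Finset.univ (a-i) * (dcoef (a-i) * ((m:ℝ)⁻¹)^(a-i)))) =
        ∑ i ∈ Finset.range a, (κ i : ℝ) * psi (κ i * (dcoef (a-i) * ((m:ℝ)⁻¹)^(a-i))) := by
          apply Finset.sum_congr rfl
          intro i hi
          rw [hc2 i (Finset.mem_range.1 hi)]
      rw [e]; exact this)
  refine ⟨Fintype.card (Σ i : Fin a, Fin (κ i)), by rw [hcard]; exact p7, ?_⟩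
  have hpr := pr_col_le c a (fun i => (Finset.mem_Icc.1 (hv i)).2)
  refine le_trans ?_ hpr
  set p := pr (fun x : Om n => ∃ σ : Equiv.Perm (Fin n), Proper x (c ∘ σ)) with hp
  have hp0 : 0 ≤ p := pr_nonneg _
  set E := Real.exp (0.97 * l) with hE
  have hsqrt : Real.sqrt (Real.exp (-0.59 * l)) = Real.exp (-0.295 * l) := by
    rw [← Real.exp_half]; congr 1; ring
  rw [hsqrt] at hmain
  have hY : Real.exp (Real.exp (0.4 * l)) * (n * (Real.exp (10 * E) * Real.exp (a * (2 * l + 2) + a * Real.exp (-0.295 * l) * (a * n)))) ≤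
      Real.exp (20 * E) := by
    have : (n:ℝ) ≤ Real.exp l := n3.le
    calc _ ≤ Real.exp (Real.exp (0.4 * l)) * (Real.exp l * (Real.exp (10 * E) * Real.exp (a * (2 * l + 2) + a * Real.exp (-0.295 * l) * (a * n)))) := by
          gcongr
      _ = Real.exp (Real.exp (0.4 * l) + (l + (10 * E + (a * (2 * l + 2) + a * Real.exp (-0.295 * l) * (a * n))))) := by
          simp only [Real.exp_add]
      _ ≤ _ := by
          apply Real.exp_le_exp.2
          have y1 : Real.exp (0.4 * l) ≤ E := Real.exp_le_exp.2 (by linarith)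
          have y2 : l ≤ E := n2.trans (Real.exp_le_exp.2 (by linarith))
          have y3 : (a:ℝ) * (2 * l + 2) ≤ E := by
            have z1 : (a:ℝ) * (2 * l + 2) ≤ a * a := mul_le_mul_of_nonneg_left (by linarith) (by positivity)
            exact z1.trans (haa.trans (Real.exp_le_exp.2 (by linarith)))
          have y4 : (a:ℝ) * Real.exp (-0.295 * l) * (a * n) ≤ E := by
            calc (a:ℝ) * Real.exp (-0.295 * l) * (a * n) = (a * a) * Real.exp (-0.295 * l) * n := by ring
              _ ≤ Real.exp (0.000000002 * l) * Real.exp (-0.295 * l) * Real.exp l := by gcongr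
              _ = Real.exp (0.000000002 * l + -0.295 * l + l) := by rw [Real.exp_add, Real.exp_add]
              _ ≤ E := Real.exp_le_exp.2 (by linarith)
          have y5 : 0 < E := Real.exp_pos _
          linarith
  have h1 : 1 ≤ Real.exp (20 * E) * p := hmain.trans (mul_le_mul_of_nonneg_right hY hp0)
  rw [neg_mul, Real.exp_neg]
  rw [inv_le_iff_one_le_mul₀ (Real.exp_pos _), mul_comm]
  exact h1

end TM

namespace TM
variable {n a : ℕ} {η δ : ℝ} {K : ℕ → ℝ} {k A B M : ℝ}

lemma tsq (l x : ℝ) (n : ℕ) (n3 : (n:ℝ) = Real.exp l) :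
    -(Real.exp (x * l))^2 / (2 * n) = -(Real.exp ((2 * x - 1) * l) / 2) := by
  rw [n3, ← Real.exp_nat_mul]
  have : Real.exp ((2:ℕ) * (x * l)) = Real.exp ((2 * x - 1) * l) * Real.exp l := by
    rw [← Real.exp_add]; congr 1; push_cast; ring
  rw [this]
  have := (Real.exp_pos l).ne'
  field_simp

lemma FH.concl (h : FH n a η δ K k A B M) :
    1 - 2 * Real.exp (-Real.log n) ≤ pr (fun x : Om n => |(chiBounded (gr x) a : ℝ) - fmThreshold n a| ≤ 10 * Real.exp (0.99 * Real.log n)) := by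
  obtain ⟨hl, a1, a2, a3, hn, ha0, hsq⟩ := h.asy.basic h.η0 (by linarith [h.η1])
  obtain ⟨n1, n2, n3⟩ := h.num
  obtain ⟨k1, k2, k3⟩ := k_bounds h.asy h.prof h.M0 h.M17 h.η0 h.η1
  obtain ⟨Kc, hKc, hpr⟩ := h.high
  have hk := h.prof.hkpos
  set l := Real.log n with hldef
  set E := Real.exp (0.97 * l) with hE
  have hEpos : 0 < E := Real.exp_pos _
  have hE1 : l ≤ E := n2.trans (Real.exp_le_exp.2 (by linarith))
  have ht2 := tsq l 0.989 n n3
  have hbig : 40 * E < Real.exp ((2 * 0.989 - 1) * l) := by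
    have e : Real.exp ((2 * 0.989 - 1) * l) = Real.exp (0.008 * l) * E := by
      rw [hE, ← Real.exp_add]; congr 1; ring
    rw [e]
    apply mul_lt_mul_of_pos_right _ hEpos
    have := Real.add_one_le_exp (0.008 * l)
    linarith
  have hx : Real.exp (-(Real.exp (0.989 * l))^2 / (2 * n)) < Real.exp (-20 * E) := by
    rw [ht2]; exact Real.exp_lt_exp.2 (by linarith)
  have hx2 : Real.exp (-20 * E) ≤ Real.exp (-l) := Real.exp_le_exp.2 (by linarith)
  have hx3 : Real.exp (-l) ≤ 1/4 := by
    have e : Real.exp (-l) * Real.exp l = 1 := by rw [← Real.exp_add]; simp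
    have := Real.add_one_le_exp l
    have := Real.exp_pos (-l)
    nlinarith
  set t := Real.exp (0.989 * l) with ht
  have htpos : 0 < t := Real.exp_pos _
  have hF : ∀ y, y ≤ 0.99 → Real.exp (y * l) ≤ Real.exp (0.99 * l) := fun y hy =>
    Real.exp_le_exp.2 (mul_le_mul_of_nonneg_right hy (by linarith))
  set F := Real.exp (0.99 * l) with hFdef
  have hEF : E ≤ F := hF _ (by norm_num)
  have htF : t ≤ F := hF _ (by norm_num)
  have hF1 : 1 ≤ F := by linarith
  have hFn : 100 * F ≤ n := by
    have e : (n:ℝ) = Real.exp (0.01 * l) * F := by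
      rw [hFdef, ← Real.exp_add, ← show l = 0.01 * l + 0.99 * l by ring]; exact n3
    rw [e]
    apply mul_le_mul_of_nonneg_right _ (by linarith)
    have := Real.add_one_le_exp (0.01 * l)
    linarith
  have hfl : (⌊k⌋₊ : ℝ) ≤ k := Nat.floor_le hk.le
  have hfl2 : k < ⌊k⌋₊ + 1 := Nat.lt_floor_add_one k
  have hmain := assemble hn a ⌊k⌋₊ Kc ha0 t (Real.exp (-2 * l)) htpos.le
    (by rw [← Real.exp_zero]; exact Real.exp_lt_exp.2 (by linarith)) (fun j hj => h.low j (by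
      have : ((j + 1 : ℕ) : ℝ) ≤ ⌊k⌋₊ := by exact_mod_cast hj
      push_cast at this
      linarith)) (hx.trans_le hpr) (by linarith) (by linarith)
  have hLe : (⌊k⌋₊ : ℝ) * Real.exp (-2 * l) ≤ Real.exp (-l) := by
    calc (⌊k⌋₊ : ℝ) * Real.exp (-2 * l) ≤ Real.exp l * Real.exp (-2 * l) :=
          mul_le_mul_of_nonneg_right (by linarith) (Real.exp_pos _).le
      _ = _ := by rw [← Real.exp_add]; congr 1; ring
  refine le_trans ?_ (hmain.trans (pr_mono ?_))
  · linarith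
  · intro x hx
    linarith

lemma case2_concl (n : ℕ) (hl : 100000000000 ≤ Real.log n) :
    1 - 2 * Real.exp (-Real.log n) ≤ pr (fun x : Om n => |(chiBounded (gr x) 2 : ℝ) - fmThreshold n 2| ≤ 10 * Real.exp (0.99 * Real.log n)) := by
  have hn : 0 < n := by
    rcases Nat.eq_zero_or_pos n with h | h
    · subst h; norm_num at hl
    · exact h
  have n3 : (n:ℝ) = Real.exp (Real.log n) := (Real.exp_log (by positivity)).symm
  obtain ⟨L1, L2⟩ := l2bd
  have hlog : (Nat.log 2 n : ℝ) ≤ 1.5 * Real.log n := by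
    have h1 : ((2^Nat.log 2 n : ℕ):ℝ) ≤ n := by exact_mod_cast Nat.pow_log_le_self 2 hn.ne'
    have h2 := Real.log_le_log (by positivity) h1
    push_cast at h2
    rw [Real.log_pow] at h2
    have : (0:ℝ) ≤ Nat.log 2 n := by positivity
    nlinarith
  set l := Real.log n with hldef
  have hll : 100 * l ≤ Real.exp (0.9 * l) := by
    have := Real.quadratic_le_exp_of_nonneg (by linarith : 0 ≤ 0.9 * l)
    nlinarith
  have hF : ∀ y, y ≤ 0.99 → Real.exp (y * l) ≤ Real.exp (0.99 * l) := fun y hy =>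
    Real.exp_le_exp.2 (mul_le_mul_of_nonneg_right hy (by linarith))
  have ht2 := tsq l 0.989 n n3
  set t := Real.exp (0.989 * l) with ht
  set F := Real.exp (0.99 * l) with hFdef
  have hlF : 100 * l ≤ F := hll.trans (hF _ (by norm_num))
  have htF : t ≤ F := hF _ (by norm_num)
  have hFn : 100 * F ≤ n := by
    have e : (n:ℝ) = Real.exp (0.01 * l) * F := by
      rw [hFdef, ← Real.exp_add, ← show l = 0.01 * l + 0.99 * l by ring]; exact n3
    rw [e]
    apply mul_le_mul_of_nonneg_right _ (by linarith)
    have := Real.add_one_le_exp (0.01 * l)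
    linarith
  have hx1 : Real.exp (0.9 * l) ≤ Real.exp ((2 * 0.989 - 1) * l) := Real.exp_le_exp.2 (by linarith)
  have hx : Real.exp (-t^2/(2*n)) ≤ Real.exp (-l) := by
    rw [ht2]; exact Real.exp_le_exp.2 (by linarith)
  have hx3 : Real.exp (-l) ≤ 1/4 := by
    have e : Real.exp (-l) * Real.exp l = 1 := by rw [← Real.exp_add]; simp
    have := Real.add_one_le_exp l
    have := Real.exp_pos (-l)
    nlinarith
  have hmain := case_two n hn t (Real.exp_pos _).le (by linarith) (by linarith)
  refine le_trans ?_ (hmain.trans (pr_mono ?_))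
  · have := Real.exp_pos (-l)
    linarith
  · intro x hx
    linarith

lemma per_n : ∀ᶠ n : ℕ in atTop, ∀ a : ℕ, (n:ℝ)^(1.1:ℝ) < muExp (1/2) n a → muExp (1/2) n a < (n:ℝ)^(2.9:ℝ) →
    1 - 2 * (n:ℝ)⁻¹ ≤ pr (fun x : Om n => |(chiBounded (gr x) a : ℝ) - fmThreshold n a| ≤ 10 * (n:ℝ)^(0.99:ℝ)) := by
  have hlog : ∀ᶠ n : ℕ in atTop, 100000000000 ≤ Real.log n :=
    (Real.tendsto_log_atTop.comp tendsto_natCast_atTop_atTop).eventually_ge_atTop _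
  filter_upwards [exists_asy 0.000000001 (by norm_num), hlog, eventually_ge_atTop 1] with n h1 hl hn a ha1 ha2
  have hn' : (0:ℝ) < n := by exact_mod_cast hn
  have hn1 : (1:ℝ) ≤ n := by exact_mod_cast hn
  have e1 : (n:ℝ)⁻¹ = Real.exp (-Real.log n) := by rw [Real.exp_neg, Real.exp_log hn']
  have e2 : (n:ℝ)^(0.99:ℝ) = Real.exp (0.99 * Real.log n) := by rw [Real.rpow_def_of_pos hn', mul_comm]
  rw [e1, e2]
  have hge : (n:ℝ) ≤ (n:ℝ)^(1.1:ℝ) := by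
    have := Real.rpow_le_rpow_of_exponent_le hn1 (by norm_num : (1:ℝ) ≤ 1.1)
    rwa [Real.rpow_one] at this
  rcases Nat.lt_or_ge a 3 with h3 | h3
  · interval_cases a
    · exfalso; simp [muExp] at ha1; linarith
    · exfalso; simp [muExp] at ha1; linarith
    · exact case2_concl n hl
  · obtain ⟨δ, hδ⟩ := h1 a h3 ha1 ha2
    obtain ⟨K, k, A, B, M, hP, hM0, hM17⟩ := exists_prof hδ (by norm_num) (by norm_num)
    exact FH.concl ⟨hδ, hP, hM0, hM17, by norm_num, le_rfl⟩

end TM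

/-- Theorem 1.2: if `n^{1.1} < μ_a < n^{2.9}` then whp `χ_a(G_{n,1/2}) = k_a + O(n^{0.99})`. -/
theorem chi_bounded_near_first_moment_threshold (a : ℕ → ℕ)
    (hmu : ∀ᶠ n : ℕ in atTop,
      (n : ℝ) ^ (1.1 : ℝ) < muExp (1/2) n (a n) ∧ muExp (1/2) n (a n) < (n : ℝ) ^ (2.9 : ℝ)) :
    ∃ C : ℝ, 0 < C ∧ Tendsto
      (fun n : ℕ => Pp n (1/2) fun G =>
        |(chiBounded G (a n) : ℝ) - (fmThreshold n (a n) : ℝ)| ≤ C * (n : ℝ) ^ (0.99 : ℝ))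
      atTop (nhds 1) := by
  refine ⟨10, by norm_num, ?_⟩
  simp_rw [TM.Pp_eq_pr]
  have hlow : Tendsto (fun n : ℕ => 1 - 2 * (n:ℝ)⁻¹) atTop (nhds 1) := by
    have := (tendsto_inv_atTop_nhds_zero_nat (𝕜 := ℝ)).const_mul 2
    have := this.const_sub 1
    simpa using this
  refine tendsto_of_tendsto_of_tendsto_of_le_of_le' hlow tendsto_const_nhds ?_ ?_
  · filter_upwards [TM.per_n, hmu] with n h1 h2
    exact h1 (a n) h2.1 h2.2
  · exact Eventually.of_forall fun n => TM.pr_le_one _
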